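/- arXiv:2105.11930 — 2 statements merged into one kernel-verified Lean document; each statement's English description precedes it below -/
import Mathlib

section
/- Let X₀ be a smooth, embedded, closed plane curve with enclosed area A₀, star-shaped and centrosymmetric with respect to the origin O, and let Y(·,t), t ∈ [0, A₀/(2π)), be the solution of the curve shortening flow with Y(·,0) = X₀. Then the evolving curve shrinks to the point O as t → A₀/(2π): sup_φ |Y(φ,t) − O| → 0 as t → A₀/(2π). -/
open Real Set MeasureTheory Filter

noncomputable section

/-- Euclidean norm of a plane vector. -/
def vnorm (v : ℝ × ℝ) : ℝ := Real.sqrt (v.1 ^ 2 + v.2 ^ 2)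

/-- Determinant of the 2×2 matrix whose rows are the plane vectors `a`, `b`. -/
def vdet (a b : ℝ × ℝ) : ℝ := a.1 * b.2 - a.2 * b.1

/-- Unit tangent vector of a plane curve. -/
def unitTangent (X : ℝ → ℝ × ℝ) (φ : ℝ) : ℝ × ℝ :=
  (vnorm (deriv X φ))⁻¹ • deriv X φ

/-- Inward unit normal: the rotation of the unit tangent by +π/2. -/
def innerNormal (X : ℝ → ℝ × ℝ) (φ : ℝ) : ℝ × ℝ :=
  (-(unitTangent X φ).2, (unitTangent X φ).1)

/-- Curvature of a plane curve. -/
def curv (X : ℝ → ℝ × ℝ) (φ : ℝ) : ℝ :=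
  vdet (deriv X φ) (deriv (deriv X) φ) / vnorm (deriv X φ) ^ 3

/-- Length of a closed plane curve parametrized on `[0, 2π]`. -/
def clen (X : ℝ → ℝ × ℝ) : ℝ := ∫ φ in (0:ℝ)..(2 * π), vnorm (deriv X φ)

/-- Enclosed area of a closed plane curve. -/
def carea (X : ℝ → ℝ × ℝ) : ℝ :=
  (1 / 2) * ∫ φ in (0:ℝ)..(2 * π), vdet (X φ) (deriv X φ)

/-- A smooth closed plane curve: a smooth `2π`-periodic map `ℝ → ℝ²` with
nonvanishing derivative. -/
structure IsSmoothClosedCurve (X : ℝ → ℝ × ℝ) : Prop where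
  smooth : ContDiff ℝ (⊤ : ℕ∞) X
  periodic : Function.Periodic X (2 * π)
  regular : ∀ φ, deriv X φ ≠ 0

/-- An embedded closed curve: injective over one period. -/
def IsEmbeddedCurve (X : ℝ → ℝ × ℝ) : Prop := Set.InjOn X (Set.Ico 0 (2 * π))

/-- Star-shapedness with respect to a point `O`: `det(X − O, T) > 0` everywhere. -/
def StarShapedWrt (X : ℝ → ℝ × ℝ) (O : ℝ × ℝ) : Prop :=
  ∀ φ, 0 < vdet (X φ - O) (unitTangent X φ)

/-- Centrosymmetry with respect to a point `O`: the image of the curve is invariant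
under the point reflection `Z ↦ 2O − Z`. -/
def CentroSymmetricWrt (X : ℝ → ℝ × ℝ) (O : ℝ × ℝ) : Prop :=
  (fun Z => (2 : ℝ) • O - Z) '' Set.range X = Set.range X

/-- `X` is a smooth solution of Gage's area-preserving flow on the time set `I`
with initial curve `X₀`: `∂X/∂t = α T + (κ − 2π/L) N`. -/
structure IsGAPFSolutionOn (X : ℝ → ℝ → ℝ × ℝ) (X₀ : ℝ → ℝ × ℝ) (I : Set ℝ) : Prop where
  init : ∀ φ, X 0 φ = X₀ φ
  curve : ∀ t ∈ I, IsSmoothClosedCurve (X t)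
  smooth : ContDiffOn ℝ (⊤ : ℕ∞) (fun p : ℝ × ℝ => X p.1 p.2) (I ×ˢ Set.univ)
  flow : ∃ α : ℝ → ℝ → ℝ,
    ∀ t ∈ I, ∀ φ,
      HasDerivWithinAt (fun τ => X τ φ)
        (α t φ • unitTangent (X t) φ +
          (curv (X t) φ - 2 * π / clen (X t)) • innerNormal (X t) φ) I t
/-- `Y` is a smooth solution of the curve shortening flow (up to a tangential term)
on the time set `I` with initial curve `X₀`: `∂Y/∂t = α T + κ N`. -/
structure IsCSFSolutionOn (Y : ℝ → ℝ → ℝ × ℝ) (X₀ : ℝ → ℝ × ℝ) (I : Set ℝ) : Prop where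
  init : ∀ φ, Y 0 φ = X₀ φ
  curve : ∀ t ∈ I, IsSmoothClosedCurve (Y t)
  smooth : ContDiffOn ℝ (⊤ : ℕ∞) (fun p : ℝ × ℝ => Y p.1 p.2) (I ×ˢ Set.univ)
  flow : ∃ α : ℝ → ℝ → ℝ,
    ∀ t ∈ I, ∀ φ,
      HasDerivWithinAt (fun τ => Y τ φ)
        (α t φ • unitTangent (Y t) φ + curv (Y t) φ • innerNormal (Y t) φ) I t

section

open Real Set MeasureTheory Filter Topology
noncomputable section

def dP (H : ℝ → ℝ → ℝ) : ℝ → ℝ → ℝ := fun t φ => deriv (H t) φ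
def dT (H : ℝ → ℝ → ℝ) : ℝ → ℝ → ℝ := fun t φ => deriv (fun τ => H τ φ) t
def Sm (I : Set ℝ) (H : ℝ → ℝ → ℝ) : Prop :=
  ContDiffOn ℝ (⊤ : ℕ∞) (fun p : ℝ × ℝ => H p.1 p.2) (I ×ˢ (Set.univ : Set ℝ))

lemma Sm.mono {I J : Set ℝ} {H} (h : Sm I H) (hJ : J ⊆ I) : Sm J H :=
  ContDiffOn.mono h (Set.prod_mono hJ subset_rfl)

lemma Sm.hasDerivAt' {I : Set ℝ} {H} (h : Sm I H) {t φ : ℝ} (ht : t ∈ I) :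
    HasDerivAt (H t) (fderivWithin ℝ (fun p : ℝ × ℝ => H p.1 p.2) (I ×ˢ (Set.univ : Set ℝ)) (t, φ) (0, 1)) φ := by
  have h1 := (h.differentiableOn (by simp) (t, φ) ⟨ht, mem_univ _⟩).hasFDerivWithinAt
  have h2 : HasDerivAt (fun x : ℝ => (t, x)) ((0:ℝ), (1:ℝ)) φ :=
    (hasDerivAt_const φ t).prodMk (hasDerivAt_id φ)
  have h3 := h1.comp_hasDerivWithinAt φ (s := univ) h2.hasDerivWithinAt (fun x _ => ⟨ht, mem_univ _⟩)
  exact (hasDerivWithinAt_univ.1 h3)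

lemma Sm.hasDerivAt {I : Set ℝ} {H} (h : Sm I H) {t : ℝ} (ht : t ∈ I) (φ : ℝ) :
    HasDerivAt (H t) (dP H t φ) φ := by
  have := h.hasDerivAt' (φ := φ) ht
  unfold dP
  rwa [this.deriv]

lemma Sm.dP {I : Set ℝ} {H} (h : Sm I H) (hI : UniqueDiffOn ℝ I) : Sm I (dP H) := by
  have h1 := (ContDiffOn.fderivWithin h (hI.prod uniqueDiffOn_univ) (m := (⊤ : ℕ∞)) (by simp))
  have h2 := h1.clm_apply (g := fun _ => ((0:ℝ),(1:ℝ))) contDiffOn_const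
  refine h2.congr ?_
  rintro ⟨t, φ⟩ ⟨ht, -⟩
  exact (h.hasDerivAt' ht).deriv

lemma Sm.hasDerivAt_t' {I : Set ℝ} (hI : IsOpen I) {H} (h : Sm I H) {t φ : ℝ} (ht : t ∈ I) :
    HasDerivAt (fun τ => H τ φ) (fderiv ℝ (fun p : ℝ × ℝ => H p.1 p.2) (t, φ) (1, 0)) t := by
  have h1 := ((h.contDiffAt ((hI.prod isOpen_univ).mem_nhds (⟨ht, mem_univ _⟩ : (t, φ) ∈ I ×ˢ univ))).differentiableAt (by simp)).hasFDerivAt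
  have h2 : HasDerivAt (fun x : ℝ => (x, φ)) ((1:ℝ), (0:ℝ)) t :=
    (hasDerivAt_id t).prodMk (hasDerivAt_const t φ)
  exact h1.comp_hasDerivAt t h2

lemma Sm.hasDerivAt_t {I : Set ℝ} (hI : IsOpen I) {H} (h : Sm I H) {t : ℝ} (ht : t ∈ I) (φ : ℝ) :
    HasDerivAt (fun τ => H τ φ) (dT H t φ) t := by
  have := h.hasDerivAt_t' hI (φ := φ) ht
  unfold dT
  rwa [this.deriv]

lemma Sm.dT {I : Set ℝ} (hI : IsOpen I) {H} (h : Sm I H) : Sm I (dT H) := by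
  have h1 := (ContDiffOn.fderiv_of_isOpen h (hI.prod isOpen_univ) (m := (⊤ : ℕ∞)) (by simp))
  have h2 := h1.clm_apply (g := fun _ => ((1:ℝ),(0:ℝ))) contDiffOn_const
  refine h2.congr ?_
  rintro ⟨t, φ⟩ ⟨ht, -⟩
  exact (h.hasDerivAt_t' hI ht).deriv

lemma Sm.comm {I : Set ℝ} (hI : IsOpen I) {H} (h : Sm I H) {t φ : ℝ} (ht : t ∈ I) :
    _root_.dT (_root_.dP H) t φ = _root_.dP (_root_.dT H) t φ := by
  set F : ℝ × ℝ → ℝ := fun p => H p.1 p.2 with hF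
  have hmem : ∀ s ∈ I, ∀ x : ℝ, I ×ˢ (univ : Set ℝ) ∈ 𝓝 (s, x) := fun s hs x =>
    (hI.prod isOpen_univ).mem_nhds ⟨hs, mem_univ _⟩
  have hc : ContDiffAt ℝ (⊤ : ℕ∞) F (t, φ) := h.contDiffAt (hmem t ht φ)
  have hsymm : IsSymmSndFDerivAt ℝ F (t, φ) :=
    hc.isSymmSndFDerivAt (by simp only [minSmoothness_of_isRCLikeNormedField]; exact WithTop.coe_le_coe.2 (le_top : (2:ℕ∞) ≤ ⊤))
  have hd : DifferentiableAt ℝ (fderiv ℝ F) (t, φ) :=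
    ((hc.fderiv_right (m := (⊤ : ℕ∞)) (by simp)).differentiableAt (by simp))
  have e1 : _root_.dT (_root_.dP H) t φ = fderiv ℝ (fderiv ℝ F) (t, φ) (1, 0) (0, 1) := by
    have h2 : HasDerivAt (fun x : ℝ => (x, φ)) ((1:ℝ), (0:ℝ)) t :=
      (hasDerivAt_id t).prodMk (hasDerivAt_const t φ)
    have h3 := (ContinuousLinearMap.apply ℝ ℝ ((0:ℝ),(1:ℝ))).hasFDerivAt.comp_hasDerivAt t (hd.hasFDerivAt.comp_hasDerivAt t h2)
    have h4 : (fun τ => _root_.dP H τ φ) =ᶠ[𝓝 t] fun τ => fderiv ℝ F (τ, φ) (0, 1) := by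
      filter_upwards [hI.mem_nhds ht] with τ hτ
      have := h.hasDerivAt' (φ := φ) hτ
      rw [fderivWithin_of_mem_nhds (hmem τ hτ φ)] at this
      exact this.deriv
    have h5 := (h3.congr_of_eventuallyEq h4).deriv
    exact h5
  have e2 : _root_.dP (_root_.dT H) t φ = fderiv ℝ (fderiv ℝ F) (t, φ) (0, 1) (1, 0) := by
    have h2 : HasDerivAt (fun x : ℝ => (t, x)) ((0:ℝ), (1:ℝ)) φ :=
      (hasDerivAt_const φ t).prodMk (hasDerivAt_id φ)
    have h3 := (ContinuousLinearMap.apply ℝ ℝ ((1:ℝ),(0:ℝ))).hasFDerivAt.comp_hasDerivAt φ (hd.hasFDerivAt.comp_hasDerivAt φ h2)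
    have h4 : (_root_.dT H t) = fun x => fderiv ℝ F (t, x) (1, 0) := by
      funext x
      exact (h.hasDerivAt_t' hI (φ := x) ht).deriv
    have h5 := h3.deriv
    unfold _root_.dP
    rw [h4]
    exact h5
  rw [e1, e2, hsymm.eq]

lemma Sm.cont {I : Set ℝ} {H} (h : Sm I H) : ContinuousOn (fun p : ℝ × ℝ => H p.1 p.2) (I ×ˢ (Set.univ : Set ℝ)) :=
  ContDiffOn.continuousOn h

/-- First violation time. -/
lemma first_time {E : Type*} [TopologicalSpace E] {K : Set E} (hK : IsCompact K) {t1 : ℝ}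
    {f : ℝ → E → ℝ} (hf : ContinuousOn (fun p : ℝ × E => f p.1 p.2) (Icc 0 t1 ×ˢ K))
    (h0 : ∀ x ∈ K, 0 < f 0 x) (hv : ∃ t ∈ Icc 0 t1, ∃ x ∈ K, f t x ≤ 0) :
    ∃ t0 ∈ Ioc 0 t1, ∃ x0 ∈ K, f t0 x0 = 0 ∧ ∀ t ∈ Icc 0 t0, ∀ x ∈ K, 0 ≤ f t x := by
  have hcpt : IsCompact (Icc 0 t1 ×ˢ K) := isCompact_Icc.prod hK
  have hpc : IsCompact ((Icc 0 t1 ×ˢ K) ∩ (fun p : ℝ × E => f p.1 p.2) ⁻¹' Iic 0) := by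
    obtain ⟨V, hV, hVe⟩ := continuousOn_iff_isClosed.1 hf (Iic 0) isClosed_Iic
    rw [inter_comm, hVe, inter_comm]
    exact hcpt.inter_right hV
  have hcl : IsCompact (Prod.fst '' ((Icc 0 t1 ×ˢ K) ∩ (fun p : ℝ × E => f p.1 p.2) ⁻¹' Iic 0)) :=
    hpc.image continuous_fst
  have hne : (Prod.fst '' ((Icc 0 t1 ×ˢ K) ∩ (fun p : ℝ × E => f p.1 p.2) ⁻¹' Iic 0)).Nonempty := by
    obtain ⟨t, ht, x, hx, h⟩ := hv
    exact ⟨t, (t, x), ⟨⟨ht, hx⟩, h⟩, rfl⟩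
  obtain ⟨t0, ⟨⟨_, x0⟩, ⟨⟨ht0, hx0⟩, hle⟩, rfl⟩, hleast⟩ := hcl.exists_isLeast hne
  simp only at ht0 hx0 hle hleast
  rename_i t0
  have hle' : f t0 x0 ≤ 0 := hle
  have hpos : ∀ t ∈ Icc 0 t1, t < t0 → ∀ x ∈ K, 0 < f t x := by
    intro t ht htt x hx
    by_contra hc
    exact absurd (hleast ⟨(t, x), ⟨⟨ht, hx⟩, not_lt.1 hc⟩, rfl⟩) (not_le.2 htt)
  have ht0p : 0 < t0 := by
    rcases ht0.1.lt_or_eq with h | h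
    · exact h
    · exact absurd (h ▸ h0 x0 hx0 : 0 < f t0 x0) (not_lt.2 hle')
  have hge : ∀ x ∈ K, 0 ≤ f t0 x := by
    intro x hx
    have hcx : ContinuousOn (fun t => f t x) (Icc 0 t1) :=
      hf.comp (f := fun t : ℝ => (t, x)) (by fun_prop) (fun t ht => ⟨ht, hx⟩)
    have h1 : Tendsto (fun t => f t x) (𝓝[Ioo 0 t0] t0) (𝓝 (f t0 x)) :=
      (hcx t0 ht0).mono_left (nhdsWithin_mono _ (fun t ht => ⟨ht.1.le, ht.2.le.trans ht0.2⟩))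
    have : (𝓝[Ioo 0 t0] t0).NeBot := by
      rw [← mem_closure_iff_nhdsWithin_neBot, closure_Ioo ht0p.ne]
      exact ⟨ht0p.le, le_rfl⟩
    refine ge_of_tendsto h1 ?_
    filter_upwards [self_mem_nhdsWithin] with t ht
    exact (hpos t ⟨ht.1.le, ht.2.le.trans ht0.2⟩ ht.2 x hx).le
  refine ⟨t0, ⟨ht0p, ht0.2⟩, x0, hx0, le_antisymm hle' (hge x0 hx0), ?_⟩
  intro t ht x hx
  rcases ht.2.lt_or_eq with h | h
  · exact (hpos t ⟨ht.1, ht.2.trans ht0.2⟩ h x hx).le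
  · rw [h]; exact hge x hx
end

end

section

open Real Set MeasureTheory Filter Topology
noncomputable section

lemma second_deriv_test {f f' : ℝ → ℝ} {x c : ℝ} (hf : ∀ y, HasDerivAt f (f' y) y)
    (hf' : HasDerivAt f' c x) (hmin : ∀ y, f x ≤ f y) : f' x = 0 ∧ 0 ≤ c := by
  have h0 : f' x = 0 := IsLocalMin.hasDerivAt_eq_zero (Filter.Eventually.of_forall hmin) (hf x)
  refine ⟨h0, ?_⟩
  by_contra hc
  push Not at hc
  have h1 := (hasDerivAt_iff_tendsto_slope.1 hf').eventually (gt_mem_nhds hc)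
  rw [eventually_nhdsWithin_iff, Metric.eventually_nhds_iff] at h1
  obtain ⟨δ, hδ, h1⟩ := h1
  obtain ⟨z, hz, hz2⟩ := exists_hasDerivAt_eq_slope f f' (show x < x + δ / 2 by linarith)
    (fun y _ => (hf y).continuousAt.continuousWithinAt) (fun y _ => hf y)
  have h2 : slope f' x z < 0 := h1 (by rw [Real.dist_eq, abs_of_pos (by linarith [hz.1])]; linarith [hz.2]) (by
    simp only [mem_compl_iff, mem_singleton_iff]; exact hz.1.ne')
  rw [slope_def_field, h0, hz2] at h2
  have : 0 ≤ ((f (x + δ / 2) - f x) / (x + δ / 2 - x) - 0) / (z - x) := by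
    apply div_nonneg _ (by linarith [hz.1])
    rw [sub_zero]
    exact div_nonneg (by linarith [hmin (x + δ / 2)]) (by linarith)
  linarith

lemma left_deriv_test {f : ℝ → ℝ} {t0 c : ℝ} (ht0 : 0 < t0) (hf : HasDerivAt f c t0)
    (h0 : f t0 = 0) (hge : ∀ t ∈ Icc 0 t0, 0 ≤ f t) : c ≤ 0 := by
  have h1 := (hasDerivAt_iff_tendsto_slope.1 hf)
  have h2 : Tendsto (slope f t0) (𝓝[Ioo 0 t0] t0) (𝓝 c) :=
    h1.mono_left (nhdsWithin_mono _ (fun t ht => ht.2.ne))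
  have : (𝓝[Ioo 0 t0] t0).NeBot := by
    rw [← mem_closure_iff_nhdsWithin_neBot, closure_Ioo ht0.ne]
    exact ⟨ht0.le, le_rfl⟩
  refine le_of_tendsto h2 ?_
  filter_upwards [self_mem_nhdsWithin] with t ht
  rw [slope_def_field, h0, sub_zero]
  exact div_nonpos_of_nonneg_of_nonpos (hge t ⟨ht.1.le, ht.2.le⟩) (by linarith [ht.2])

structure CSF (T : ℝ) (a b : ℝ → ℝ → ℝ) : Prop where
  sa : Sm (Ico 0 T) a
  sb : Sm (Ico 0 T) b
  per_a : ∀ t ∈ Ico 0 T, Function.Periodic (a t) (2 * π)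
  per_b : ∀ t ∈ Ico 0 T, Function.Periodic (b t) (2 * π)
  reg : ∀ t ∈ Ico 0 T, ∀ φ, 0 < dP a t φ ^ 2 + dP b t φ ^ 2
  flow : ∀ t ∈ Ioo 0 T, ∀ φ,
    (dT a t φ * dP b t φ - dT b t φ * dP a t φ) * (dP a t φ ^ 2 + dP b t φ ^ 2) =
      -(dP a t φ * dP (dP b) t φ - dP b t φ * dP (dP a) t φ)
  emb : ∀ t ∈ Ico 0 T, ∀ φ ψ, φ < ψ → ψ < φ + 2 * π → ¬ (a t φ = a t ψ ∧ b t φ = b t ψ)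

lemma dP_periodic {H : ℝ → ℝ → ℝ} {t : ℝ} (h : Function.Periodic (H t) (2 * π)) :
    Function.Periodic (dP H t) (2 * π) := by
  intro φ
  unfold dP
  rw [← deriv_comp_add_const]
  congr 1
  funext x
  exact h x

lemma exists_mod (φ : ℝ) : ∃ φ' ∈ Icc 0 (2 * π), ∀ {α : Type} (f : ℝ → α), Function.Periodic f (2 * π) → f φ' = f φ := by
  refine ⟨toIcoMod Real.two_pi_pos 0 φ, ?_, ?_⟩
  · have := toIcoMod_mem_Ico Real.two_pi_pos 0 φ
    rw [zero_add] at this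
    exact ⟨this.1, this.2.le⟩
  · intro α f hf
    rw [← self_sub_toIcoDiv_zsmul]
    exact hf.sub_zsmul_eq _

lemma starA_algebra {A B x y x2 y2 x3 y3 at' bt xt yt g c ε : ℝ} (hg : 0 < g) (hg2 : g ^ 2 = x ^ 2 + y ^ 2)
    (hε : 0 < ε) (hP : A * y - B * x = c * g) (hc0 : 0 < c) (hc : c ^ 2 < A ^ 2 + B ^ 2)
    (h1 : A * y2 - B * x2 - c * (x2 * (x / g) + y2 * (y / g)) = 0)
    (h2 : 0 ≤ x * y2 - y * x2 + (A * y3 - B * x3) - c * (x3 * (x / g) + y3 * (y / g)))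
    (h3 : at' * y - bt * x + (A * yt - B * xt) + ε * (x * (x / g) + y * (y / g))
        - c * (xt * (x / g) + yt * (y / g)) ≤ 0)
    (hf : (at' * y - bt * x) * (x ^ 2 + y ^ 2) = -(x * y2 - y * x2))
    (hdf : (xt * y + at' * y2 - (yt * x + bt * x2)) * (x ^ 2 + y ^ 2)
      + (at' * y - bt * x) * (2 * (x * x2 + y * y2)) = -(x * y3 - y * x3)) : False := by
  have key : ∀ Z1 Z2 : ℝ, A * Z2 - B * Z1 - c * (Z1 * (x / g) + Z2 * (y / g))
      = (A * x + B * y) * (x * Z2 - y * Z1) / g ^ 2 := by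
    intro Z1 Z2
    have e1 : A * g ^ 2 - c * g * y = x * (A * x + B * y) := by rw [← hP, hg2]; ring
    have e2 : B * g ^ 2 + c * g * x = y * (A * x + B * y) := by rw [← hP, hg2]; ring
    field_simp
    linear_combination Z2 * e1 - Z1 * e2
  set S := A * x + B * y with hS
  have hS0 : S ≠ 0 := by
    intro h
    have : S ^ 2 + (A * y - B * x) ^ 2 = (A ^ 2 + B ^ 2) * g ^ 2 := by rw [hg2, hS]; ring
    rw [h, hP] at this
    nlinarith [mul_pos (sub_pos.2 hc) (pow_pos hg 2)]
  have hg2p : 0 < g ^ 2 := by positivity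
  rw [key] at h1
  have hk : x * y2 - y * x2 = 0 := by
    rcases div_eq_zero_iff.1 h1 with h | h
    · exact (mul_eq_zero.1 h).resolve_left hS0
    · exact absurd h hg2p.ne'
  have h2' : 0 ≤ S * (x * y3 - y * x3) / g ^ 2 := by rw [← key]; linarith
  have h2'' : 0 ≤ S * (x * y3 - y * x3) := by
    rcases div_nonneg_iff.1 h2' with h | h
    · exact h.1
    · linarith [h.2]
  have hf0 : at' * y - bt * x = 0 := by
    rw [hk, neg_zero, ← hg2] at hf
    exact (mul_eq_zero.1 hf).resolve_right hg2p.ne'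
  have h4 : at' * y2 - bt * x2 = 0 := by
    have : g ^ 2 * (at' * y2 - bt * x2) = 0 := by
      rw [hg2]; linear_combination (at' * x + bt * y) * hk + (x * x2 + y * y2) * hf0
    exact (mul_eq_zero.1 this).resolve_left hg2p.ne'
  have h5 : (x * yt - y * xt) * g ^ 2 = x * y3 - y * x3 := by
    rw [hg2]; linear_combination -hdf + (x ^ 2 + y ^ 2) * h4 + (2 * (x * x2 + y * y2)) * hf0
  have h6 : 0 ≤ S * (x * yt - y * xt) / g ^ 2 := by
    apply div_nonneg _ hg2p.le
    have : S * (x * y3 - y * x3) = S * (x * yt - y * xt) * g ^ 2 := by rw [← h5]; ring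
    rw [this] at h2''
    exact nonneg_of_mul_nonneg_left h2'' hg2p
  rw [← key] at h6
  have h7 : x * (x / g) + y * (y / g) = g := by
    field_simp; linarith
  rw [h7] at h3
  nlinarith [mul_pos hε hg]

end

end

section

open Real Set MeasureTheory Filter Topology
noncomputable section

namespace CSF
variable {T : ℝ} {a b : ℝ → ℝ → ℝ}

lemma ioo_ico : Ioo (0:ℝ) T ⊆ Ico 0 T := Ioo_subset_Ico_self

lemma ud_ico : UniqueDiffOn ℝ (Ico (0:ℝ) T) := uniqueDiffOn_Ico 0 T
lemma ud_ioo : UniqueDiffOn ℝ (Ioo (0:ℝ) T) := uniqueDiffOn_Ioo 0 T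

lemma exists_pos_lower {f : ℝ × ℝ → ℝ} {K : Set (ℝ × ℝ)} (hK : IsCompact K) (hf : ContinuousOn f K)
    (hpos : ∀ p ∈ K, 0 < f p) : ∃ m > 0, ∀ p ∈ K, m ≤ f p := by
  rcases K.eq_empty_or_nonempty with h | h
  · exact ⟨1, one_pos, by simp [h]⟩
  · obtain ⟨p, hp, hm⟩ := hK.exists_isMinOn h hf
    exact ⟨f p, hpos p hp, fun q hq => hm hq⟩

set_option maxHeartbeats 2000000 in
/-- Star-shapedness is preserved as long as the curve does not reach the origin. -/
theorem star (h : CSF T a b) {t1 : ℝ} (ht1 : t1 ∈ Ico 0 T)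
    (hne : ∀ t ∈ Icc 0 t1, ∀ φ, 0 < a t φ ^ 2 + b t φ ^ 2)
    (h0 : ∀ φ, 0 < a 0 φ * dP b 0 φ - b 0 φ * dP a 0 φ) :
    ∀ t ∈ Icc 0 t1, ∀ φ, 0 < a t φ * dP b t φ - b t φ * dP a t φ := by
  have hsub : Icc 0 t1 ⊆ Ico 0 T := fun t ht => ⟨ht.1, ht.2.trans_lt ht1.2⟩
  have hsubK : Icc 0 t1 ×ˢ Icc 0 (2 * π) ⊆ Ico 0 T ×ˢ (univ : Set ℝ) := Set.prod_mono hsub (subset_univ _)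
  have hcpt : IsCompact (Icc (0:ℝ) t1 ×ˢ Icc (0:ℝ) (2 * π)) := isCompact_Icc.prod isCompact_Icc
  have ca := h.sa.cont.mono hsubK
  have cb := h.sb.cont.mono hsubK
  have sa1 := h.sa.dP ud_ico
  have sb1 := h.sb.dP ud_ico
  have ca1 := sa1.cont.mono hsubK
  have cb1 := sb1.cont.mono hsubK
  obtain ⟨m, hm, hmle⟩ := exists_pos_lower (f := fun p => a p.1 p.2 ^ 2 + b p.1 p.2 ^ 2) hcpt
    ((ca.pow 2).add (cb.pow 2)) (fun p hp => hne p.1 hp.1 p.2)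
  obtain ⟨q, hq, hqle⟩ := exists_pos_lower
    (f := fun p => (a p.1 p.2 * dP b p.1 p.2 - b p.1 p.2 * dP a p.1 p.2) / √(dP a p.1 p.2 ^ 2 + dP b p.1 p.2 ^ 2))
    (K := {(0:ℝ)} ×ˢ Icc 0 (2 * π)) (isCompact_singleton.prod isCompact_Icc)
    (by
      have hs : {(0:ℝ)} ×ˢ Icc 0 (2 * π) ⊆ Icc 0 t1 ×ˢ Icc 0 (2 * π) :=
        Set.prod_mono (by simpa using ht1.1) subset_rfl
      refine ContinuousOn.div (((ca.mono hs).mul (cb1.mono hs)).sub ((cb.mono hs).mul (ca1.mono hs)))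
        ((((ca1.mono hs).pow 2).add ((cb1.mono hs).pow 2)).sqrt) ?_
      intro p hp
      exact (Real.sqrt_pos.2 (h.reg p.1 (hsub (hs hp).1) p.2)).ne')
    (by
      rintro ⟨t, φ⟩ ⟨ht, -⟩
      have ht' : t = 0 := ht
      subst ht'
      exact div_pos (h0 φ) (Real.sqrt_pos.2 (h.reg 0 ⟨le_rfl, ht1.1.trans_lt ht1.2⟩ φ)))
  set δ := min (√m) q / 2 with hδ
  have hsm : 0 < √m := Real.sqrt_pos.2 hm
  have hδ0 : 0 < δ := by rw [hδ]; exact div_pos (lt_min hsm hq) two_pos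
  have hδm : δ < √m := by
    have := min_le_left (√m) q
    rw [hδ]; linarith
  have hδq : δ < q := by
    have := min_le_right (√m) q
    rw [hδ]; linarith
  set ε := δ / (2 * (t1 + 1)) with hε
  have ht1p : 0 < t1 + 1 := by linarith [ht1.1]
  have hε0 : 0 < ε := by positivity
  have hεt : ∀ t ∈ Icc 0 t1, 0 < δ - ε * t := by
    intro t ht
    have : ε * (2 * (t1 + 1)) = δ := by rw [hε]; field_simp
    nlinarith [ht.1, ht.2]
  by_contra hcon
  push Not at hcon
  obtain ⟨tb, htb, φb, hb⟩ := hcon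
  set f : ℝ → ℝ → ℝ := fun t φ => a t φ * dP b t φ - b t φ * dP a t φ
    - (δ - ε * t) * √(dP a t φ ^ 2 + dP b t φ ^ 2) with hf
  have hfper : ∀ t ∈ Icc 0 t1, Function.Periodic (f t) (2 * π) := by
    intro t ht φ
    have h1 := h.per_a t (hsub ht)
    have h2 := h.per_b t (hsub ht)
    simp only [hf]
    rw [h1 φ, h2 φ, dP_periodic h1 φ, dP_periodic h2 φ]
  have hfc : ContinuousOn (fun p : ℝ × ℝ => f p.1 p.2) (Icc 0 t1 ×ˢ Icc 0 (2 * π)) := by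
    refine ((ca.mul cb1).sub (cb.mul ca1)).sub (ContinuousOn.mul (by fun_prop) (((ca1.pow 2).add (cb1.pow 2)).sqrt))
  obtain ⟨t0, ht0, φ0, -, hz, hge⟩ := first_time isCompact_Icc hfc
    (by
      intro φ hφ
      have h1 := hqle (0, φ) ⟨rfl, hφ⟩
      have hg := Real.sqrt_pos.2 (h.reg 0 ⟨le_rfl, ht1.1.trans_lt ht1.2⟩ φ)
      simp only at h1
      rw [le_div_iff₀ hg] at h1
      simp only [hf]
      nlinarith)
    (by
      obtain ⟨φ', hφ', hp⟩ := exists_mod φb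
      refine ⟨tb, htb, φ', hφ', ?_⟩
      rw [hp (f tb) (hfper tb htb)]
      simp only [hf]
      have := mul_nonneg (hεt tb htb).le (Real.sqrt_nonneg (dP a tb φb ^ 2 + dP b tb φb ^ 2))
      linarith)
  have ht0' : t0 ∈ Icc 0 t1 := ⟨ht0.1.le, ht0.2⟩
  have ht0o : t0 ∈ Ioo 0 T := ⟨ht0.1, ht0.2.trans_lt ht1.2⟩
  have ht0s := ioo_ico ht0o
  have hge' : ∀ t ∈ Icc 0 t0, ∀ φ, 0 ≤ f t φ := by
    intro t ht φ
    obtain ⟨φ', hφ', hp⟩ := exists_mod φ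
    rw [← hp (f t) (hfper t ⟨ht.1, ht.2.trans ht0.2⟩)]
    exact hge t ht φ' hφ'
  set g := √(dP a t0 φ0 ^ 2 + dP b t0 φ0 ^ 2) with hg
  have hgp : 0 < g := Real.sqrt_pos.2 (h.reg t0 ht0s φ0)
  have hg2 : g ^ 2 = dP a t0 φ0 ^ 2 + dP b t0 φ0 ^ 2 := Real.sq_sqrt (h.reg t0 ht0s φ0).le
  set e1 := dP a t0 φ0 / g with he1
  set e2 := dP b t0 φ0 / g with he2
  have hee : e1 ^ 2 + e2 ^ 2 = 1 := by
    rw [he1, he2]; field_simp; linarith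
  set F : ℝ → ℝ → ℝ := fun t φ => a t φ * dP b t φ - b t φ * dP a t φ
    - (δ - ε * t) * (dP a t φ * e1 + dP b t φ * e2) with hF
  have hFz : F t0 φ0 = 0 := by
    have : dP a t0 φ0 * e1 + dP b t0 φ0 * e2 = g := by
      rw [he1, he2]; field_simp; linarith
    simp only [hF]
    rw [this]
    exact hz
  have hFge : ∀ t ∈ Icc 0 t0, ∀ φ, 0 ≤ F t φ := by
    intro t ht φ
    have h1 := hge' t ht φ
    have h2 : dP a t φ * e1 + dP b t φ * e2 ≤ √(dP a t φ ^ 2 + dP b t φ ^ 2) := by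
      apply Real.le_sqrt_of_sq_le
      nlinarith [sq_nonneg (dP a t φ * e2 - dP b t φ * e1)]
    have h3 := mul_le_mul_of_nonneg_left h2 (hεt t ⟨ht.1, ht.2.trans ht0.2⟩).le
    simp only [hf] at h1
    simp only [hF]
    linarith
  have oa := h.sa.mono (ioo_ico (T := T))
  have ob := h.sb.mono (ioo_ico (T := T))
  have oa1 := oa.dP ud_ioo
  have ob1 := ob.dP ud_ioo
  have oa2 := oa1.dP ud_ioo
  have ob2 := ob1.dP ud_ioo
  have oat := oa.dT isOpen_Ioo
  have obt := ob.dT isOpen_Ioo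
  set c := δ - ε * t0 with hc
  have hcp : 0 < c := hεt t0 ht0'
  -- spatial derivatives
  have hd1 : ∀ φ, HasDerivAt (F t0) (a t0 φ * dP (dP b) t0 φ - b t0 φ * dP (dP a) t0 φ
      - c * (dP (dP a) t0 φ * e1 + dP (dP b) t0 φ * e2)) φ := by
    intro φ
    have := (((oa.hasDerivAt ht0o φ).mul (ob1.hasDerivAt ht0o φ)).sub
      ((ob.hasDerivAt ht0o φ).mul (oa1.hasDerivAt ht0o φ))).sub
      ((((oa1.hasDerivAt ht0o φ).mul_const e1).add ((ob1.hasDerivAt ht0o φ).mul_const e2)).const_mul c)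
    refine this.congr_deriv ?_
    ring
  have hd2 : HasDerivAt (fun φ => a t0 φ * dP (dP b) t0 φ - b t0 φ * dP (dP a) t0 φ
      - c * (dP (dP a) t0 φ * e1 + dP (dP b) t0 φ * e2))
      (dP a t0 φ0 * dP (dP b) t0 φ0 - dP b t0 φ0 * dP (dP a) t0 φ0 +
        (a t0 φ0 * dP (dP (dP b)) t0 φ0 - b t0 φ0 * dP (dP (dP a)) t0 φ0)
        - c * (dP (dP (dP a)) t0 φ0 * e1 + dP (dP (dP b)) t0 φ0 * e2)) φ0 := by
    have := (((oa.hasDerivAt ht0o φ0).mul (ob2.hasDerivAt ht0o φ0)).sub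
      ((ob.hasDerivAt ht0o φ0).mul (oa2.hasDerivAt ht0o φ0))).sub
      ((((oa2.hasDerivAt ht0o φ0).mul_const e1).add ((ob2.hasDerivAt ht0o φ0).mul_const e2)).const_mul c)
    refine this.congr_deriv ?_
    ring
  obtain ⟨k1, k2⟩ := second_deriv_test hd1 hd2 (fun φ => by
    rw [hFz]; exact hFge t0 ⟨ht0.1.le, le_rfl⟩ φ)
  have hd3 : HasDerivAt (fun t => F t φ0) (dT a t0 φ0 * dP b t0 φ0 - dT b t0 φ0 * dP a t0 φ0 +
      (a t0 φ0 * dT (dP b) t0 φ0 - b t0 φ0 * dT (dP a) t0 φ0)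
      + ε * (dP a t0 φ0 * e1 + dP b t0 φ0 * e2)
      - c * (dT (dP a) t0 φ0 * e1 + dT (dP b) t0 φ0 * e2)) t0 := by
    have hlin : HasDerivAt (fun t => δ - ε * t) (-ε) t0 := by
      simpa using ((hasDerivAt_id t0).const_mul ε).const_sub δ
    have := (((oa.hasDerivAt_t isOpen_Ioo ht0o φ0).mul (ob1.hasDerivAt_t isOpen_Ioo ht0o φ0)).sub
      ((ob.hasDerivAt_t isOpen_Ioo ht0o φ0).mul (oa1.hasDerivAt_t isOpen_Ioo ht0o φ0))).sub
      (hlin.mul (((oa1.hasDerivAt_t isOpen_Ioo ht0o φ0).mul_const e1).add ((ob1.hasDerivAt_t isOpen_Ioo ht0o φ0).mul_const e2)))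
    refine this.congr_deriv ?_
    simp only [Pi.add_apply]
    rw [← hc]
    ring
  have k3 := left_deriv_test ht0.1 hd3 hFz (fun t ht => hFge t ht φ0)
  rw [oa.comm isOpen_Ioo ht0o, ob.comm isOpen_Ioo ht0o] at k3
  -- differentiate the flow equation
  have hfl := h.flow t0 ht0o
  have hdl := (((oat.hasDerivAt ht0o φ0).mul (ob1.hasDerivAt ht0o φ0)).sub
      ((obt.hasDerivAt ht0o φ0).mul (oa1.hasDerivAt ht0o φ0))).mul
      (((oa1.hasDerivAt ht0o φ0).pow 2).add ((ob1.hasDerivAt ht0o φ0).pow 2))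
  have hdr := (((oa1.hasDerivAt ht0o φ0).mul (ob2.hasDerivAt ht0o φ0)).sub
      ((ob1.hasDerivAt ht0o φ0).mul (oa2.hasDerivAt ht0o φ0))).neg
  have hfl2 := hdl.unique (hdr.congr_of_eventuallyEq (Filter.Eventually.of_forall (fun φ => by
    simpa using hfl φ)))
  have hcm : c ^ 2 < a t0 φ0 ^ 2 + b t0 φ0 ^ 2 := by
    obtain ⟨φ', hφ', hp⟩ := exists_mod φ0
    have h1 := hmle (t0, φ') ⟨ht0', hφ'⟩
    simp only at h1
    rw [hp _ (h.per_a t0 ht0s), hp _ (h.per_b t0 ht0s)] at h1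
    have h2 : c < √m := by
      have : 0 < ε * t0 := mul_pos hε0 ht0.1
      rw [hc]; linarith
    have h3 := Real.sq_sqrt hm.le
    have h4 : c ^ 2 < √m ^ 2 := pow_lt_pow_left₀ h2 hcp.le two_ne_zero
    linarith
  refine starA_algebra hgp hg2 hε0 (c := c) ?_ hcp hcm k1 k2 k3 (hfl φ0) ?_
  · simp only [hf] at hz
    linarith
  · simp only [Pi.sub_apply, Pi.add_apply, Pi.mul_apply, Pi.pow_apply] at hfl2
    push_cast at hfl2
    linear_combination hfl2

end CSF
end

end

section

open Real Set MeasureTheory Filter Topology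
noncomputable section

lemma polar_lift {x y x1 y1 : ℝ → ℝ} (hx : ∀ φ, HasDerivAt x (x1 φ) φ) (hy : ∀ φ, HasDerivAt y (y1 φ) φ)
    (cx1 : Continuous x1) (cy1 : Continuous y1) (hne : ∀ φ, 0 < x φ ^ 2 + y φ ^ 2) :
    ∃ θ ρ : ℝ → ℝ, (∀ φ, HasDerivAt θ ((x φ * y1 φ - y φ * x1 φ) / (x φ ^ 2 + y φ ^ 2)) φ) ∧
      (∀ φ, 0 < ρ φ) ∧ ∀ φ, x φ = ρ φ * cos (θ φ) ∧ y φ = ρ φ * sin (θ φ) := by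
  have cx : Continuous x := continuous_iff_continuousAt.2 fun φ => (hx φ).continuousAt
  have cy : Continuous y := continuous_iff_continuousAt.2 fun φ => (hy φ).continuousAt
  set z : ℝ → ℂ := fun φ => (x φ : ℂ) + (y φ : ℂ) * Complex.I with hz
  set z1 : ℝ → ℂ := fun φ => (x1 φ : ℂ) + (y1 φ : ℂ) * Complex.I with hz1
  have hzre : ∀ φ, (z φ).re = x φ := by intro φ; simp [hz]
  have hzim : ∀ φ, (z φ).im = y φ := by intro φ; simp [hz]
  have hz1re : ∀ φ, (z1 φ).re = x1 φ := by intro φ; simp [hz1]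
  have hz1im : ∀ φ, (z1 φ).im = y1 φ := by intro φ; simp [hz1]
  have hz0 : ∀ φ, z φ ≠ 0 := by
    intro φ h
    have h1 := hzre φ
    have h2 := hzim φ
    rw [h] at h1 h2
    have := hne φ
    rw [← h1, ← h2] at this
    simp at this
  have hzd : ∀ φ, HasDerivAt z (z1 φ) φ := by
    intro φ
    exact (hx φ).ofReal_comp.add ((hy φ).ofReal_comp.mul_const Complex.I)
  have cz : Continuous z := by fun_prop
  have cz1 : Continuous z1 := by fun_prop
  set w : ℝ → ℂ := fun φ => z1 φ / z φ with hw
  have cw : Continuous w := cz1.div cz hz0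
  set J : ℝ → ℂ := fun φ => ∫ s in (0:ℝ)..φ, w s with hJ
  have hJd : ∀ φ, HasDerivAt J (w φ) φ := fun φ =>
    intervalIntegral.integral_hasDerivAt_right (cw.intervalIntegrable _ _)
      (cw.stronglyMeasurableAtFilter _ _) cw.continuousAt
  have hconst : ∀ φ, z φ * Complex.exp (-J φ) = z 0 := by
    intro φ
    have hd : ∀ s, HasDerivAt (fun s => z s * Complex.exp (-J s)) 0 s := by
      intro s
      refine ((hzd s).mul ((hJd s).neg.cexp)).congr_deriv ?_
      have := hz0 s
      simp only [hw, Pi.neg_apply]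
      field_simp
      ring
    have := is_const_of_deriv_eq_zero (fun s => (hd s).differentiableAt) (fun s => (hd s).deriv) φ 0
    rw [this]
    simp [hJ]
  have hzJ : ∀ φ, z φ = z 0 * Complex.exp (J φ) := by
    intro φ
    rw [← hconst φ, mul_assoc, ← Complex.exp_add]
    simp
  have hpol : ∀ φ, z φ = ((‖z 0‖ * Real.exp (J φ).re : ℝ) : ℂ) *
      Complex.exp (((Complex.arg (z 0) + (J φ).im : ℝ) : ℂ) * Complex.I) := by
    intro φ
    rw [hzJ φ]
    conv_lhs => rw [← Complex.norm_mul_exp_arg_mul_I (z 0), ← Complex.re_add_im (J φ)]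
    push_cast
    rw [Complex.exp_add, add_mul, Complex.exp_add]
    ring
  refine ⟨fun φ => Complex.arg (z 0) + (J φ).im, fun φ => ‖z 0‖ * Real.exp (J φ).re, ?_, ?_, ?_⟩
  · intro φ
    have h1 : HasDerivAt (fun s => (J s).im) (w φ).im φ :=
      (Complex.imCLM.hasFDerivAt.comp_hasDerivAt φ (hJd φ))
    refine (h1.const_add _).congr_deriv ?_
    simp only [hw]
    rw [Complex.div_im, hz1re, hz1im, hzre, hzim, Complex.normSq_apply, hzre, hzim]
    have := hne φ
    have h3 : x φ * x φ + y φ * y φ = x φ ^ 2 + y φ ^ 2 := by ring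
    rw [h3]
    field_simp
    try ring
  · intro φ
    have := norm_pos_iff.2 (hz0 0)
    positivity
  · intro φ
    have h1 := hpol φ
    constructor
    · rw [← hzre φ, h1, Complex.re_ofReal_mul, Complex.exp_ofReal_mul_I_re]
    · rw [← hzim φ, h1, Complex.im_ofReal_mul, Complex.exp_ofReal_mul_I_im]

lemma star_lift {x y x1 y1 : ℝ → ℝ} (hx : ∀ φ, HasDerivAt x (x1 φ) φ) (hy : ∀ φ, HasDerivAt y (y1 φ) φ)
    (cx1 : Continuous x1) (cy1 : Continuous y1)
    (px : Function.Periodic x (2 * π)) (py : Function.Periodic y (2 * π))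
    (px1 : Function.Periodic x1 (2 * π)) (py1 : Function.Periodic y1 (2 * π))
    (hst : ∀ φ, 0 < x φ * y1 φ - y φ * x1 φ)
    (emb : ∀ φ ψ, φ < ψ → ψ < φ + 2 * π → ¬ (x φ = x ψ ∧ y φ = y ψ)) :
    ∃ θ ρ : ℝ → ℝ, (∀ φ, HasDerivAt θ ((x φ * y1 φ - y φ * x1 φ) / (x φ ^ 2 + y φ ^ 2)) φ) ∧
      StrictMono θ ∧ (∀ φ, θ (φ + 2 * π) = θ φ + 2 * π) ∧
      (∀ φ, 0 < ρ φ) ∧ ∀ φ, x φ = ρ φ * cos (θ φ) ∧ y φ = ρ φ * sin (θ φ) := by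
  have hne : ∀ φ, 0 < x φ ^ 2 + y φ ^ 2 := by
    intro φ
    by_contra hc
    have h1 : x φ = 0 := by nlinarith [sq_nonneg (x φ), sq_nonneg (y φ)]
    have h2 : y φ = 0 := by nlinarith [sq_nonneg (x φ), sq_nonneg (y φ)]
    have := hst φ
    rw [h1, h2] at this
    simp at this
  obtain ⟨θ, ρ, hθ, hρ, hxy⟩ := polar_lift hx hy cx1 cy1 hne
  refine ⟨θ, ρ, hθ, ?_, ?_, hρ, hxy⟩
  · exact strictMono_of_hasDerivAt_pos hθ (fun φ => div_pos (hst φ) (hne φ))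
  have hmono : StrictMono θ := strictMono_of_hasDerivAt_pos hθ (fun φ => div_pos (hst φ) (hne φ))
  have cθ : Continuous θ := continuous_iff_continuousAt.2 fun φ => (hθ φ).continuousAt
  have hρ2 : ∀ φ, ρ φ ^ 2 = x φ ^ 2 + y φ ^ 2 := by
    intro φ
    rw [(hxy φ).1, (hxy φ).2]
    linear_combination -(ρ φ ^ 2) * (Real.sin_sq_add_cos_sq (θ φ))
  have hρs : ∀ φ, ρ φ = √(x φ ^ 2 + y φ ^ 2) := by
    intro φ; rw [← hρ2, Real.sqrt_sq (hρ φ).le]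
  have cx : Continuous x := continuous_iff_continuousAt.2 fun φ => (hx φ).continuousAt
  have cy : Continuous y := continuous_iff_continuousAt.2 fun φ => (hy φ).continuousAt
  have cρ : Continuous ρ := by
    have : ρ = fun φ => √(x φ ^ 2 + y φ ^ 2) := funext hρs
    rw [this]; fun_prop
  have hρp : Function.Periodic ρ (2 * π) := by
    intro φ; rw [hρs, hρs, px φ, py φ]
  -- the increment
  obtain ⟨Θ, hΘ⟩ : ∃ Θ : ℝ, ∀ φ, θ (φ + 2 * π) = θ φ + Θ := by
    have hd : ∀ s, HasDerivAt (fun s => θ (s + 2 * π) - θ s) 0 s := by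
      intro s
      have := ((hθ (s + 2 * π)).comp_add_const s (2 * π)).sub (hθ s)
      refine this.congr_deriv ?_
      rw [px s, py s, px1 s, py1 s, sub_self]
    refine ⟨θ (0 + 2 * π) - θ 0, fun φ => ?_⟩
    have := is_const_of_deriv_eq_zero (fun s => (hd s).differentiableAt) (fun s => (hd s).deriv) φ 0
    linarith
  obtain ⟨k, hk⟩ : ∃ k : ℤ, Θ = 2 * π * k := by
    have hc : cos (θ (0 + 2 * π)) = cos (θ 0) := by
      have h1 := (hxy (0 + 2 * π)).1
      rw [px 0, hρp 0, (hxy 0).1] at h1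
      exact (mul_left_cancel₀ (hρ 0).ne' h1).symm
    have hs : sin (θ (0 + 2 * π)) = sin (θ 0) := by
      have h1 := (hxy (0 + 2 * π)).2
      rw [py 0, hρp 0, (hxy 0).2] at h1
      exact (mul_left_cancel₀ (hρ 0).ne' h1).symm
    obtain ⟨k, hk⟩ := Real.Angle.angle_eq_iff_two_pi_dvd_sub.1 (Real.Angle.cos_sin_inj hc hs)
    refine ⟨k, ?_⟩
    rw [← hk, hΘ 0]; ring
  have hΘp : 0 < Θ := by
    have := hmono (show (0:ℝ) < 0 + 2 * π by simpa using Real.two_pi_pos)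
    rw [hΘ 0] at this; linarith
  have hkpos : 0 < k := by
    rw [hk] at hΘp
    have := pos_of_mul_pos_right hΘp Real.two_pi_pos.le
    exact_mod_cast this
  by_cases hk1 : k = 1
  · intro φ; rw [hΘ, hk, hk1]; simp
  exfalso
  have hk2 : (2:ℝ) ≤ k := by
    have : 2 ≤ k := by omega
    exact_mod_cast this
  have hΘ2 : 2 * π < Θ := by
    rw [hk]; nlinarith [Real.two_pi_pos]
  have hΘn : ∀ n : ℕ, ∀ φ, θ (φ + n * (2 * π)) = θ φ + n * Θ := by
    intro n
    induction n with
    | zero => intro φ; simp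
    | succ n ih =>
      intro φ
      have : φ + ((n + 1 : ℕ) : ℝ) * (2 * π) = (φ + n * (2 * π)) + 2 * π := by push_cast; ring
      rw [this, hΘ, ih]; push_cast; ring
  have hsurj : Function.Surjective θ := by
    apply cθ.surjective
    · apply tendsto_atTop_atTop_of_monotone hmono.monotone
      intro B
      obtain ⟨n, hn⟩ := exists_nat_gt ((B - θ 0) / Θ)
      refine ⟨0 + n * (2 * π), ?_⟩
      rw [hΘn]
      rw [div_lt_iff₀ hΘp] at hn
      linarith
    · apply tendsto_atBot_atBot_of_monotone hmono.monotone
      intro B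
      obtain ⟨n, hn⟩ := exists_nat_gt ((θ 0 - B) / Θ)
      refine ⟨0 - n * (2 * π), ?_⟩
      have := hΘn n (0 - n * (2 * π))
      rw [sub_add_cancel] at this
      rw [div_lt_iff₀ hΘp] at hn
      linarith
  set e := hmono.orderIsoOfSurjective θ hsurj with he
  have hee : ∀ s, θ (e.symm s) = s := fun s => e.apply_symm_apply s
  have ce : Continuous e.symm := e.symm.continuous
  obtain ⟨φm, -, hm⟩ := (isCompact_Icc (a := (0:ℝ)) (b := 2 * π)).exists_isMaxOn
    ⟨0, le_rfl, Real.two_pi_pos.le⟩ cρ.continuousOn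
  have hmax : ∀ φ, ρ φ ≤ ρ φm := by
    intro φ
    obtain ⟨φ', hφ', hp⟩ := exists_mod φ
    rw [← hp ρ hρp]
    exact hm hφ'
  set s : ℝ → ℝ := fun φ => e.symm (θ φ + 2 * π) with hs
  have cs : Continuous s := ce.comp (cθ.add continuous_const)
  have hsθ : ∀ φ, θ (s φ) = θ φ + 2 * π := fun φ => hee _
  set φ' := e.symm (θ φm - 2 * π) with hφ'
  have hsφ' : s φ' = φm := by
    apply hmono.injective
    rw [hsθ, hφ', hee]; ring
  obtain ⟨φs, hφs⟩ := mem_range_of_exists_le_of_exists_ge (c := (0:ℝ)) (f := fun φ => ρ (s φ) - ρ φ)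
    ((cρ.comp cs).sub cρ) ⟨φm, by simpa using hmax (s φm)⟩ ⟨φ', by simp only [hsφ']; linarith [hmax φ']⟩
  simp only at hφs
  have hρeq : ρ (s φs) = ρ φs := by linarith
  refine emb φs (s φs) ?_ ?_ ⟨?_, ?_⟩
  · apply hmono.lt_iff_lt.1; rw [hsθ]; linarith [Real.two_pi_pos]
  · apply hmono.lt_iff_lt.1; rw [hsθ, hΘ]; linarith
  · rw [(hxy φs).1, (hxy (s φs)).1, hρeq, hsθ, Real.cos_add_two_pi]
  · rw [(hxy φs).2, (hxy (s φs)).2, hρeq, hsθ, Real.sin_add_two_pi]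
end

end

section

open Real Set MeasureTheory Filter Topology
noncomputable section

lemma avoid_algebra {w1 w2 x y u v x2 y2 u2 v2 p q p' q' l μ ε : ℝ} (hl : 0 < l) (hε : 0 < ε)
    (hG1 : 0 < x ^ 2 + y ^ 2) (hG2 : 0 < u ^ 2 + v ^ 2)
    (k1 : w1 * x + w2 * y = 0) (k2 : w1 * u + w2 * v = 0)
    (m1 : x + l * μ * u = 0) (m2 : y + l * μ * v = 0)
    (hs : 0 ≤ w1 * (x2 + l * μ ^ 2 * u2) + w2 * (y2 + l * μ ^ 2 * v2))
    (f1 : (p * y - q * x) * (x ^ 2 + y ^ 2) = -(x * y2 - y * x2))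
    (f2 : (p' * v - q' * u) * (u ^ 2 + v ^ 2) = -(u * v2 - v * u2))
    (ht : 2 * (w1 * (p + p' / l) + w2 * (q + q' / l)) + ε ≤ 0) : False := by
  have aux : ∀ x y x2 y2 p q : ℝ, 0 < x ^ 2 + y ^ 2 → w1 * x + w2 * y = 0 →
      (p * y - q * x) * (x ^ 2 + y ^ 2) = -(x * y2 - y * x2) →
      (w1 * p + w2 * q) * (x ^ 2 + y ^ 2) = w1 * x2 + w2 * y2 := by
    intro x y x2 y2 p q hG k f
    have e1 : w1 * (x ^ 2 + y ^ 2) = -(x * w2 - y * w1) * y := by linear_combination x * k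
    have e2 : w2 * (x ^ 2 + y ^ 2) = (x * w2 - y * w1) * x := by linear_combination y * k
    have : (x ^ 2 + y ^ 2) * ((w1 * p + w2 * q) * (x ^ 2 + y ^ 2) - (w1 * x2 + w2 * y2)) = 0 := by
      linear_combination ((x^2+y^2) * p - x2) * e1 + ((x^2+y^2) * q - y2) * e2 - (x * w2 - y * w1) * f
    have := (mul_eq_zero.1 this).resolve_left hG.ne'
    linarith
  have a1 := aux x y x2 y2 p q hG1 k1 f1
  have a2 := aux u v u2 v2 p' q' hG2 k2 f2
  have hGG : x ^ 2 + y ^ 2 = l ^ 2 * μ ^ 2 * (u ^ 2 + v ^ 2) := by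
    have e1 : x = -(l * μ * u) := by linarith
    have e2 : y = -(l * μ * v) := by linarith
    rw [e1, e2]; ring
  have key : (w1 * (p + p' / l) + w2 * (q + q' / l)) * (x ^ 2 + y ^ 2)
      = w1 * (x2 + l * μ ^ 2 * u2) + w2 * (y2 + l * μ ^ 2 * v2) := by
    have e3 : (w1 * p' / l + w2 * q' / l) * (x ^ 2 + y ^ 2) = l * μ ^ 2 * (w1 * u2 + w2 * v2) := by
      rw [hGG, ← a2]; field_simp
    linear_combination a1 + e3
  have : 0 ≤ w1 * (p + p' / l) + w2 * (q + q' / l) := by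
    rw [← key] at hs
    exact nonneg_of_mul_nonneg_left hs hG1
  linarith

namespace CSF
variable {T : ℝ} {a b : ℝ → ℝ → ℝ}

set_option maxHeartbeats 2000000 in
theorem avoid (h : CSF T a b) {t1 l : ℝ} (ht1 : t1 ∈ Ico 0 T) (hl : 1 < l)
    (h0 : ∀ φ ψ, 0 < (a 0 φ + l * a 0 ψ) ^ 2 + (b 0 φ + l * b 0 ψ) ^ 2) :
    ∀ t ∈ Icc 0 t1, ∀ φ ψ, 0 < (a t φ + l * a (t / l ^ 2) ψ) ^ 2 + (b t φ + l * b (t / l ^ 2) ψ) ^ 2 := by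
  have hl0 : 0 < l := by linarith
  have hl2 : 1 < l ^ 2 := by nlinarith
  have hsub : Icc 0 t1 ⊆ Ico 0 T := fun t ht => ⟨ht.1, ht.2.trans_lt ht1.2⟩
  have hdiv : ∀ t, 0 ≤ t → t / l ^ 2 ≤ t := fun t ht => div_le_self ht hl2.le
  have hsub2 : ∀ t ∈ Icc 0 t1, t / l ^ 2 ∈ Ico 0 T := fun t ht =>
    ⟨by have := ht.1; positivity, ((hdiv t ht.1).trans ht.2).trans_lt ht1.2⟩
  set D : ℝ → ℝ × ℝ → ℝ := fun t p => (a t p.1 + l * a (t / l ^ 2) p.2) ^ 2 + (b t p.1 + l * b (t / l ^ 2) p.2) ^ 2 with hD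
  set K : Set (ℝ × ℝ) := Icc 0 (2 * π) ×ˢ Icc 0 (2 * π) with hK
  have hKc : IsCompact K := isCompact_Icc.prod isCompact_Icc
  have hc1 : ∀ H : ℝ → ℝ → ℝ, Sm (Ico 0 T) H →
      ContinuousOn (fun p : ℝ × (ℝ × ℝ) => H p.1 p.2.1) (Icc 0 t1 ×ˢ K) := fun H hH =>
    hH.cont.comp (f := fun p : ℝ × (ℝ × ℝ) => (p.1, p.2.1)) (by fun_prop)
      (fun p hp => ⟨hsub hp.1, mem_univ _⟩)
  have hc2 : ∀ H : ℝ → ℝ → ℝ, Sm (Ico 0 T) H →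
      ContinuousOn (fun p : ℝ × (ℝ × ℝ) => H (p.1 / l ^ 2) p.2.2) (Icc 0 t1 ×ˢ K) := fun H hH =>
    hH.cont.comp (f := fun p : ℝ × (ℝ × ℝ) => (p.1 / l ^ 2, p.2.2)) (by fun_prop)
      (fun p hp => ⟨hsub2 _ hp.1, mem_univ _⟩)
  have hDc : ContinuousOn (fun p : ℝ × (ℝ × ℝ) => D p.1 p.2) (Icc 0 t1 ×ˢ K) :=
    (((hc1 a h.sa).add (continuousOn_const.mul (hc2 a h.sa))).pow 2).add
      (((hc1 b h.sb).add (continuousOn_const.mul (hc2 b h.sb))).pow 2)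
  have h00 : (0:ℝ) ∈ Icc 0 t1 := ⟨le_rfl, ht1.1⟩
  have hmod : ∀ t ∈ Icc 0 t1, ∀ φ ψ, ∃ p ∈ K, D t p = D t (φ, ψ) := by
    intro t ht φ ψ
    obtain ⟨φ', hφ', hp⟩ := exists_mod φ
    obtain ⟨ψ', hψ', hq⟩ := exists_mod ψ
    refine ⟨(φ', ψ'), ⟨hφ', hψ'⟩, ?_⟩
    simp only [hD]
    rw [hp _ (h.per_a t (hsub ht)), hp _ (h.per_b t (hsub ht)), hq _ (h.per_a _ (hsub2 t ht)),
      hq _ (h.per_b _ (hsub2 t ht))]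
  obtain ⟨m, hm, hmle⟩ := exists_pos_lower (f := fun p => D 0 p) hKc
    (hDc.comp (f := fun p : ℝ × ℝ => ((0:ℝ), p)) (by fun_prop) (fun p hp => ⟨h00, hp⟩))
    (fun p _ => by simp only [hD, zero_div]; exact h0 p.1 p.2)
  set δ := m / 2 with hδ
  have hδ0 : 0 < δ := by positivity
  set ε := δ / (2 * (t1 + 1)) with hε
  have ht1p : 0 < t1 + 1 := by linarith [ht1.1]
  have hε0 : 0 < ε := by positivity
  have hεt : ∀ t ∈ Icc 0 t1, 0 < δ - ε * t := by
    intro t ht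
    have : ε * (2 * (t1 + 1)) = δ := by rw [hε]; field_simp
    nlinarith [ht.1, ht.2]
  by_contra hcon
  push Not at hcon
  obtain ⟨tb, htb, φb, ψb, hb⟩ := hcon
  obtain ⟨t0, ht0, ⟨φ0, ψ0⟩, hp0, hz, hge⟩ := first_time (f := fun t p => D t p - (δ - ε * t)) hKc
    (t1 := t1) (hDc.sub (by fun_prop))
    (fun p hp => by
      have := hmle p hp
      simp only [mul_zero, sub_zero]
      linarith)
    (by
      obtain ⟨p, hp, he⟩ := hmod tb htb φb ψb
      refine ⟨tb, htb, p, hp, ?_⟩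
      rw [he]
      have : D tb (φb, ψb) ≤ 0 := hb
      linarith [hεt tb htb])
  have ht0' : t0 ∈ Icc 0 t1 := ⟨ht0.1.le, ht0.2⟩
  have ht0o : t0 ∈ Ioo 0 T := ⟨ht0.1, ht0.2.trans_lt ht1.2⟩
  set t0' := t0 / l ^ 2 with ht0d
  have ht0o' : t0' ∈ Ioo 0 T := ⟨by have := ht0.1; positivity, (hsub2 t0 ht0').2⟩
  have hge' : ∀ t ∈ Icc 0 t0, ∀ φ ψ, 0 ≤ D t (φ, ψ) - (δ - ε * t) := by
    intro t ht φ ψ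
    obtain ⟨p, hp, he⟩ := hmod t ⟨ht.1, ht.2.trans ht0.2⟩ φ ψ
    rw [← he]
    exact hge t ht p hp
  have hmin : ∀ φ ψ, D t0 (φ0, ψ0) ≤ D t0 (φ, ψ) := by
    intro φ ψ
    have := hge' t0 ⟨ht0.1.le, le_rfl⟩ φ ψ
    linarith
  have hDp : 0 < D t0 (φ0, ψ0) := by linarith [hεt t0 ht0']
  have oa := h.sa.mono (ioo_ico (T := T))
  have ob := h.sb.mono (ioo_ico (T := T))
  have oa1 := oa.dP ud_ioo
  have ob1 := ob.dP ud_ioo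
  set w1 := a t0 φ0 + l * a t0' ψ0 with hw1
  set w2 := b t0 φ0 + l * b t0' ψ0 with hw2
  have hww : 0 < w1 ^ 2 + w2 ^ 2 := hDp
  -- general curve through the minimum
  have curve : ∀ α μ : ℝ, (w1 * (α * dP a t0 φ0 + l * (μ * dP a t0' ψ0)) + w2 * (α * dP b t0 φ0 + l * (μ * dP b t0' ψ0)) = 0) ∧
      0 ≤ w1 * (α ^ 2 * dP (dP a) t0 φ0 + l * (μ ^ 2 * dP (dP a) t0' ψ0)) + (α * dP a t0 φ0 + l * (μ * dP a t0' ψ0)) ^ 2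
       + w2 * (α ^ 2 * dP (dP b) t0 φ0 + l * (μ ^ 2 * dP (dP b) t0' ψ0)) + (α * dP b t0 φ0 + l * (μ * dP b t0' ψ0)) ^ 2 := by
    intro α μ
    have lin : ∀ (c β s : ℝ), HasDerivAt (fun s => c + β * s) β s := by
      intro c β s
      simpa using ((hasDerivAt_id s).const_mul β).const_add c
    have cmp : ∀ (H : ℝ → ℝ → ℝ), Sm (Ioo 0 T) H → ∀ t ∈ Ioo 0 T, ∀ c β s : ℝ,
        HasDerivAt (fun s => H t (c + β * s)) (β * dP H t (c + β * s)) s := by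
      intro H hH t ht c β s
      have := (hH.hasDerivAt ht (c + β * s)).comp s (lin c β s)
      rw [mul_comm]
      exact this
    have q : ∀ (H : ℝ → ℝ → ℝ), Sm (Ioo 0 T) H → ∀ s, HasDerivAt (fun s => H t0 (φ0 + α * s) + l * H t0' (ψ0 + μ * s))
        (α * dP H t0 (φ0 + α * s) + l * (μ * dP H t0' (ψ0 + μ * s))) s := fun H hH s =>
      (cmp H hH t0 ht0o φ0 α s).add ((cmp H hH t0' ht0o' ψ0 μ s).const_mul l)
    have q2 : ∀ (H : ℝ → ℝ → ℝ), Sm (Ioo 0 T) H → ∀ s, HasDerivAt (fun s => α * H t0 (φ0 + α * s) + l * (μ * H t0' (ψ0 + μ * s)))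
        (α * (α * dP H t0 (φ0 + α * s)) + l * (μ * (μ * dP H t0' (ψ0 + μ * s)))) s := fun H hH s =>
      ((cmp H hH t0 ht0o φ0 α s).const_mul α).add (((cmp H hH t0' ht0o' ψ0 μ s).const_mul μ).const_mul l)
    have d1 : ∀ s, HasDerivAt (fun s => D t0 (φ0 + α * s, ψ0 + μ * s))
        (2 * ((a t0 (φ0 + α * s) + l * a t0' (ψ0 + μ * s)) * (α * dP a t0 (φ0 + α * s) + l * (μ * dP a t0' (ψ0 + μ * s)))
        + (b t0 (φ0 + α * s) + l * b t0' (ψ0 + μ * s)) * (α * dP b t0 (φ0 + α * s) + l * (μ * dP b t0' (ψ0 + μ * s))))) s := by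
      intro s
      refine (((q a oa s).pow 2).add ((q b ob s).pow 2)).congr_deriv ?_
      push_cast; ring
    have d2 := (((q a oa 0).mul (q2 _ oa1 0)).add ((q b ob 0).mul (q2 _ ob1 0))).const_mul 2
    have := second_deriv_test d1 d2 (by intro s; simp only [mul_zero, add_zero]; exact hmin _ _)
    simp only [mul_zero, add_zero] at this
    refine ⟨by linarith [this.1], ?_⟩
    have h2 := this.2
    rw [← hw1, ← hw2] at h2
    nlinarith [h2]
  have k1 : w1 * dP a t0 φ0 + w2 * dP b t0 φ0 = 0 := by
    have := (curve 1 0).1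
    linarith
  have k2 : w1 * dP a t0' ψ0 + w2 * dP b t0' ψ0 = 0 := by
    have := (curve 0 1).1
    have h2 : l * (w1 * dP a t0' ψ0 + w2 * dP b t0' ψ0) = 0 := by linarith
    exact (mul_eq_zero.1 h2).resolve_left hl0.ne'
  have hG1 := h.reg t0 (ioo_ico ht0o) φ0
  have hG2 := h.reg t0' (ioo_ico ht0o') ψ0
  have hpar : dP a t0 φ0 * dP b t0' ψ0 - dP b t0 φ0 * dP a t0' ψ0 = 0 := by
    have : (w1 ^ 2 + w2 ^ 2) * (dP a t0 φ0 * dP b t0' ψ0 - dP b t0 φ0 * dP a t0' ψ0) = 0 := by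
      linear_combination (w1 * dP b t0' ψ0 - w2 * dP a t0' ψ0) * k1 - (w1 * dP b t0 φ0 - w2 * dP a t0 φ0) * k2
    exact (mul_eq_zero.1 this).resolve_left hww.ne'
  set x := dP a t0 φ0 with hx
  set y := dP b t0 φ0 with hy
  set u := dP a t0' ψ0 with hu
  set v := dP b t0' ψ0 with hv
  set μ := -(x * u + y * v) / (l * (u ^ 2 + v ^ 2)) with hμ
  have m1 : x + l * μ * u = 0 := by
    rw [hμ]; field_simp; linear_combination v * hpar
  have m2 : y + l * μ * v = 0 := by
    rw [hμ]; field_simp; linear_combination -u * hpar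
  have k3 := (curve 1 μ).2
  have e1 : 1 * x + l * (μ * u) = 0 := by linarith
  have e2 : 1 * y + l * (μ * v) = 0 := by linarith
  rw [e1, e2] at k3
  have td : ∀ (H : ℝ → ℝ → ℝ), Sm (Ioo 0 T) H → HasDerivAt (fun t => H t φ0 + l * H (t / l ^ 2) ψ0)
      (dT H t0 φ0 + dT H t0' ψ0 / l) t0 := by
    intro H hH
    have e : HasDerivAt (fun t : ℝ => t / l ^ 2) (1 / l ^ 2) t0 := (hasDerivAt_id t0).div_const _
    have e' : HasDerivAt (fun τ => H τ ψ0) (dT H t0' ψ0) (t0 / l ^ 2) := hH.hasDerivAt_t isOpen_Ioo ht0o' ψ0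
    have := (hH.hasDerivAt_t isOpen_Ioo ht0o φ0).add ((e'.comp t0 e).const_mul l)
    refine this.congr_deriv ?_
    field_simp
  have tD : HasDerivAt (fun t => D t (φ0, ψ0) - (δ - ε * t))
     (2 * (w1 * (dT a t0 φ0 + dT a t0' ψ0 / l) + w2 * (dT b t0 φ0 + dT b t0' ψ0 / l)) + ε) t0 := by
    have hlin : HasDerivAt (fun t => δ - ε * t) (-ε) t0 := by
      simpa using ((hasDerivAt_id t0).const_mul ε).const_sub δ
    refine ((((td a oa).pow 2).add ((td b ob).pow 2)).sub hlin).congr_deriv ?_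
    rw [← ht0d, ← hw1, ← hw2]
    push_cast
    ring
  have k4 := left_deriv_test ht0.1 tD hz (fun t ht => hge' t ht φ0 ψ0)
  refine avoid_algebra hl0 hε0 hG1 hG2 k1 k2 m1 m2 ?_ (h.flow t0 ht0o φ0) (h.flow t0' ht0o' ψ0) k4
  linarith [k3]

end CSF
end

end

section

open Real Set MeasureTheory Filter Topology
noncomputable section

lemma ray_exists {x y : ℝ → ℝ} {θ ρ : ℝ → ℝ}
    (px : Function.Periodic x (2 * π)) (py : Function.Periodic y (2 * π))
    (hc : Continuous θ) (hθ : ∀ φ, θ (φ + 2 * π) = θ φ + 2 * π) (hρ : ∀ φ, 0 < ρ φ)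
    (hxy : ∀ φ, x φ = ρ φ * cos (θ φ) ∧ y φ = ρ φ * sin (θ φ)) (t : ℝ) :
    ∃ φ ∈ Icc 0 (2 * π), ∃ r > 0, x φ = r * cos t ∧ y φ = r * sin t := by
  have hk : ∃ k : ℤ, θ 0 ≤ t + k * (2 * π) ∧ t + k * (2 * π) ≤ θ 0 + 2 * π := by
    have hm := toIcoMod_mem_Ico Real.two_pi_pos (θ 0) t
    refine ⟨-toIcoDiv Real.two_pi_pos (θ 0) t, ?_⟩
    have e := self_sub_toIcoDiv_zsmul Real.two_pi_pos (θ 0) t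
    rw [← e, zsmul_eq_mul] at hm
    push_cast
    constructor <;> linarith [hm.1, hm.2]
  obtain ⟨k, hk1, hk2⟩ := hk
  have h2 : θ (2 * π) = θ 0 + 2 * π := by rw [← hθ 0, zero_add]
  obtain ⟨φ, hφ, he⟩ := intermediate_value_Icc (Real.two_pi_pos.le) hc.continuousOn (show t + k * (2 * π) ∈ Icc (θ 0) (θ (2 * π)) from ⟨hk1, by rw [h2]; exact hk2⟩)
  refine ⟨φ, hφ, ρ φ, hρ φ, ?_, ?_⟩
  · rw [(hxy φ).1, he, Real.cos_add_int_mul_two_pi]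
  · rw [(hxy φ).2, he, Real.sin_add_int_mul_two_pi]

lemma lift_shift {θ : ℝ → ℝ} (hθ : ∀ φ, θ (φ + 2 * π) = θ φ + 2 * π) (k : ℤ) (φ : ℝ) :
    θ (φ + k * (2 * π)) = θ φ + k * (2 * π) := by
  have hp : Function.Periodic (fun φ => θ φ - φ) (2 * π) := by
    intro φ
    simp only [hθ]
    ring
  have := hp.int_mul k φ
  linarith

lemma ray_unique {x y : ℝ → ℝ} {θ ρ : ℝ → ℝ}
    (px : Function.Periodic x (2 * π)) (py : Function.Periodic y (2 * π))
    (hm : StrictMono θ) (hθ : ∀ φ, θ (φ + 2 * π) = θ φ + 2 * π) (hρ : ∀ φ, 0 < ρ φ)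
    (hxy : ∀ φ, x φ = ρ φ * cos (θ φ) ∧ y φ = ρ φ * sin (θ φ)) {t φ ψ r s : ℝ} (hr : 0 < r) (hs : 0 < s)
    (h1 : x φ = r * cos t) (h2 : y φ = r * sin t) (h3 : x ψ = s * cos t) (h4 : y ψ = s * sin t) : r = s := by
  have key : ∀ φ r, 0 < r → x φ = r * cos t → y φ = r * sin t → r = ρ φ ∧ ∃ k : ℤ, t = θ φ + k * (2 * π) := by
    intro φ r hr h1 h2
    have e1 := (hxy φ).1
    have e2 := (hxy φ).2
    rw [h1] at e1
    rw [h2] at e2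
    have hρφ := hρ φ
    have : r = ρ φ := by
      have : r ^ 2 = ρ φ ^ 2 := by
        calc r ^ 2 = (r * cos t) ^ 2 + (r * sin t) ^ 2 := by
              rw [mul_pow, mul_pow, ← mul_add, cos_sq_add_sin_sq, mul_one]
          _ = ρ φ ^ 2 := by rw [e1, e2, mul_pow, mul_pow, ← mul_add, cos_sq_add_sin_sq, mul_one]
      exact (sq_eq_sq₀ hr.le hρφ.le).1 this
    refine ⟨this, ?_⟩
    rw [this] at e1 e2
    have e1' := mul_left_cancel₀ hρφ.ne' e1
    have e2' := mul_left_cancel₀ hρφ.ne' e2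
    have : (t : Real.Angle) = (θ φ : Real.Angle) := Real.Angle.cos_sin_inj e1' e2'
    obtain ⟨k, hk⟩ := Real.Angle.angle_eq_iff_two_pi_dvd_sub.1 this
    exact ⟨k, by linarith⟩
  obtain ⟨a1, k, hk⟩ := key φ r hr h1 h2
  obtain ⟨a2, j, hj⟩ := key ψ s hs h3 h4
  have : φ + k * (2 * π) = ψ + j * (2 * π) := by
    apply hm.injective
    rw [lift_shift hθ, lift_shift hθ, ← hk, ← hj]
  have px' : x φ = x ψ := by
    rw [← px.int_mul k φ, ← px.int_mul j ψ, this]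
  have py' : y φ = y ψ := by
    rw [← py.int_mul k φ, ← py.int_mul j ψ, this]
  have : r ^ 2 = s ^ 2 := by
    calc r ^ 2 = (r * cos t) ^ 2 + (r * sin t) ^ 2 := by
          rw [mul_pow, mul_pow, ← mul_add, cos_sq_add_sin_sq, mul_one]
      _ = s ^ 2 := by rw [← h1, ← h2, px', py', h3, h4, mul_pow, mul_pow, ← mul_add, cos_sq_add_sin_sq, mul_one]
  exact (sq_eq_sq₀ hr.le hs.le).1 this

namespace CSF
variable {T : ℝ} {a b : ℝ → ℝ → ℝ}

lemma cont_slice {H : ℝ → ℝ → ℝ} (h : Sm (Ico 0 T) H) {t : ℝ} (ht : t ∈ Ico 0 T) : Continuous (H t) :=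
  continuous_iff_continuousAt.2 fun φ => (h.hasDerivAt ht φ).continuousAt

lemma lift (h : CSF T a b) {t : ℝ} (ht : t ∈ Ico 0 T)
    (hst : ∀ φ, 0 < a t φ * dP b t φ - b t φ * dP a t φ) :
    ∃ θ ρ : ℝ → ℝ, (∀ φ, HasDerivAt θ ((a t φ * dP b t φ - b t φ * dP a t φ) / (a t φ ^ 2 + b t φ ^ 2)) φ) ∧
      StrictMono θ ∧ (∀ φ, θ (φ + 2 * π) = θ φ + 2 * π) ∧
      (∀ φ, 0 < ρ φ) ∧ ∀ φ, a t φ = ρ φ * cos (θ φ) ∧ b t φ = ρ φ * sin (θ φ) :=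
  star_lift (fun φ => h.sa.hasDerivAt ht φ) (fun φ => h.sb.hasDerivAt ht φ)
    (cont_slice (h.sa.dP ud_ico) ht) (cont_slice (h.sb.dP ud_ico) ht) (h.per_a t ht) (h.per_b t ht)
    (dP_periodic (h.per_a t ht)) (dP_periodic (h.per_b t ht)) hst (h.emb t ht)

def Symm (a b : ℝ → ℝ → ℝ) (t : ℝ) : Prop := ∀ φ, ∃ ψ, a t ψ = -a t φ ∧ b t ψ = -b t φ

theorem symm_of_ne (h : CSF T a b) {t1 : ℝ} (ht1 : t1 ∈ Ico 0 T)
    (hne : ∀ t ∈ Icc 0 t1, ∀ φ, 0 < a t φ ^ 2 + b t φ ^ 2)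
    (h0 : ∀ φ, 0 < a 0 φ * dP b 0 φ - b 0 φ * dP a 0 φ) (hs0 : Symm a b 0) :
    ∀ t ∈ Icc 0 t1, Symm a b t := by
  have hst := h.star ht1 hne h0
  have hsub : Icc 0 t1 ⊆ Ico 0 T := fun t ht => ⟨ht.1, ht.2.trans_lt ht1.2⟩
  have h00 : (0:ℝ) ∈ Icc 0 t1 := ⟨le_rfl, ht1.1⟩
  have huniq : ∀ t ∈ Icc 0 t1, ∀ {θ φ ψ r s : ℝ}, 0 < r → 0 < s → a t φ = r * cos θ → b t φ = r * sin θ →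
      a t ψ = s * cos θ → b t ψ = s * sin θ → r = s := by
    intro t ht θ φ ψ r s hr hs e1 e2 e3 e4
    obtain ⟨ϑ, ρ, -, l2, l3, l4, l5⟩ := h.lift (hsub ht) (hst t ht)
    exact ray_unique (h.per_a t (hsub ht)) (h.per_b t (hsub ht)) l2 l3 l4 l5 hr hs e1 e2 e3 e4
  have hex : ∀ t θ : ℝ, ∃ φ r : ℝ, t ∈ Icc 0 t1 → φ ∈ Icc 0 (2 * π) ∧ 0 < r ∧ a t φ = r * cos θ ∧ b t φ = r * sin θ := by
    intro t θ
    by_cases ht : t ∈ Icc 0 t1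
    · obtain ⟨ϑ, ρ, l1, l2, l3, l4, l5⟩ := h.lift (hsub ht) (hst t ht)
      obtain ⟨φ, hφ, r, hr, e⟩ := ray_exists (h.per_a t (hsub ht)) (h.per_b t (hsub ht))
        (continuous_iff_continuousAt.2 fun φ => (l1 φ).continuousAt) l3 l4 l5 θ
      exact ⟨φ, r, fun _ => ⟨hφ, hr, e⟩⟩
    · exact ⟨0, 0, fun h => absurd h ht⟩
  choose F R hFR using hex
  have hRc : ∀ θ, ContinuousOn (fun t => R t θ) (Icc 0 t1) := by
    intro θ t ht
    rw [ContinuousWithinAt, tendsto_iff_ultrafilter]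
    intro g hg
    have hgI : Icc 0 t1 ∈ g := hg self_mem_nhdsWithin
    have hgt : Tendsto id (g : Filter ℝ) (𝓝 t) := (hg.trans nhdsWithin_le_nhds)
    have hK : Icc 0 (2 * π) ∈ g.map (fun t => F t θ) := by
      rw [Ultrafilter.mem_map]
      filter_upwards [hgI] with s hs using (hFR s θ hs).1
    obtain ⟨φ, hφ, hφl⟩ := isCompact_Icc.ultrafilter_le_nhds (g.map (fun t => F t θ)) (le_principal_iff.2 hK)
    have hφl' : Tendsto (fun t => F t θ) (g : Filter ℝ) (𝓝 φ) := hφl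
    have hlim : ∀ H : ℝ → ℝ → ℝ, Sm (Ico 0 T) H → Tendsto (fun s => H s (F s θ)) (g : Filter ℝ) (𝓝 (H t φ)) := by
      intro H hH
      have hc := hH.cont (t, φ) ⟨hsub ht, mem_univ _⟩
      refine hc.tendsto.comp (f := fun s => (s, F s θ)) ?_
      rw [nhdsWithin, tendsto_inf]
      refine ⟨by rw [nhds_prod_eq]; exact hgt.prodMk hφl', tendsto_principal.2 ?_⟩
      filter_upwards [hgI] with s hs using ⟨hsub hs, mem_univ _⟩
    have la := hlim a h.sa
    have lb := hlim b h.sb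
    have hsq : ∀ s ∈ Icc 0 t1, R s θ = √(a s (F s θ) ^ 2 + b s (F s θ) ^ 2) := by
      intro s hs
      obtain ⟨-, hr, e1, e2⟩ := hFR s θ hs
      rw [e1, e2, mul_pow, mul_pow, ← mul_add, cos_sq_add_sin_sq, mul_one, Real.sqrt_sq hr.le]
    have lR : Tendsto (fun s => R s θ) (g : Filter ℝ) (𝓝 √(a t φ ^ 2 + b t φ ^ 2)) := by
      refine Tendsto.congr' ?_ (((la.pow 2).add (lb.pow 2)).sqrt)
      filter_upwards [hgI] with s hs using (hsq s hs).symm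
    have ea : a t φ = √(a t φ ^ 2 + b t φ ^ 2) * cos θ := by
      refine tendsto_nhds_unique la (Tendsto.congr' ?_ (lR.mul_const (cos θ)))
      filter_upwards [hgI] with s hs using (hFR s θ hs).2.2.1.symm
    have eb : b t φ = √(a t φ ^ 2 + b t φ ^ 2) * sin θ := by
      refine tendsto_nhds_unique lb (Tendsto.congr' ?_ (lR.mul_const (sin θ)))
      filter_upwards [hgI] with s hs using (hFR s θ hs).2.2.2.symm
    obtain ⟨-, hr, e1, e2⟩ := hFR t θ ht
    have := huniq t ht (Real.sqrt_pos.2 (hne t ht φ)) hr ea eb e1 e2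
    show Tendsto (fun s => R s θ) (g : Filter ℝ) (𝓝 (R t θ))
    rw [← this]
    exact lR
  have hR0 : ∀ θ, R 0 (θ + π) = R 0 θ := by
    intro θ
    obtain ⟨-, hr, e1, e2⟩ := hFR 0 θ h00
    obtain ⟨-, hr', e1', e2'⟩ := hFR 0 (θ + π) h00
    obtain ⟨ψ, f1, f2⟩ := hs0 (F 0 θ)
    refine huniq 0 h00 hr' hr e1' e2' (ψ := ψ) ?_ ?_
    · rw [f1, e1, cos_add_pi]; ring
    · rw [f2, e2, sin_add_pi]; ring
  have hdivm : ∀ l : ℝ, 1 < l → ∀ t ∈ Icc 0 t1, t / l ^ 2 ∈ Icc 0 t1 := by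
    intro l hl t ht
    have hl2 : 1 ≤ l ^ 2 := by nlinarith
    exact ⟨div_nonneg ht.1 (by positivity), (div_le_self ht.1 hl2).trans ht.2⟩
  have hnest : ∀ l : ℝ, 1 < l → ∀ t ∈ Icc 0 t1, ∀ θ, R t θ ≤ l * R (t / l ^ 2) (θ + π) := by
    intro l hl t ht θ
    have hav := h.avoid ht1 hl (by
      intro φ ψ
      by_contra hcon
      have e1 : a 0 φ + l * a 0 ψ = 0 := by nlinarith [sq_nonneg (a 0 φ + l * a 0 ψ), sq_nonneg (b 0 φ + l * b 0 ψ)]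
      have e2 : b 0 φ + l * b 0 ψ = 0 := by nlinarith [sq_nonneg (a 0 φ + l * a 0 ψ), sq_nonneg (b 0 φ + l * b 0 ψ)]
      obtain ⟨φ', f1, f2⟩ := hs0 φ
      obtain ⟨ϑ, ρ, -, l2, l3, l4, l5⟩ := h.lift (hsub h00) (hst 0 h00)
      have := huniq 0 h00 (θ := ϑ ψ) (r := l * ρ ψ) (s := ρ ψ) (φ := φ') (ψ := ψ) (mul_pos (by linarith) (l4 ψ)) (l4 ψ)
        (by rw [f1]; linarith [(l5 ψ).1, congrArg (l * ·) (l5 ψ).1]) (by rw [f2]; linarith [(l5 ψ).2, congrArg (l * ·) (l5 ψ).2]) (l5 ψ).1 (l5 ψ).2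
      nlinarith [l4 ψ])
    by_contra hcon
    push Not at hcon
    have hsubt : Icc 0 t ⊆ Icc 0 t1 := Icc_subset_Icc_right ht.2
    have hcf : ContinuousOn (fun τ => l * R (τ / l ^ 2) (θ + π) - R τ θ) (Icc 0 t) := by
      refine (continuousOn_const.mul ((hRc (θ + π)).comp (by fun_prop) ?_)).sub ((hRc θ).mono hsubt)
      intro s hs
      exact hdivm l hl s (hsubt hs)
    obtain ⟨τ, hτ, hz⟩ := intermediate_value_Icc' ht.1 hcf (show (0:ℝ) ∈ _ by
      constructor
      · linarith
      · simp only [zero_div]; rw [hR0]; nlinarith [(hFR 0 θ h00).2.1])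
    simp only at hz
    obtain ⟨-, hr, e1, e2⟩ := hFR τ θ (hsubt hτ)
    obtain ⟨-, hr', e1', e2'⟩ := hFR (τ / l ^ 2) (θ + π) (hdivm l hl τ (hsubt hτ))
    have hp := hav τ (hsubt hτ) (F τ θ) (F (τ / l ^ 2) (θ + π))
    rw [e1, e1', e2, e2', cos_add_pi, sin_add_pi] at hp
    have e : R τ θ = l * R (τ / l ^ 2) (θ + π) := by linarith
    rw [e] at hp
    ring_nf at hp
    exact lt_irrefl _ hp
  have hle : ∀ t ∈ Icc 0 t1, ∀ θ, R t θ ≤ R t (θ + π) := by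
    intro t ht θ
    have hT : Tendsto (fun l : ℝ => l * R (t / l ^ 2) (θ + π)) (𝓝[>] 1) (𝓝 (1 * R t (θ + π))) := by
      refine (tendsto_nhdsWithin_of_tendsto_nhds tendsto_id).mul ?_
      have hc := hRc (θ + π) t ht
      refine hc.tendsto.comp (f := fun l : ℝ => t / l ^ 2) ?_
      refine tendsto_inf.2 ?_
      constructor
      · apply tendsto_nhdsWithin_of_tendsto_nhds
        have : ContinuousAt (fun l : ℝ => t / l ^ 2) 1 := by
          apply ContinuousAt.div <;> first | fun_prop | norm_num
        simpa [ContinuousAt] using this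
      · rw [tendsto_principal]
        filter_upwards [self_mem_nhdsWithin] with l hl using hdivm l hl t ht
    rw [one_mul] at hT
    refine ge_of_tendsto hT ?_
    filter_upwards [self_mem_nhdsWithin] with l hl using hnest l hl t ht θ
  intro t ht φ
  obtain ⟨ϑ, ρ, -, l2, l3, l4, l5⟩ := h.lift (hsub ht) (hst t ht)
  obtain ⟨-, hr, e1, e2⟩ := hFR t (ϑ φ) ht
  obtain ⟨-, hr', e1', e2'⟩ := hFR t (ϑ φ + π) ht
  obtain ⟨-, hr'', e1'', e2''⟩ := hFR t (ϑ φ + π + π) ht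
  have hR2 : R t (ϑ φ + π + π) = R t (ϑ φ) := by
    refine huniq t ht (θ := ϑ φ) (φ := F t (ϑ φ + π + π)) hr'' hr ?_ ?_ e1 e2
    · rw [e1'', cos_add_pi, cos_add_pi, neg_neg]
    · rw [e2'', sin_add_pi, sin_add_pi, neg_neg]
  have hRe : R t (ϑ φ + π) = R t (ϑ φ) := by
    apply le_antisymm
    · rw [← hR2]; exact hle t ht _
    · exact hle t ht _
  have hRρ : R t (ϑ φ) = ρ φ := huniq t ht hr (l4 φ) e1 e2 (l5 φ).1 (l5 φ).2
  refine ⟨F t (ϑ φ + π), ?_, ?_⟩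
  · rw [e1', hRe, hRρ, cos_add_pi, (l5 φ).1]; ring
  · rw [e2', hRe, hRρ, sin_add_pi, (l5 φ).2]; ring

end CSF
end

end

section

open Real Set MeasureTheory Filter Topology
noncomputable section

lemma ne_of_symm {x y : ℝ → ℝ} (cx : Continuous x) (cy : Continuous y)
    (px : Function.Periodic x (2 * π)) (py : Function.Periodic y (2 * π))
    (emb : ∀ φ ψ, φ < ψ → ψ < φ + 2 * π → ¬ (x φ = x ψ ∧ y φ = y ψ))
    (hs : ∀ φ, ∃ ψ, x ψ = -x φ ∧ y ψ = -y φ) : ∀ φ, 0 < x φ ^ 2 + y φ ^ 2 := by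
  intro φ0
  by_contra hcon
  have hx0 : x φ0 = 0 := by nlinarith [sq_nonneg (x φ0), sq_nonneg (y φ0)]
  have hy0 : y φ0 = 0 := by nlinarith [sq_nonneg (x φ0), sq_nonneg (y φ0)]
  have hπ := Real.two_pi_pos
  set I := Icc φ0 (φ0 + 2 * π) with hI
  set J := Ioo φ0 (φ0 + 2 * π) with hJ
  have hJne : ∀ φ ∈ J, ¬ (x φ = 0 ∧ y φ = 0) := by
    rintro φ hφ ⟨e1, e2⟩
    exact emb φ0 φ hφ.1 hφ.2 ⟨by rw [e1, hx0], by rw [e2, hy0]⟩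
  have hxe : x (φ0 + 2 * π) = 0 := by rw [px, hx0]
  have hye : y (φ0 + 2 * π) = 0 := by rw [py, hy0]
  have hIJ : ∀ φ ∈ J, ∀ ψ ∈ I, x ψ = -x φ → y ψ = -y φ → ψ ∈ J := by
    intro φ hφ ψ hψ e1 e2
    refine ⟨lt_of_le_of_ne hψ.1 ?_, lt_of_le_of_ne hψ.2 ?_⟩
    · rintro rfl
      exact hJne φ hφ ⟨by linarith, by linarith⟩
    · rintro rfl
      exact hJne φ hφ ⟨by linarith, by linarith⟩
  have hex : ∀ φ ∈ J, ∃ ψ ∈ J, x ψ = -x φ ∧ y ψ = -y φ := by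
    intro φ hφ
    obtain ⟨ψ, e1, e2⟩ := hs φ
    have hm := toIcoMod_mem_Ico hπ φ0 ψ
    have g1 : x (toIcoMod hπ φ0 ψ) = -x φ := by
      rw [← self_sub_toIcoDiv_zsmul, px.sub_zsmul_eq, e1]
    have g2 : y (toIcoMod hπ φ0 ψ) = -y φ := by
      rw [← self_sub_toIcoDiv_zsmul, py.sub_zsmul_eq, e2]
    exact ⟨_, hIJ φ hφ _ ⟨hm.1, hm.2.le⟩ g1 g2, g1, g2⟩
  have hcl : ∀ Q : Set (ℝ × ℝ), IsClosed Q → IsClosed (Prod.fst '' ((I ×ˢ I) ∩ (Q ∩ {p | x p.2 = -x p.1 ∧ y p.2 = -y p.1}))) := by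
    intro Q hQ
    refine IsCompact.isClosed (IsCompact.image ?_ continuous_fst)
    refine (isCompact_Icc.prod isCompact_Icc).inter_right (hQ.inter ?_)
    exact (isClosed_eq (by fun_prop) (by fun_prop)).inter (isClosed_eq (by fun_prop) (by fun_prop))
  have c1 := hcl {p | p.1 ≤ p.2} (isClosed_le (by fun_prop) (by fun_prop))
  have c2 := hcl {p | p.2 ≤ p.1} (isClosed_le (by fun_prop) (by fun_prop))
  have hJI : J ⊆ I := Ioo_subset_Icc_self
  have hmid : φ0 + π ∈ J := ⟨by linarith, by linarith⟩
  obtain ⟨ψm, hψm, m1, m2⟩ := hex _ hmid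
  have hpre := (isPreconnected_closed_iff.1 (isPreconnected_Ioo (a := φ0) (b := φ0 + 2 * π))) _ _ c1 c2
    (by
      intro φ hφ
      obtain ⟨ψ, hψ, e⟩ := hex φ hφ
      rcases le_total φ ψ with hle | hle
      · exact Or.inl ⟨(φ, ψ), ⟨⟨hJI hφ, hJI hψ⟩, hle, e⟩, rfl⟩
      · exact Or.inr ⟨(φ, ψ), ⟨⟨hJI hφ, hJI hψ⟩, hle, e⟩, rfl⟩)
    (by
      rcases le_total (φ0 + π) ψm with hle | hle
      · exact ⟨φ0 + π, hmid, (φ0 + π, ψm), ⟨⟨hJI hmid, hJI hψm⟩, hle, m1, m2⟩, rfl⟩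
      · exact ⟨ψm, hψm, (ψm, φ0 + π), ⟨⟨hJI hψm, hJI hmid⟩, hle, by simp [m1], by simp [m2]⟩, rfl⟩)
    (by
      rcases le_total ψm (φ0 + π) with hle | hle
      · exact ⟨φ0 + π, hmid, (φ0 + π, ψm), ⟨⟨hJI hmid, hJI hψm⟩, hle, m1, m2⟩, rfl⟩
      · exact ⟨ψm, hψm, (ψm, φ0 + π), ⟨⟨hJI hψm, hJI hmid⟩, hle, by simp [m1], by simp [m2]⟩, rfl⟩)
  obtain ⟨φ, hφ, ⟨⟨φ', ψ1⟩, ⟨⟨-, i1⟩, g1, f1, f1'⟩, q1⟩, ⟨⟨φ'', ψ2⟩, ⟨⟨-, i2⟩, g2, f2, f2'⟩, q2⟩⟩ := hpre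
  dsimp only at *
  subst q1
  subst q2
  have j1 := hIJ _ hφ ψ1 i1 f1 f1'
  have j2 := hIJ _ hφ ψ2 i2 f2 f2'
  change φ'' ≤ ψ1 at g1
  change ψ2 ≤ φ'' at g2
  by_cases heq : ψ2 = ψ1
  · have : ψ1 = φ'' := le_antisymm (heq ▸ g2) g1
    subst this
    exact hJne _ hφ ⟨by linarith, by linarith⟩
  · exact emb ψ2 ψ1 (lt_of_le_of_ne (g2.trans g1) heq) (by linarith [j1.2, j2.1]) ⟨by rw [f1, f2], by rw [f1', f2']⟩

namespace CSF
variable {T : ℝ} {a b : ℝ → ℝ → ℝ}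

lemma symm_closed (h : CSF T a b) {t : ℝ} (ht : t ∈ Ico 0 T) (ht0 : 0 < t)
    (hs : ∀ s ∈ Ico 0 t, Symm a b s) : Symm a b t := by
  intro φ
  have hex : ∀ s, ∃ ψ, s ∈ Ico 0 t → ψ ∈ Icc 0 (2 * π) ∧ a s ψ = -a s φ ∧ b s ψ = -b s φ := by
    intro s
    by_cases hst : s ∈ Ico 0 t
    · obtain ⟨ψ, e1, e2⟩ := hs s hst φ
      obtain ⟨ψ', h1, h2⟩ := exists_mod ψ
      have hsT : s ∈ Ico 0 T := ⟨hst.1, hst.2.trans ht.2⟩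
      exact ⟨ψ', fun _ => ⟨h1, by rw [h2 _ (h.per_a s hsT), e1], by rw [h2 _ (h.per_b s hsT), e2]⟩⟩
    · exact ⟨0, fun h => absurd h hst⟩
  choose F hF using hex
  have : (𝓝[Ico 0 t] t).NeBot := by
    rw [← mem_closure_iff_nhdsWithin_neBot, closure_Ico ht0.ne]
    exact ⟨ht0.le, le_rfl⟩
  set g := Ultrafilter.of (𝓝[Ico 0 t] t) with hg
  have hgl : (g : Filter ℝ) ≤ 𝓝[Ico 0 t] t := Ultrafilter.of_le _
  have hgI : Ico 0 t ∈ g := hgl self_mem_nhdsWithin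
  have hgt : Tendsto id (g : Filter ℝ) (𝓝 t) := (hgl.trans nhdsWithin_le_nhds)
  have hK : Icc 0 (2 * π) ∈ g.map F := by
    rw [Ultrafilter.mem_map]
    filter_upwards [hgI] with s hs using (hF s hs).1
  obtain ⟨ψ, hψ, hψl⟩ := isCompact_Icc.ultrafilter_le_nhds (g.map F) (le_principal_iff.2 hK)
  have hψl' : Tendsto F (g : Filter ℝ) (𝓝 ψ) := hψl
  have hlim : ∀ H : ℝ → ℝ → ℝ, Sm (Ico 0 T) H → ∀ (G : ℝ → ℝ) (χ : ℝ), Tendsto G (g : Filter ℝ) (𝓝 χ) →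
      Tendsto (fun s => H s (G s)) (g : Filter ℝ) (𝓝 (H t χ)) := by
    intro H hH G χ hG
    have hc := hH.cont (t, χ) ⟨ht, mem_univ _⟩
    refine hc.tendsto.comp (f := fun s => (s, G s)) ?_
    rw [nhdsWithin, tendsto_inf]
    refine ⟨by rw [nhds_prod_eq]; exact hgt.prodMk hG, tendsto_principal.2 ?_⟩
    filter_upwards [hgI] with s hs using ⟨⟨hs.1, hs.2.trans ht.2⟩, mem_univ _⟩
  refine ⟨ψ, ?_, ?_⟩
  · refine tendsto_nhds_unique (hlim a h.sa F ψ hψl') (Tendsto.congr' ?_ (hlim a h.sa (fun _ => φ) φ tendsto_const_nhds).neg)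
    filter_upwards [hgI] with s hs using (hF s hs).2.1.symm
  · refine tendsto_nhds_unique (hlim b h.sb F ψ hψl') (Tendsto.congr' ?_ (hlim b h.sb (fun _ => φ) φ tendsto_const_nhds).neg)
    filter_upwards [hgI] with s hs using (hF s hs).2.2.symm

theorem ne_zero (h : CSF T a b)
    (h0 : ∀ φ, 0 < a 0 φ * dP b 0 φ - b 0 φ * dP a 0 φ) (hs0 : Symm a b 0) :
    ∀ t ∈ Ico 0 T, ∀ φ, 0 < a t φ ^ 2 + b t φ ^ 2 := by
  intro tb htb φb
  by_contra hcon
  have hsub : Icc 0 tb ⊆ Ico 0 T := fun t ht => ⟨ht.1, ht.2.trans_lt htb.2⟩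
  set K := Icc 0 tb ×ˢ Icc 0 (2 * π) with hK
  have hKs : K ⊆ Ico 0 T ×ˢ univ := Set.prod_mono hsub (subset_univ _)
  have hKc : IsCompact K := isCompact_Icc.prod isCompact_Icc
  have hc : ContinuousOn (fun p : ℝ × ℝ => a p.1 p.2 ^ 2 + b p.1 p.2 ^ 2) K :=
    ((h.sa.cont.mono hKs).pow 2).add ((h.sb.cont.mono hKs).pow 2)
  set Z := Prod.fst '' (K ∩ (fun p : ℝ × ℝ => a p.1 p.2 ^ 2 + b p.1 p.2 ^ 2) ⁻¹' (Iic 0)) with hZ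
  have hZc : IsCompact Z := by
    refine IsCompact.image ?_ continuous_fst
    exact hKc.of_isClosed_subset (hc.preimage_isClosed_of_isClosed hKc.isClosed isClosed_Iic) inter_subset_left
  have hmem : ∀ t ∈ Icc 0 tb, ∀ φ, ¬ (0 < a t φ ^ 2 + b t φ ^ 2) → t ∈ Z := by
    intro t ht φ hφ
    obtain ⟨φ', h1, h2⟩ := exists_mod φ
    refine ⟨(t, φ'), ⟨⟨ht, h1⟩, ?_⟩, rfl⟩
    show a t φ' ^ 2 + b t φ' ^ 2 ≤ 0
    rw [h2 _ (h.per_a t (hsub ht)), h2 _ (h.per_b t (hsub ht))]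
    exact not_lt.1 hφ
  obtain ⟨ts, hts, hmin⟩ := hZc.exists_isLeast ⟨tb, hmem tb ⟨htb.1, le_rfl⟩ φb hcon⟩
  obtain ⟨⟨ts', φs⟩, ⟨⟨k1, k2⟩, k3⟩, rfl⟩ := hts
  dsimp only at *
  change a ts' φs ^ 2 + b ts' φs ^ 2 ≤ 0 at k3
  have hlt : ∀ t ∈ Ico 0 ts', ∀ φ, 0 < a t φ ^ 2 + b t φ ^ 2 := by
    intro t ht φ
    by_contra hh
    have := hmin (hmem t ⟨ht.1, ht.2.le.trans k1.2⟩ φ hh)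
    linarith [ht.2]
  have hpos : 0 < ts' := by
    rcases k1.1.lt_or_eq with hh | hh
    · exact hh
    · rw [← hh] at k3
      have e1 : a 0 φs = 0 := by nlinarith [sq_nonneg (a 0 φs), sq_nonneg (b 0 φs)]
      have e2 : b 0 φs = 0 := by nlinarith [sq_nonneg (a 0 φs), sq_nonneg (b 0 φs)]
      have := h0 φs
      rw [e1, e2] at this
      simp at this
  have hsy : Symm a b ts' := h.symm_closed (hsub k1) hpos (fun s hs => by
    refine h.symm_of_ne (t1 := s) (hsub ⟨hs.1, hs.2.le.trans k1.2⟩) ?_ h0 hs0 s ⟨hs.1, le_rfl⟩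
    intro t ht
    exact hlt t ⟨ht.1, ht.2.trans_lt hs.2⟩)
  have := ne_of_symm (cont_slice h.sa (hsub k1)) (cont_slice h.sb (hsub k1)) (h.per_a _ (hsub k1)) (h.per_b _ (hsub k1))
    (h.emb _ (hsub k1)) hsy φs
  linarith

theorem star_all (h : CSF T a b)
    (h0 : ∀ φ, 0 < a 0 φ * dP b 0 φ - b 0 φ * dP a 0 φ) (hs0 : Symm a b 0) :
    ∀ t ∈ Ico 0 T, ∀ φ, 0 < a t φ * dP b t φ - b t φ * dP a t φ := fun t ht =>
  h.star ht (fun s hs => h.ne_zero h0 hs0 s ⟨hs.1, hs.2.trans_lt ht.2⟩) h0 t ⟨ht.1, le_rfl⟩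

theorem symm_all (h : CSF T a b)
    (h0 : ∀ φ, 0 < a 0 φ * dP b 0 φ - b 0 φ * dP a 0 φ) (hs0 : Symm a b 0) :
    ∀ t ∈ Ico 0 T, Symm a b t := fun t ht =>
  h.symm_of_ne ht (fun s hs => h.ne_zero h0 hs0 s ⟨hs.1, hs.2.trans_lt ht.2⟩) h0 hs0 t ⟨ht.1, le_rfl⟩

end CSF
end

end

section

open Real Set MeasureTheory Filter Topology
noncomputable section

lemma int_deriv_zero {f f' : ℝ → ℝ} (hp : Function.Periodic f (2 * π)) (hd : ∀ φ, HasDerivAt f (f' φ) φ)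
    (hc : Continuous f') : ∫ φ in (0:ℝ)..(2 * π), f' φ = 0 := by
  rw [intervalIntegral.integral_eq_sub_of_hasDerivAt (fun φ _ => hd φ) (hc.intervalIntegrable _ _)]
  have := hp 0
  rw [zero_add] at this
  rw [this, sub_self]

section static
variable {x y x1 y1 x2 y2 : ℝ → ℝ}

lemma turning (hx : ∀ φ, HasDerivAt x (x1 φ) φ) (hy : ∀ φ, HasDerivAt y (y1 φ) φ)
    (hx1 : ∀ φ, HasDerivAt x1 (x2 φ) φ) (hy1 : ∀ φ, HasDerivAt y1 (y2 φ) φ)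
    (cx2 : Continuous x2) (cy2 : Continuous y2)
    (px : Function.Periodic x (2 * π)) (py : Function.Periodic y (2 * π))
    (px1 : Function.Periodic x1 (2 * π)) (py1 : Function.Periodic y1 (2 * π))
    (hst : ∀ φ, 0 < x φ * y1 φ - y φ * x1 φ)
    (hg : ∀ φ, 0 < x1 φ ^ 2 + y1 φ ^ 2)
    {θ : ℝ → ℝ} (hθ : ∀ φ, HasDerivAt θ ((x φ * y1 φ - y φ * x1 φ) / (x φ ^ 2 + y φ ^ 2)) φ)
    (hθp : ∀ φ, θ (φ + 2 * π) = θ φ + 2 * π) :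
    ∫ φ in (0:ℝ)..(2 * π), (x1 φ * y2 φ - y1 φ * x2 φ) / (x1 φ ^ 2 + y1 φ ^ 2) = 2 * π := by
  have cx : Continuous x := continuous_iff_continuousAt.2 fun φ => (hx φ).continuousAt
  have cy : Continuous y := continuous_iff_continuousAt.2 fun φ => (hy φ).continuousAt
  have cx1 : Continuous x1 := continuous_iff_continuousAt.2 fun φ => (hx1 φ).continuousAt
  have cy1 : Continuous y1 := continuous_iff_continuousAt.2 fun φ => (hy1 φ).continuousAt
  have hF : ∀ φ, HasDerivAt (fun φ => θ φ - arctan ((x φ * x1 φ + y φ * y1 φ) / (x φ * y1 φ - y φ * x1 φ)))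
      ((x1 φ * y2 φ - y1 φ * x2 φ) / (x1 φ ^ 2 + y1 φ ^ 2)) φ := by
    intro φ
    have hP := hst φ
    have hS := ((hx φ).mul (hx1 φ)).add ((hy φ).mul (hy1 φ))
    have hPd := ((hx φ).mul (hy1 φ)).sub ((hy φ).mul (hx1 φ))
    refine ((hθ φ).sub ((hS.div hPd hP.ne').arctan)).congr_deriv ?_
    simp only [Pi.add_apply, Pi.mul_apply, Pi.sub_apply, Pi.div_apply]
    have hX : 0 < x φ ^ 2 + y φ ^ 2 := by
      by_contra hcon
      have e1 : x φ = 0 := by nlinarith [sq_nonneg (x φ), sq_nonneg (y φ)]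
      have e2 : y φ = 0 := by nlinarith [sq_nonneg (x φ), sq_nonneg (y φ)]
      rw [e1, e2] at hP
      simp at hP
    have hgφ := hg φ
    generalize x φ = X at *
    generalize y φ = Y at *
    generalize x1 φ = U at *
    generalize y1 φ = V at *
    generalize x2 φ = P at *
    generalize y2 φ = Q at *
    have hP' := hP.ne'
    have e : 1 + ((X * U + Y * V) / (X * V - Y * U)) ^ 2 = ((X ^ 2 + Y ^ 2) * (U ^ 2 + V ^ 2)) / (X * V - Y * U) ^ 2 := by
      rw [div_pow, eq_div_iff (pow_ne_zero 2 hP'), add_mul, div_mul_cancel₀ _ (pow_ne_zero 2 hP')]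
      ring
    rw [e]
    field_simp
    ring
  rw [intervalIntegral.integral_eq_sub_of_hasDerivAt (fun φ _ => hF φ) (Continuous.intervalIntegrable (by
    exact Continuous.div (by fun_prop) (by fun_prop) (fun φ => (hg φ).ne')) _ _)]
  have e1 := px 0; have e2 := py 0; have e3 := px1 0; have e4 := py1 0; have e5 := hθp 0
  rw [zero_add] at e1 e2 e3 e4 e5
  rw [e1, e2, e3, e4, e5]
  ring

/-- Derivative of the unit tangent. -/
lemma tangent_deriv (hx1 : ∀ φ, HasDerivAt x1 (x2 φ) φ) (hy1 : ∀ φ, HasDerivAt y1 (y2 φ) φ)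
    (hg : ∀ φ, 0 < x1 φ ^ 2 + y1 φ ^ 2) (φ : ℝ) :
    HasDerivAt (fun φ => x1 φ / √(x1 φ ^ 2 + y1 φ ^ 2))
      (-(x1 φ * y2 φ - y1 φ * x2 φ) / √(x1 φ ^ 2 + y1 φ ^ 2) ^ 3 * y1 φ) φ ∧
    HasDerivAt (fun φ => y1 φ / √(x1 φ ^ 2 + y1 φ ^ 2))
      ((x1 φ * y2 φ - y1 φ * x2 φ) / √(x1 φ ^ 2 + y1 φ ^ 2) ^ 3 * x1 φ) φ := by
  have hs := Real.sqrt_pos.2 (hg φ)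
  have hsq := Real.sq_sqrt (hg φ).le
  have hG : HasDerivAt (fun φ => √(x1 φ ^ 2 + y1 φ ^ 2)) ((x1 φ * x2 φ + y1 φ * y2 φ) / √(x1 φ ^ 2 + y1 φ ^ 2)) φ := by
    refine ((((hx1 φ).pow 2).add ((hy1 φ).pow 2)).sqrt (hg φ).ne').congr_deriv ?_
    simp only [Pi.add_apply, Pi.pow_apply]
    field_simp
    push_cast
    ring
  refine ⟨((hx1 φ).div hG hs.ne').congr_deriv ?_, ((hy1 φ).div hG hs.ne').congr_deriv ?_⟩
  all_goals
    generalize √(x1 φ ^ 2 + y1 φ ^ 2) = s at *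
    field_simp
    rw [hsq]
    ring

lemma support_len (hx : ∀ φ, HasDerivAt x (x1 φ) φ) (hy : ∀ φ, HasDerivAt y (y1 φ) φ)
    (hx1 : ∀ φ, HasDerivAt x1 (x2 φ) φ) (hy1 : ∀ φ, HasDerivAt y1 (y2 φ) φ)
    (cx2 : Continuous x2) (cy2 : Continuous y2)
    (px : Function.Periodic x (2 * π)) (py : Function.Periodic y (2 * π))
    (px1 : Function.Periodic x1 (2 * π)) (py1 : Function.Periodic y1 (2 * π))
    (hg : ∀ φ, 0 < x1 φ ^ 2 + y1 φ ^ 2) :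
    ∫ φ in (0:ℝ)..(2 * π), (x1 φ * y2 φ - y1 φ * x2 φ) * (x φ * y1 φ - y φ * x1 φ) / √(x1 φ ^ 2 + y1 φ ^ 2) ^ 3
      = ∫ φ in (0:ℝ)..(2 * π), √(x1 φ ^ 2 + y1 φ ^ 2) := by
  have cx : Continuous x := continuous_iff_continuousAt.2 fun φ => (hx φ).continuousAt
  have cy : Continuous y := continuous_iff_continuousAt.2 fun φ => (hy φ).continuousAt
  have cx1 : Continuous x1 := continuous_iff_continuousAt.2 fun φ => (hx1 φ).continuousAt
  have cy1 : Continuous y1 := continuous_iff_continuousAt.2 fun φ => (hy1 φ).continuousAt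
  have hs := fun φ => Real.sqrt_pos.2 (hg φ)
  have c1 : Continuous fun φ => (x1 φ * y2 φ - y1 φ * x2 φ) * (x φ * y1 φ - y φ * x1 φ) / √(x1 φ ^ 2 + y1 φ ^ 2) ^ 3 :=
    Continuous.div (by fun_prop) (by fun_prop) (fun φ => (pow_pos (hs φ) 3).ne')
  have c2 : Continuous fun φ => √(x1 φ ^ 2 + y1 φ ^ 2) := by fun_prop
  have := int_deriv_zero (f := fun φ => x φ * (x1 φ / √(x1 φ ^ 2 + y1 φ ^ 2)) + y φ * (y1 φ / √(x1 φ ^ 2 + y1 φ ^ 2)))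
    (f' := fun φ => √(x1 φ ^ 2 + y1 φ ^ 2) - (x1 φ * y2 φ - y1 φ * x2 φ) * (x φ * y1 φ - y φ * x1 φ) / √(x1 φ ^ 2 + y1 φ ^ 2) ^ 3)
    (by intro φ; simp only [px φ, py φ, px1 φ, py1 φ])
    (by
      intro φ
      obtain ⟨t1, t2⟩ := tangent_deriv hx1 hy1 hg φ
      refine (((hx φ).mul t1).add ((hy φ).mul t2)).congr_deriv ?_
      have hsφ := hs φ
      have hsq := Real.sq_sqrt (hg φ).le
      generalize √(x1 φ ^ 2 + y1 φ ^ 2) = s at *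
      field_simp
      linear_combination (-s ^ 2) * hsq)
    (c2.sub c1)
  rw [intervalIntegral.integral_sub (c2.intervalIntegrable _ _) (c1.intervalIntegrable _ _)] at this
  linarith

lemma radius_le (hx : ∀ φ, HasDerivAt x (x1 φ) φ) (hy : ∀ φ, HasDerivAt y (y1 φ) φ)
    (cx1 : Continuous x1) (cy1 : Continuous y1)
    (px : Function.Periodic x (2 * π)) (py : Function.Periodic y (2 * π))
    (px1 : Function.Periodic x1 (2 * π)) (py1 : Function.Periodic y1 (2 * π))
    (hs : ∀ φ, ∃ ψ, x ψ = -x φ ∧ y ψ = -y φ) (φ : ℝ) :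
    √(x φ ^ 2 + y φ ^ 2) ≤ (∫ φ in (0:ℝ)..(2 * π), √(x1 φ ^ 2 + y1 φ ^ 2)) / 2 := by
  have hπ := Real.two_pi_pos
  have cg : Continuous fun φ => √(x1 φ ^ 2 + y1 φ ^ 2) := by fun_prop
  have hLp : ∫ s in φ..φ + 2 * π, √(x1 s ^ 2 + y1 s ^ 2) = ∫ s in (0:ℝ)..(2 * π), √(x1 s ^ 2 + y1 s ^ 2) := by
    have hp : Function.Periodic (fun s => √(x1 s ^ 2 + y1 s ^ 2)) (2 * π) := by
      intro s; simp only [px1 s, py1 s]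
    have := hp.intervalIntegral_add_eq φ 0
    rwa [zero_add] at this
  obtain ⟨ψ', e1, e2⟩ := hs φ
  have hm := toIcoMod_mem_Ico hπ φ ψ'
  have g1 : x (toIcoMod hπ φ ψ') = -x φ := by
    rw [← self_sub_toIcoDiv_zsmul, px.sub_zsmul_eq, e1]
  have g2 : y (toIcoMod hπ φ ψ') = -y φ := by
    rw [← self_sub_toIcoDiv_zsmul, py.sub_zsmul_eq, e2]
  set ψ := toIcoMod hπ φ ψ' with hψ
  have hLψ : ∫ s in φ..ψ, √(x1 s ^ 2 + y1 s ^ 2) ≤ ∫ s in (0:ℝ)..(2 * π), √(x1 s ^ 2 + y1 s ^ 2) := by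
    rw [← hLp, ← intervalIntegral.integral_add_adjacent_intervals (cg.intervalIntegrable φ ψ) (cg.intervalIntegrable ψ (φ + 2 * π))]
    have := intervalIntegral.integral_nonneg (μ := volume) hm.2.le (f := fun s => √(x1 s ^ 2 + y1 s ^ 2)) (fun s _ => Real.sqrt_nonneg _)
    linarith
  set R := √(x φ ^ 2 + y φ ^ 2) with hR
  have hR2 : R ^ 2 = x φ ^ 2 + y φ ^ 2 := Real.sq_sqrt (by positivity)
  have hR0 : 0 ≤ R := Real.sqrt_nonneg _
  have hInt0 : ∫ s in φ..ψ, -(x φ * x1 s + y φ * y1 s) = 2 * R ^ 2 := by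
    rw [intervalIntegral.integral_eq_sub_of_hasDerivAt (f := fun s => -(x φ * x s + y φ * y s))
      (fun s _ => (((hx s).const_mul (x φ)).add ((hy s).const_mul (y φ))).neg) (Continuous.intervalIntegrable (by fun_prop) _ _), g1, g2, hR2]
    ring
  have hmono : ∫ s in φ..ψ, -(x φ * x1 s + y φ * y1 s) ≤ ∫ s in φ..ψ, R * √(x1 s ^ 2 + y1 s ^ 2) := by
    refine intervalIntegral.integral_mono_on hm.1 (Continuous.intervalIntegrable (by fun_prop) _ _) (Continuous.intervalIntegrable (by fun_prop) _ _) ?_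
    intro s _
    rw [hR, ← Real.sqrt_mul (by positivity)]
    apply Real.le_sqrt_of_sq_le
    nlinarith [sq_nonneg (x φ * y1 s - y φ * x1 s)]
  rw [intervalIntegral.integral_const_mul, hInt0] at hmono
  rcases hR0.eq_or_lt with h0 | h0
  · rw [← h0]
    have := intervalIntegral.integral_nonneg (μ := volume) hπ.le (f := fun s => √(x1 s ^ 2 + y1 s ^ 2)) (fun s _ => Real.sqrt_nonneg _)
    linarith
  · have : R * (2 * R) ≤ R * ∫ s in (0:ℝ)..(2 * π), √(x1 s ^ 2 + y1 s ^ 2) := by nlinarith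
    have := le_of_mul_le_mul_left this h0
    linarith

lemma energy_ge (hx : ∀ φ, HasDerivAt x (x1 φ) φ) (hy : ∀ φ, HasDerivAt y (y1 φ) φ)
    (hx1 : ∀ φ, HasDerivAt x1 (x2 φ) φ) (hy1 : ∀ φ, HasDerivAt y1 (y2 φ) φ)
    (cx2 : Continuous x2) (cy2 : Continuous y2)
    (px : Function.Periodic x (2 * π)) (py : Function.Periodic y (2 * π))
    (px1 : Function.Periodic x1 (2 * π)) (py1 : Function.Periodic y1 (2 * π))
    (hs : ∀ φ, ∃ ψ, x ψ = -x φ ∧ y ψ = -y φ)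
    (hst : ∀ φ, 0 < x φ * y1 φ - y φ * x1 φ)
    (hg : ∀ φ, 0 < x1 φ ^ 2 + y1 φ ^ 2) {A : ℝ} (hA : 0 < A)
    (hAi : ∫ φ in (0:ℝ)..(2 * π), (x φ * y1 φ - y φ * x1 φ) = 2 * A) :
    (∫ φ in (0:ℝ)..(2 * π), √(x1 φ ^ 2 + y1 φ ^ 2)) / A ≤
      ∫ φ in (0:ℝ)..(2 * π), (x1 φ * y2 φ - y1 φ * x2 φ) ^ 2 / √(x1 φ ^ 2 + y1 φ ^ 2) ^ 5 := by
  have cx : Continuous x := continuous_iff_continuousAt.2 fun φ => (hx φ).continuousAt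
  have cy : Continuous y := continuous_iff_continuousAt.2 fun φ => (hy φ).continuousAt
  have cx1 : Continuous x1 := continuous_iff_continuousAt.2 fun φ => (hx1 φ).continuousAt
  have cy1 : Continuous y1 := continuous_iff_continuousAt.2 fun φ => (hy1 φ).continuousAt
  have hsq := fun φ => Real.sqrt_pos.2 (hg φ)
  have hlen := support_len hx hy hx1 hy1 cx2 cy2 px py px1 py1 hg
  have hrad := radius_le hx hy cx1 cy1 px py px1 py1 hs
  set L := ∫ φ in (0:ℝ)..(2 * π), √(x1 φ ^ 2 + y1 φ ^ 2) with hL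
  have c1 : Continuous fun φ => (x1 φ * y2 φ - y1 φ * x2 φ) * (x φ * y1 φ - y φ * x1 φ) / √(x1 φ ^ 2 + y1 φ ^ 2) ^ 3 :=
    Continuous.div (by fun_prop) (by fun_prop) (fun φ => (pow_pos (hsq φ) 3).ne')
  have c2 : Continuous fun φ => (x1 φ * y2 φ - y1 φ * x2 φ) ^ 2 / √(x1 φ ^ 2 + y1 φ ^ 2) ^ 5 :=
    Continuous.div (by fun_prop) (by fun_prop) (fun φ => (pow_pos (hsq φ) 5).ne')
  have c3 : Continuous fun φ => (x φ * y1 φ - y φ * x1 φ) := by fun_prop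
  have hmono : ∫ φ in (0:ℝ)..(2 * π), (2 / A * ((x1 φ * y2 φ - y1 φ * x2 φ) * (x φ * y1 φ - y φ * x1 φ) / √(x1 φ ^ 2 + y1 φ ^ 2) ^ 3)
       - L / (2 * A ^ 2) * (x φ * y1 φ - y φ * x1 φ)) ≤
      ∫ φ in (0:ℝ)..(2 * π), (x1 φ * y2 φ - y1 φ * x2 φ) ^ 2 / √(x1 φ ^ 2 + y1 φ ^ 2) ^ 5 := by
    refine intervalIntegral.integral_mono_on Real.two_pi_pos.le (Continuous.intervalIntegrable ((c1.const_mul _).sub (c3.const_mul _)) _ _)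
      (c2.intervalIntegrable _ _) ?_
    intro φ _
    have hP := hst φ
    have hPle : x φ * y1 φ - y φ * x1 φ ≤ L / 2 * √(x1 φ ^ 2 + y1 φ ^ 2) := by
      refine le_trans ?_ (mul_le_mul_of_nonneg_right (hrad φ) (hsq φ).le)
      rw [← Real.sqrt_mul (by positivity)]
      apply Real.le_sqrt_of_sq_le
      nlinarith [sq_nonneg (x φ * x1 φ + y φ * y1 φ)]
    have hs := hsq φ
    generalize √(x1 φ ^ 2 + y1 φ ^ 2) = s at *
    generalize x φ * y1 φ - y φ * x1 φ = P at *
    generalize x1 φ * y2 φ - y1 φ * x2 φ = D at *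
    have e1 : 0 ≤ s * (D / s ^ 3 - P / (s * A)) ^ 2 := by positivity
    have e2 : s * (D / s ^ 3 - P / (s * A)) ^ 2 = D ^ 2 / s ^ 5 - 2 / A * (D * P / s ^ 3) + P ^ 2 / (s * A ^ 2) := by
      field_simp
      ring
    have e3 : P ^ 2 / (s * A ^ 2) ≤ L / (2 * A ^ 2) * P := by
      rw [div_le_iff₀ (by positivity)]
      have : L / (2 * A ^ 2) * P * (s * A ^ 2) = P * (L / 2 * s) := by field_simp
      rw [this, sq]
      exact mul_le_mul_of_nonneg_left hPle hP.le
    linarith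
  rw [intervalIntegral.integral_sub ((c1.const_mul _).intervalIntegrable _ _) ((c3.const_mul _).intervalIntegrable _ _),
    intervalIntegral.integral_const_mul, intervalIntegral.integral_const_mul, hlen, hAi] at hmono
  refine le_trans (le_of_eq ?_) hmono
  field_simp
  ring

end static
end

end

section

open Real Set MeasureTheory Filter Topology
noncomputable section

lemma Sm.mul {I : Set ℝ} {H G : ℝ → ℝ → ℝ} (h : Sm I H) (g : Sm I G) : Sm I (fun t φ => H t φ * G t φ) :=
  ContDiffOn.mul h g
lemma Sm.sub {I : Set ℝ} {H G : ℝ → ℝ → ℝ} (h : Sm I H) (g : Sm I G) : Sm I (fun t φ => H t φ - G t φ) :=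
  ContDiffOn.sub h g
lemma Sm.speed {I : Set ℝ} {H G : ℝ → ℝ → ℝ} (h : Sm I H) (g : Sm I G) (hp : ∀ t ∈ I, ∀ φ, 0 < H t φ ^ 2 + G t φ ^ 2) :
    Sm I (fun t φ => √(H t φ ^ 2 + G t φ ^ 2)) :=
  ContDiffOn.sqrt ((ContDiffOn.pow h 2).add (ContDiffOn.pow g 2)) (fun p hp' => (hp p.1 hp'.1 p.2).ne')

lemma Sm.cont_slice {I : Set ℝ} {H : ℝ → ℝ → ℝ} (h : Sm I H) {t : ℝ} (ht : t ∈ I) : Continuous (H t) :=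
  continuous_iff_continuousAt.2 fun φ => (h.hasDerivAt ht φ).continuousAt

lemma Sm.hasDerivAt_integral {T : ℝ} {H : ℝ → ℝ → ℝ} (h : Sm (Ioo 0 T) H) {t : ℝ} (ht : t ∈ Ioo 0 T) :
    HasDerivAt (fun t => ∫ φ in (0:ℝ)..(2 * π), H t φ) (∫ φ in (0:ℝ)..(2 * π), _root_.dT H t φ) t := by
  obtain ⟨c, hc1, hc2⟩ := exists_between ht.1
  obtain ⟨d, hd1, hd2⟩ := exists_between ht.2
  have hsub : Icc c d ⊆ Ioo 0 T := fun s hs => ⟨hc1.trans_le hs.1, hs.2.trans_lt hd2⟩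
  have hd := h.dT isOpen_Ioo
  have hK : IsCompact (Icc c d ×ˢ Icc 0 (2 * π)) := isCompact_Icc.prod isCompact_Icc
  obtain ⟨C, hC⟩ := hK.exists_bound_of_continuousOn (hd.cont.mono (Set.prod_mono hsub (subset_univ _)))
  have hIoc : ∀ φ ∈ uIoc (0:ℝ) (2 * π), φ ∈ Icc 0 (2 * π) := by
    intro φ hφ
    rw [uIoc_of_le Real.two_pi_pos.le] at hφ
    exact ⟨hφ.1.le, hφ.2⟩
  refine (intervalIntegral.hasDerivAt_integral_of_dominated_loc_of_deriv_le (s := Icc c d) (bound := fun _ => C)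
    (Icc_mem_nhds hc2 hd1) ?_ ?_ ?_ ?_ ?_ ?_).2
  · filter_upwards [Icc_mem_nhds hc2 hd1] with s hs
    exact (h.cont_slice (hsub hs)).aestronglyMeasurable
  · exact (h.cont_slice ht).intervalIntegrable _ _
  · exact (hd.cont_slice ht).aestronglyMeasurable
  · exact Eventually.of_forall fun φ hφ s hs => hC (s, φ) ⟨hs, hIoc φ hφ⟩
  · exact intervalIntegrable_const
  · exact Eventually.of_forall fun φ hφ s hs => h.hasDerivAt_t isOpen_Ioo (hsub hs) φ

lemma Sm.continuousOn_integral {T : ℝ} {H : ℝ → ℝ → ℝ} (h : Sm (Ico 0 T) H) {t1 : ℝ} (ht1 : t1 ∈ Ico 0 T) :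
    ContinuousOn (fun t => ∫ φ in (0:ℝ)..(2 * π), H t φ) (Icc 0 t1) := by
  have hsub : Icc 0 t1 ⊆ Ico 0 T := fun t ht => ⟨ht.1, ht.2.trans_lt ht1.2⟩
  have hK : IsCompact (Icc 0 t1 ×ˢ Icc 0 (2 * π)) := isCompact_Icc.prod isCompact_Icc
  obtain ⟨C, hC⟩ := hK.exists_bound_of_continuousOn (h.cont.mono (Set.prod_mono hsub (subset_univ _)))
  have hIoc : ∀ φ ∈ uIoc (0:ℝ) (2 * π), φ ∈ Icc 0 (2 * π) := by
    intro φ hφ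
    rw [uIoc_of_le Real.two_pi_pos.le] at hφ
    exact ⟨hφ.1.le, hφ.2⟩
  intro t ht
  refine intervalIntegral.continuousWithinAt_of_dominated_interval (bound := fun _ => C) ?_ ?_ intervalIntegrable_const ?_
  · filter_upwards [self_mem_nhdsWithin] with s hs
    exact (h.cont_slice (hsub hs)).aestronglyMeasurable
  · filter_upwards [self_mem_nhdsWithin] with s hs
    exact Eventually.of_forall fun φ hφ => hC (s, φ) ⟨hs, hIoc φ hφ⟩
  · refine Eventually.of_forall fun φ hφ => ?_
    have := h.cont (t, φ) ⟨hsub ht, mem_univ _⟩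
    exact ContinuousWithinAt.comp (f := fun s => (s, φ)) this (by fun_prop) (fun s hs => ⟨hsub hs, mem_univ _⟩)

namespace CSF
variable {T : ℝ} {a b : ℝ → ℝ → ℝ}

lemma dT_periodic {H : ℝ → ℝ → ℝ} (hp : ∀ t ∈ Ico 0 T, Function.Periodic (H t) (2 * π)) {t : ℝ} (ht : t ∈ Ioo 0 T) :
    Function.Periodic (dT H t) (2 * π) := by
  intro φ
  unfold dT
  apply Filter.EventuallyEq.deriv_eq
  filter_upwards [isOpen_Ioo.mem_nhds ht] with s hs using hp s (ioo_ico hs) φ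

lemma area_deriv (h : CSF T a b)
    (hst : ∀ t ∈ Ico 0 T, ∀ φ, 0 < a t φ * dP b t φ - b t φ * dP a t φ) {t : ℝ} (ht : t ∈ Ioo 0 T) :
    HasDerivAt (fun t => ∫ φ in (0:ℝ)..(2 * π), (a t φ * dP b t φ - b t φ * dP a t φ)) (-(4 * π)) t := by
  have ht' := ioo_ico ht
  have oa := h.sa.mono (ioo_ico (T := T))
  have ob := h.sb.mono (ioo_ico (T := T))
  have oa1 := oa.dP ud_ioo
  have ob1 := ob.dP ud_ioo
  have oa2 := oa1.dP ud_ioo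
  have ob2 := ob1.dP ud_ioo
  have ta := oa.dT isOpen_Ioo
  have tb := ob.dT isOpen_Ioo
  have ta1 := ta.dP ud_ioo
  have tb1 := tb.dP ud_ioo
  have ca := oa.cont_slice ht
  have cb := ob.cont_slice ht
  have ca1 := oa1.cont_slice ht
  have cb1 := ob1.cont_slice ht
  have ca2 := oa2.cont_slice ht
  have cb2 := ob2.cont_slice ht
  have cta := ta.cont_slice ht
  have ctb := tb.cont_slice ht
  have cta1 := ta1.cont_slice ht
  have ctb1 := tb1.cont_slice ht
  have hreg := h.reg t ht'
  refine (((oa.mul ob1).sub (ob.mul oa1)).hasDerivAt_integral ht).congr_deriv ?_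
  obtain ⟨θ, ρ, l1, -, l3, -, -⟩ := h.lift ht' (hst t ht')
  have hturn := turning (oa.hasDerivAt ht) (ob.hasDerivAt ht) (oa1.hasDerivAt ht) (ob1.hasDerivAt ht) ca2 cb2
    (h.per_a t ht') (h.per_b t ht') (dP_periodic (h.per_a t ht')) (dP_periodic (h.per_b t ht')) (hst t ht') hreg l1 l3
  have hz := int_deriv_zero (f := fun φ => a t φ * dT b t φ - b t φ * dT a t φ)
    (f' := fun φ => dP a t φ * dT b t φ + a t φ * dP (dT b) t φ - (dP b t φ * dT a t φ + b t φ * dP (dT a) t φ))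
    (by
      intro φ
      simp only [h.per_a t ht' φ, h.per_b t ht' φ, dT_periodic h.per_a ht φ, dT_periodic h.per_b ht φ])
    (fun φ => ((oa.hasDerivAt ht φ).mul (tb.hasDerivAt ht φ)).sub ((ob.hasDerivAt ht φ).mul (ta.hasDerivAt ht φ)))
    (by fun_prop)
  have e : ∀ φ, dT (fun t φ => a t φ * dP b t φ - b t φ * dP a t φ) t φ =
      (-2) * ((dP a t φ * dP (dP b) t φ - dP b t φ * dP (dP a) t φ) / (dP a t φ ^ 2 + dP b t φ ^ 2)) +
      (dP a t φ * dT b t φ + a t φ * dP (dT b) t φ - (dP b t φ * dT a t φ + b t φ * dP (dT a) t φ)) := by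
    intro φ
    have hd := (((oa.hasDerivAt_t isOpen_Ioo ht φ).mul (ob1.hasDerivAt_t isOpen_Ioo ht φ)).sub
      ((ob.hasDerivAt_t isOpen_Ioo ht φ).mul (oa1.hasDerivAt_t isOpen_Ioo ht φ))).deriv
    have hf := h.flow t ht φ
    have hf' : (dP a t φ * dP (dP b) t φ - dP b t φ * dP (dP a) t φ) / (dP a t φ ^ 2 + dP b t φ ^ 2)
       = -(dT a t φ * dP b t φ - dT b t φ * dP a t φ) := by
      rw [div_eq_iff (hreg φ).ne']
      linarith
    rw [hf']
    have hd' : dT (fun t φ => a t φ * dP b t φ - b t φ * dP a t φ) t φ = _ := hd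
    rw [hd', oa.comm isOpen_Ioo ht, ob.comm isOpen_Ioo ht]
    ring
  simp_rw [e]
  rw [intervalIntegral.integral_add, intervalIntegral.integral_const_mul, hturn, hz]
  · ring
  · apply Continuous.intervalIntegrable
    exact continuous_const.mul (Continuous.div (by fun_prop) (by fun_prop) (fun φ => (hreg φ).ne'))
  · apply Continuous.intervalIntegrable
    fun_prop

lemma area_eq (h : CSF T a b)
    (hst : ∀ t ∈ Ico 0 T, ∀ φ, 0 < a t φ * dP b t φ - b t φ * dP a t φ) {t : ℝ} (ht : t ∈ Ico 0 T) :
    ∫ φ in (0:ℝ)..(2 * π), (a t φ * dP b t φ - b t φ * dP a t φ) =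
     (∫ φ in (0:ℝ)..(2 * π), (a 0 φ * dP b 0 φ - b 0 φ * dP a 0 φ)) - 4 * π * t := by
  rcases ht.1.eq_or_lt with h0 | h0
  · rw [← h0]; ring
  have hc := (((h.sa.mul (h.sb.dP ud_ico)).sub (h.sb.mul (h.sa.dP ud_ico))).continuousOn_integral ht)
  obtain ⟨c, hc1, hc2⟩ := exists_hasDerivAt_eq_slope _ (fun _ => -(4 * π)) h0 hc
    (fun s hs => h.area_deriv hst ⟨hs.1, hs.2.trans ht.2⟩)
  rw [sub_zero, eq_div_iff h0.ne'] at hc2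
  linarith

lemma len_deriv (h : CSF T a b) {t : ℝ} (ht : t ∈ Ioo 0 T) :
    HasDerivAt (fun t => ∫ φ in (0:ℝ)..(2 * π), √(dP a t φ ^ 2 + dP b t φ ^ 2))
      (-∫ φ in (0:ℝ)..(2 * π), (dP a t φ * dP (dP b) t φ - dP b t φ * dP (dP a) t φ) ^ 2 / √(dP a t φ ^ 2 + dP b t φ ^ 2) ^ 5) t := by
  have ht' := ioo_ico ht
  have oa := h.sa.mono (ioo_ico (T := T))
  have ob := h.sb.mono (ioo_ico (T := T))
  have oa1 := oa.dP ud_ioo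
  have ob1 := ob.dP ud_ioo
  have oa2 := oa1.dP ud_ioo
  have ob2 := ob1.dP ud_ioo
  have ta := oa.dT isOpen_Ioo
  have tb := ob.dT isOpen_Ioo
  have ta1 := ta.dP ud_ioo
  have tb1 := tb.dP ud_ioo
  have ca1 := oa1.cont_slice ht
  have cb1 := ob1.cont_slice ht
  have ca2 := oa2.cont_slice ht
  have cb2 := ob2.cont_slice ht
  have cta := ta.cont_slice ht
  have ctb := tb.cont_slice ht
  have cta1 := ta1.cont_slice ht
  have ctb1 := tb1.cont_slice ht
  have hreg := h.reg t ht'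
  have hsq := fun φ => Real.sqrt_pos.2 (hreg φ)
  have cs : Continuous fun φ => √(dP a t φ ^ 2 + dP b t φ ^ 2) := by fun_prop
  refine ((oa1.speed ob1 (fun s hs => h.reg s (ioo_ico hs))).hasDerivAt_integral ht).congr_deriv ?_
  have c1 : Continuous fun φ => (dP a t φ * dP (dP b) t φ - dP b t φ * dP (dP a) t φ) ^ 2 / √(dP a t φ ^ 2 + dP b t φ ^ 2) ^ 5 :=
    Continuous.div (by fun_prop) (by fun_prop) (fun φ => (pow_pos (hsq φ) 5).ne')
  have c2 : Continuous fun φ => (dP a t φ * dP (dT a) t φ + dP b t φ * dP (dT b) t φ) / √(dP a t φ ^ 2 + dP b t φ ^ 2) :=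
    Continuous.div (by fun_prop) (by fun_prop) (fun φ => (hsq φ).ne')
  have e : ∀ φ, dT (fun t φ => √(dP a t φ ^ 2 + dP b t φ ^ 2)) t φ =
      (dP a t φ * dP (dT a) t φ + dP b t φ * dP (dT b) t φ) / √(dP a t φ ^ 2 + dP b t φ ^ 2) := by
    intro φ
    have hd := ((((oa1.hasDerivAt_t isOpen_Ioo ht φ).pow 2).add ((ob1.hasDerivAt_t isOpen_Ioo ht φ).pow 2)).sqrt (hreg φ).ne').deriv
    have hd' : dT (fun t φ => √(dP a t φ ^ 2 + dP b t φ ^ 2)) t φ = _ := hd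
    have hs := hsq φ
    rw [hd', oa.comm isOpen_Ioo ht, ob.comm isOpen_Ioo ht]
    simp only [Pi.add_apply, Pi.pow_apply]
    field_simp
    push_cast
    ring
  have hz := int_deriv_zero (f := fun φ => dP a t φ / √(dP a t φ ^ 2 + dP b t φ ^ 2) * dT a t φ + dP b t φ / √(dP a t φ ^ 2 + dP b t φ ^ 2) * dT b t φ)
    (f' := fun φ => (dP a t φ * dP (dT a) t φ + dP b t φ * dP (dT b) t φ) / √(dP a t φ ^ 2 + dP b t φ ^ 2) +
      (dP a t φ * dP (dP b) t φ - dP b t φ * dP (dP a) t φ) ^ 2 / √(dP a t φ ^ 2 + dP b t φ ^ 2) ^ 5)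
    (by
      intro φ
      simp only [dP_periodic (h.per_a t ht') φ, dP_periodic (h.per_b t ht') φ, dT_periodic h.per_a ht φ, dT_periodic h.per_b ht φ])
    (by
      intro φ
      obtain ⟨t1, t2⟩ := tangent_deriv (oa1.hasDerivAt ht) (ob1.hasDerivAt ht) hreg φ
      refine ((t1.mul (ta.hasDerivAt ht φ)).add (t2.mul (tb.hasDerivAt ht φ))).congr_deriv ?_
      have hs := hsq φ
      have hf := h.flow t ht φ
      rw [← Real.sq_sqrt (hreg φ).le] at hf
      generalize √(dP a t φ ^ 2 + dP b t φ ^ 2) = s at *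
      field_simp
      linear_combination (-(dP a t φ * dP (dP b) t φ - dP b t φ * dP (dP a) t φ)) * hf)
    (c2.add c1)
  rw [intervalIntegral.integral_add (c2.intervalIntegrable _ _) (c1.intervalIntegrable _ _)] at hz
  simp_rw [e]
  linarith

theorem shrink (h : CSF T a b) (hT : 0 < T)
    (h0 : ∀ φ, 0 < a 0 φ * dP b 0 φ - b 0 φ * dP a 0 φ) (hs0 : Symm a b 0)
    (hA : ∫ φ in (0:ℝ)..(2 * π), (a 0 φ * dP b 0 φ - b 0 φ * dP a 0 φ) = 4 * π * T) :
    ∀ ε > (0:ℝ), ∃ t₁ ∈ Ico 0 T, ∀ t ∈ Ico t₁ T, ∀ φ, √(a t φ ^ 2 + b t φ ^ 2) < ε := by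
  intro ε hε
  have hst := h.star_all h0 hs0
  have hsy := h.symm_all h0 hs0
  have hπ := Real.pi_pos
  set L := fun t => ∫ φ in (0:ℝ)..(2 * π), √(dP a t φ ^ 2 + dP b t φ ^ 2) with hL
  have hrad : ∀ t ∈ Ico 0 T, ∀ φ, √(a t φ ^ 2 + b t φ ^ 2) ≤ L t / 2 := fun t ht =>
    radius_le (h.sa.hasDerivAt ht) (h.sb.hasDerivAt ht) ((h.sa.dP ud_ico).cont_slice ht) ((h.sb.dP ud_ico).cont_slice ht)
      (h.per_a t ht) (h.per_b t ht) (dP_periodic (h.per_a t ht)) (dP_periodic (h.per_b t ht)) (hsy t ht)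
  have hLpos : ∀ t ∈ Ico 0 T, 0 < L t := by
    intro t ht
    have h1 := Real.sqrt_pos.2 (h.ne_zero h0 hs0 t ht 0)
    linarith [hrad t ht 0]
  have hK : ∀ t ∈ Ioo 0 T, L t / (2 * π * (T - t)) ≤
      ∫ φ in (0:ℝ)..(2 * π), (dP a t φ * dP (dP b) t φ - dP b t φ * dP (dP a) t φ) ^ 2 / √(dP a t φ ^ 2 + dP b t φ ^ 2) ^ 5 := by
    intro t ht'
    have ht := ioo_ico ht'
    refine energy_ge (h.sa.hasDerivAt ht) (h.sb.hasDerivAt ht) ((h.sa.dP ud_ico).hasDerivAt ht) ((h.sb.dP ud_ico).hasDerivAt ht)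
      (((h.sa.dP ud_ico).dP ud_ico).cont_slice ht) (((h.sb.dP ud_ico).dP ud_ico).cont_slice ht)
      (h.per_a t ht) (h.per_b t ht) (dP_periodic (h.per_a t ht)) (dP_periodic (h.per_b t ht)) (hsy t ht) (hst t ht) (h.reg t ht)
      (mul_pos (by positivity) (by linarith [ht.2])) ?_
    rw [h.area_eq hst ht, hA]
    ring
  set W := fun t => Real.log (L t) - 1 / (2 * π) * Real.log (T - t) with hW
  have hWd : ∀ t ∈ Ioo 0 T, ∃ w ≤ 0, HasDerivAt W w t := by
    intro t ht
    have hTt : 0 < T - t := by linarith [ht.2]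
    have hLt := hLpos t (ioo_ico ht)
    have d1 := (h.len_deriv ht).log hLt.ne'
    have d2 := (((hasDerivAt_id t).const_sub T).log hTt.ne').const_mul (1 / (2 * π))
    refine ⟨_, ?_, d1.sub d2⟩
    have hk := hK t ht
    set K := ∫ φ in (0:ℝ)..(2 * π), (dP a t φ * dP (dP b) t φ - dP b t φ * dP (dP a) t φ) ^ 2 / √(dP a t φ ^ 2 + dP b t φ ^ 2) ^ 5
    change -K / L t - 1 / (2 * π) * (-1 / (T - t)) ≤ 0
    have : 1 / (2 * π * (T - t)) ≤ K / L t := by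
      rw [le_div_iff₀ hLt]
      refine le_trans (le_of_eq ?_) hk
      ring
    have e : -K / L t - 1 / (2 * π) * (-1 / (T - t)) = 1 / (2 * π * (T - t)) - K / L t := by
      field_simp
      ring
    rw [e]
    linarith
  have hWa : AntitoneOn W (Ioo 0 T) := by
    refine antitoneOn_of_deriv_nonpos (convex_Ioo 0 T) ?_ ?_ ?_
    · intro t ht
      obtain ⟨w, -, hw⟩ := hWd t ht
      exact hw.continuousAt.continuousWithinAt
    · rw [interior_Ioo]
      intro t ht
      obtain ⟨w, -, hw⟩ := hWd t ht
      exact hw.differentiableAt.differentiableWithinAt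
    · rw [interior_Ioo]
      intro t ht
      obtain ⟨w, hw0, hw⟩ := hWd t ht
      rw [hw.deriv]
      exact hw0
  set C := W (T / 2) with hC
  have hhalf : T / 2 ∈ Ioo 0 T := ⟨by linarith, by linarith⟩
  set δ := Real.exp (2 * π * (Real.log ε - C)) with hδ
  have hδ0 : 0 < δ := Real.exp_pos _
  set t₁ := max (T / 2) (T - δ) with ht₁
  have h1T : t₁ < T := max_lt hhalf.2 (by linarith)
  refine ⟨t₁, ⟨hhalf.1.le.trans (le_max_left _ _), h1T⟩, ?_⟩
  intro t ht φ
  have hth : T / 2 ≤ t := (le_max_left _ _).trans ht.1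
  have htδ : T - t ≤ δ := by
    have : T - δ ≤ t := (le_max_right _ _).trans ht.1
    linarith
  have htI : t ∈ Ioo 0 T := ⟨hhalf.1.trans_le hth, ht.2⟩
  have hTt : 0 < T - t := by linarith [ht.2]
  have hw : W t ≤ C := hWa hhalf htI hth
  have hlog : Real.log (T - t) ≤ 2 * π * (Real.log ε - C) := by
    rw [Real.log_le_iff_le_exp hTt]
    exact htδ
  have hLt := hLpos t (ioo_ico htI)
  have hle : Real.log (L t) ≤ Real.log ε := by
    have e1 : Real.log (L t) = W t + 1 / (2 * π) * Real.log (T - t) := by rw [hW]; ring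
    have e2 : 1 / (2 * π) * Real.log (T - t) ≤ 1 / (2 * π) * (2 * π * (Real.log ε - C)) :=
      mul_le_mul_of_nonneg_left hlog (by positivity)
    have e3 : 1 / (2 * π) * (2 * π * (Real.log ε - C)) = Real.log ε - C := by field_simp
    linarith
  have hLe : L t ≤ ε := (Real.log_le_log_iff hLt hε).1 hle
  linarith [hrad t (ioo_ico htI) φ]

end CSF
end

end

lemma hasDerivAt_fst_aux {f : ℝ → ℝ × ℝ} {v : ℝ × ℝ} {x : ℝ} (h : HasDerivAt f v x) :
    HasDerivAt (fun s => (f s).1) v.1 x :=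
  (ContinuousLinearMap.fst ℝ ℝ ℝ).hasFDerivAt.comp_hasDerivAt x h

lemma hasDerivAt_snd_aux {f : ℝ → ℝ × ℝ} {v : ℝ × ℝ} {x : ℝ} (h : HasDerivAt f v x) :
    HasDerivAt (fun s => (f s).2) v.2 x :=
  (ContinuousLinearMap.snd ℝ ℝ ℝ).hasFDerivAt.comp_hasDerivAt x h

open Topology

/-- Under the curve shortening flow, the evolving curve starting from a star-shaped,
centrosymmetric curve shrinks to the point `O` as `t → A₀/(2π)`:
`sup_φ |Y(φ,t) − O| → 0`. -/
theorem csf_shrinks_to_center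
    (X₀ : ℝ → ℝ × ℝ) (Y : ℝ → ℝ → ℝ × ℝ)
    (hX₀ : IsSmoothClosedCurve X₀) (hemb : IsEmbeddedCurve X₀)
    (hstar₀ : StarShapedWrt X₀ 0) (hsym₀ : CentroSymmetricWrt X₀ 0)
    (hsol : IsCSFSolutionOn Y X₀ (Set.Ico 0 (carea X₀ / (2 * π))))
    (hembt : ∀ t ∈ Set.Ico (0:ℝ) (carea X₀ / (2 * π)), IsEmbeddedCurve (Y t)) :
    ∀ ε > (0:ℝ), ∃ t₁ ∈ Set.Ico (0:ℝ) (carea X₀ / (2 * π)),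
      ∀ t ∈ Set.Ico t₁ (carea X₀ / (2 * π)), ∀ φ, vnorm (Y t φ) < ε := by
  have hY0 : Y 0 = X₀ := funext hsol.init
  set T := carea X₀ / (2 * π) with hTdef
  set a : ℝ → ℝ → ℝ := fun t φ => (Y t φ).1 with ha
  set b : ℝ → ℝ → ℝ := fun t φ => (Y t φ).2 with hb
  have hπ := Real.two_pi_pos
  have sa : Sm (Ico 0 T) a := contDiff_fst.comp_contDiffOn hsol.smooth
  have sb : Sm (Ico 0 T) b := contDiff_snd.comp_contDiffOn hsol.smooth
  have hd1 : ∀ t ∈ Ico 0 T, ∀ φ, deriv (Y t) φ = (dP a t φ, dP b t φ) := by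
    intro t ht φ
    exact ((sa.hasDerivAt ht φ).prodMk (sb.hasDerivAt ht φ)).deriv
  have hd2 : ∀ t ∈ Ico 0 T, ∀ φ, deriv (deriv (Y t)) φ = (dP (dP a) t φ, dP (dP b) t φ) := by
    intro t ht φ
    rw [funext (hd1 t ht)]
    exact (((sa.dP CSF.ud_ico).hasDerivAt ht φ).prodMk ((sb.dP CSF.ud_ico).hasDerivAt ht φ)).deriv
  have hreg : ∀ t ∈ Ico 0 T, ∀ φ, 0 < dP a t φ ^ 2 + dP b t φ ^ 2 := by
    intro t ht φ
    by_contra hcon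
    have e1 : dP a t φ = 0 := by nlinarith [sq_nonneg (dP a t φ), sq_nonneg (dP b t φ)]
    have e2 : dP b t φ = 0 := by nlinarith [sq_nonneg (dP a t φ), sq_nonneg (dP b t φ)]
    apply (hsol.curve t ht).regular φ
    rw [hd1 t ht, e1, e2]
    rfl
  have hcsf : CSF T a b := by
    refine ⟨sa, sb, ?_, ?_, hreg, ?_, ?_⟩
    · intro t ht φ
      simp only [ha, (hsol.curve t ht).periodic φ]
    · intro t ht φ
      simp only [hb, (hsol.curve t ht).periodic φ]
    · intro t ht φ
      have ht' : t ∈ Ico 0 T := Ioo_subset_Ico_self ht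
      obtain ⟨α, hα⟩ := hsol.flow
      have hd := (hα t ht' φ).hasDerivAt (Ico_mem_nhds ht.1 ht.2)
      have ea : dT a t φ = _ := (hasDerivAt_fst_aux hd).deriv
      have eb : dT b t φ = _ := (hasDerivAt_snd_aux hd).deriv
      have hg := hreg t ht' φ
      have hs := Real.sqrt_pos.2 hg
      have hsq := Real.sq_sqrt hg.le
      simp only [innerNormal, unitTangent, curv, vdet, hd1 t ht', hd2 t ht', vnorm, Prod.fst_add, Prod.snd_add,
        Prod.smul_fst, Prod.smul_snd, smul_eq_mul] at ea eb
      generalize √(dP a t φ ^ 2 + dP b t φ ^ 2) = s at *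
      rw [ea, eb, ← hsq]
      field_simp
      linear_combination ((dP a t φ * dP (dP b) t φ - dP b t φ * dP (dP a) t φ)) * hsq
    · rintro t ht φ ψ h1 h2 ⟨e1, e2⟩
      have hper := (hsol.curve t ht).periodic
      have e : Y t φ = Y t ψ := Prod.ext e1 e2
      have hm1 := toIcoMod_mem_Ico hπ 0 φ
      have hm2 := toIcoMod_mem_Ico hπ 0 ψ
      have q1 : Y t (toIcoMod hπ 0 φ) = Y t φ := by
        rw [← self_sub_toIcoDiv_zsmul, hper.sub_zsmul_eq]
      have q2 : Y t (toIcoMod hπ 0 ψ) = Y t ψ := by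
        rw [← self_sub_toIcoDiv_zsmul, hper.sub_zsmul_eq]
      have := hembt t ht (by simpa using hm1) (by simpa using hm2) (by rw [q1, q2, e])
      rw [← self_sub_toIcoDiv_zsmul, ← self_sub_toIcoDiv_zsmul hπ 0 ψ, zsmul_eq_mul, zsmul_eq_mul] at this
      set m := toIcoDiv hπ 0 φ
      set n := toIcoDiv hπ 0 ψ
      have hk : ψ - φ = ((n - m : ℤ) : ℝ) * (2 * π) := by push_cast; linarith
      have k1 : 0 < ((n - m : ℤ) : ℝ) := by
        by_contra hc
        push Not at hc
        nlinarith
      have k2 : ((n - m : ℤ) : ℝ) < 1 := by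
        by_contra hc
        push Not at hc
        nlinarith
      have k1' : 0 < n - m := by exact_mod_cast k1
      have k2' : n - m < 1 := by exact_mod_cast k2
      omega
  have hX₀d : ∀ φ, HasDerivAt X₀ (deriv X₀ φ) φ := fun φ =>
    ((hX₀.smooth.differentiable (by simp)) φ).hasDerivAt
  have hda : ∀ φ, dP a 0 φ = (deriv X₀ φ).1 := by
    intro φ
    have := (hasDerivAt_fst_aux (hX₀d φ)).deriv
    rw [← hY0] at this ⊢
    exact this
  have hdb : ∀ φ, dP b 0 φ = (deriv X₀ φ).2 := by
    intro φ
    have := (hasDerivAt_snd_aux (hX₀d φ)).deriv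
    rw [← hY0] at this ⊢
    exact this
  have hvd : ∀ φ, vdet (X₀ φ) (deriv X₀ φ) = a 0 φ * dP b 0 φ - b 0 φ * dP a 0 φ := by
    intro φ
    rw [hda, hdb]
    simp only [ha, hb, hY0, vdet]
  have hstar : ∀ φ, 0 < a 0 φ * dP b 0 φ - b 0 φ * dP a 0 φ := by
    intro φ
    rw [← hvd]
    have h1 := hstar₀ φ
    simp only [vdet, unitTangent, sub_zero, Prod.smul_fst, Prod.smul_snd, smul_eq_mul] at h1
    have h2 : 0 ≤ (vnorm (deriv X₀ φ))⁻¹ := inv_nonneg.2 (Real.sqrt_nonneg _)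
    have h3 : 0 < (vnorm (deriv X₀ φ))⁻¹ * vdet (X₀ φ) (deriv X₀ φ) := by
      unfold vdet
      linarith
    exact pos_of_mul_pos_right h3 h2
  have hcd : Continuous (deriv X₀) := hX₀.smooth.continuous_deriv (by simp)
  have hcX : Continuous X₀ := hX₀.smooth.continuous
  have hAeq : ∫ φ in (0:ℝ)..(2 * π), (a 0 φ * dP b 0 φ - b 0 φ * dP a 0 φ) = 4 * π * T := by
    simp_rw [← hvd]
    rw [hTdef, carea]
    field_simp
    ring
  have hT : 0 < T := by
    have h1 : 0 < ∫ φ in (0:ℝ)..(2 * π), vdet (X₀ φ) (deriv X₀ φ) := by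
      apply intervalIntegral.intervalIntegral_pos_of_pos
      · apply Continuous.intervalIntegrable
        unfold vdet
        fun_prop
      · intro φ
        rw [hvd]
        exact hstar φ
      · exact hπ
    rw [hTdef, carea]
    positivity
  have hsym : CSF.Symm a b 0 := by
    intro φ
    have h1 : -X₀ φ ∈ (fun Z => (2 : ℝ) • (0 : ℝ × ℝ) - Z) '' Set.range X₀ := ⟨X₀ φ, ⟨φ, rfl⟩, by simp⟩
    rw [hsym₀] at h1
    obtain ⟨ψ, hψ⟩ := h1
    refine ⟨ψ, ?_, ?_⟩
    · simp only [ha, hY0, hψ, Prod.fst_neg]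
    · simp only [hb, hY0, hψ, Prod.snd_neg]
  exact hcsf.shrink hT hstar hsym hAeq
end
end

section
/- Let X₀ be a smooth, embedded, closed plane curve, star-shaped and centrosymmetric with respect to the origin O, and suppose Gage's area-preserving flow with initial curve X₀ has a smooth solution X(·,t) on [0,ω). If X(·,t) is star-shaped with respect to O for every t ∈ [0,ω), then X(·,t) is centrosymmetric with respect to O for every t ∈ [0,ω); in polar form, the radial function satisfies r(θ + π, t) = r(θ, t) for all (θ,t). -/
open Real Set MeasureTheory Filter

noncomputable section

open scoped Topology

/-- Euclidean inner product of plane vectors. -/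
def vdot (a b : ℝ × ℝ) : ℝ := a.1 * b.1 + a.2 * b.2

lemma vdot_self_pos {a b : ℝ × ℝ} (h : vdet a b ≠ 0) : 0 < vdot a a := by
  unfold vdot
  by_contra hc
  have h1 : a.1 = 0 := by nlinarith [sq_nonneg a.1, sq_nonneg a.2]
  have h2 : a.2 = 0 := by nlinarith [sq_nonneg a.1, sq_nonneg a.2]
  apply h; simp [vdet, h1, h2]

lemma opposite_of_vdet_zero {a b : ℝ × ℝ} (h : vdet a b = 0) (ha : 0 < vdot a a) :
    b = -(-vdot a b / vdot a a) • a := by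
  have ha' := ha.ne'
  unfold vdet at h
  unfold vdot at *
  ext
  · simp only [Prod.smul_fst, smul_eq_mul, neg_div, neg_neg]
    rw [div_mul_eq_mul_div, eq_div_iff ha']
    linear_combination -a.2 * h
  · simp only [Prod.smul_snd, smul_eq_mul, neg_div, neg_neg]
    rw [div_mul_eq_mul_div, eq_div_iff ha']
    linear_combination a.1 * h

lemma ray_follow (A : ℝ → ℝ × ℝ) (B : ℝ × ℝ → ℝ × ℝ) (s₀ ψ₀ : ℝ) (b : ℝ × ℝ)
    (hA : ContDiffAt ℝ 2 A s₀) (hB : ContDiffAt ℝ 2 B (s₀, ψ₀))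
    (hdet : vdet (A s₀) (B (s₀, ψ₀)) = 0) (hdot : vdot (A s₀) (B (s₀, ψ₀)) < 0)
    (hb : HasDerivAt (fun ψ => B (s₀, ψ)) b ψ₀) (hb' : vdet (A s₀) b ≠ 0) :
    ∃ k m : ℝ → ℝ, ContDiffAt ℝ 2 k s₀ ∧ ContDiffAt ℝ 2 m s₀ ∧ k s₀ = ψ₀ ∧
      ∀ᶠ s in 𝓝 s₀, B (s, k s) = -(m s) • A s ∧ 0 < m s := by
  have hpos : 0 < vdot (A s₀) (A s₀) := vdot_self_pos hb'
  have hG : ContDiffAt ℝ 2 (fun p : ℝ × ℝ => vdet (A p.1) (B p)) (s₀, ψ₀) := by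
    have hA' : ContDiffAt ℝ 2 (fun p : ℝ × ℝ => A p.1) (s₀, ψ₀) :=
      ContDiffAt.comp (s₀, ψ₀) hA contDiffAt_fst
    unfold vdet
    exact (hA'.fst.mul hB.snd).sub (hA'.snd.mul hB.fst)
  have h2 : (2 : WithTop ℕ∞) ≠ 0 := by norm_num
  have hd : HasDerivAt (fun ψ => vdet (A s₀) (B (s₀, ψ))) (vdet (A s₀) b) ψ₀ := by
    have e1 := (hasFDerivAt_fst (𝕜 := ℝ) (p := B (s₀, ψ₀))).comp_hasDerivAt ψ₀ hb
    have e2 := (hasFDerivAt_snd (𝕜 := ℝ) (p := B (s₀, ψ₀))).comp_hasDerivAt ψ₀ hb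
    exact (e2.const_mul (A s₀).1).sub (e1.const_mul (A s₀).2)
  have hinv : ((fderiv ℝ (fun p : ℝ × ℝ => vdet (A p.1) (B p)) (s₀, ψ₀)) ∘L
      .inr ℝ ℝ ℝ).IsInvertible := by
    have h3 := (hG.differentiableAt h2).hasFDerivAt
    have h4 : HasDerivAt (fun ψ : ℝ => (s₀, ψ)) ((0 : ℝ), (1 : ℝ)) ψ₀ :=
      (hasDerivAt_const _ _).prodMk (hasDerivAt_id _)
    have h5 := (h3.comp_hasDerivAt ψ₀ h4).unique hd
    refine ⟨ContinuousLinearEquiv.unitsEquivAut ℝ (Units.mk0 _ hb'), ?_⟩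
    ext
    simp [h5]
  refine ⟨hG.implicitFunction h2 hinv, fun s => -vdot (A s) (B (s, hG.implicitFunction h2 hinv s))
    / vdot (A s) (A s), ?_⟩
  have hk := hG.contDiffAt_implicitFunction h2 hinv
  have hk0 := hG.implicitFunction_apply_self h2 hinv
  have hev := hG.eventually_apply_implicitFunction h2 hinv
  generalize hG.implicitFunction h2 hinv = k at *
  simp only at hk hk0 hev
  have hBk : ContDiffAt ℝ 2 (fun s => B (s, k s)) s₀ := by
    refine ContDiffAt.comp (g := B) (f := fun s => (s, k s)) s₀ ?_ (contDiffAt_id.prodMk hk)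
    rw [hk0]; exact hB
  have hm1 : ContDiffAt ℝ 2 (fun s => vdot (A s) (B (s, k s))) s₀ := by
    unfold vdot; exact (hA.fst.mul hBk.fst).add (hA.snd.mul hBk.snd)
  have hm2 : ContDiffAt ℝ 2 (fun s => vdot (A s) (A s)) s₀ := by
    unfold vdot; exact (hA.fst.mul hA.fst).add (hA.snd.mul hA.snd)
  refine ⟨hk, hm1.neg.div hm2 hpos.ne', hk0, ?_⟩
  have e1 : ∀ᶠ s in 𝓝 s₀, vdot (A s) (B (s, k s)) < 0 :=
    hm1.continuousAt.eventually_lt continuousAt_const (by simpa [hk0] using hdot)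
  have e2 : ∀ᶠ s in 𝓝 s₀, 0 < vdot (A s) (A s) :=
    continuousAt_const.eventually_lt hm2.continuousAt hpos
  filter_upwards [hev, e1, e2] with s h h' h''
  rw [hdet] at h
  exact ⟨opposite_of_vdet_zero h h'', div_pos (by linarith) h''⟩

lemma second_deriv_nonpos_of_localMax {m : ℝ → ℝ} {a : ℝ} (hc : ContinuousAt m a)
    (h : IsLocalMax m a) : deriv (deriv m) a ≤ 0 := by
  by_contra hcon
  push Not at hcon
  have hmin := isLocalMin_of_deriv_deriv_pos hcon h.deriv_eq_zero hc
  have heq : m =ᶠ[𝓝 a] fun _ => m a := by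
    filter_upwards [h, hmin] with x h1 h2 using le_antisymm h1 h2
  have := heq.deriv.deriv_eq
  simp at this
  linarith

lemma differentiableAt_deriv_of_C2 {f : ℝ → ℝ} {a : ℝ} (hf : ContDiffAt ℝ 2 f a) :
    DifferentiableAt ℝ (deriv f) a := by
  have h := (hf.fderiv_right (m := 1) (by norm_num)).differentiableAt (by norm_num)
  exact h.clm_apply (differentiableAt_const (1 : ℝ))

lemma space_cmp (P : ℝ → ℝ × ℝ) (hP : ContDiff ℝ (⊤ : ℕ∞) P) (k m : ℝ → ℝ) (a b : ℝ)
    (hk : ContDiffAt ℝ 2 k a) (hm : ContDiffAt ℝ 2 m a) (hkb : k a = b)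
    (hev : ∀ᶠ s in 𝓝 a, P (k s) = -(m s) • P s) (hmax : IsLocalMax m a) (hma : 0 < m a)
    (ha : 0 < vdet (P a) (deriv P a)) (hb : 0 < vdet (P b) (deriv P b)) :
    ∃ c : ℝ, 0 < c ∧ c • deriv P b = -(m a) • deriv P a ∧
      m a ^ 2 * vdet (deriv P a) (deriv (deriv P) a) ≤
        c ^ 3 * vdet (deriv P b) (deriv (deriv P) b) := by
  have hP1 : Differentiable ℝ P := hP.differentiable (by simp)
  have hdP : ContDiff ℝ (⊤ : ℕ∞) (deriv P) := (contDiff_infty_iff_deriv.1 hP).2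
  have hP2 : Differentiable ℝ (deriv P) := hdP.differentiable (by simp)
  have hk1 : ∀ᶠ s in 𝓝 a, DifferentiableAt ℝ k s := by
    filter_upwards [hk.eventually (by simp)] with s hs using hs.differentiableAt (by norm_num)
  have hm1 : ∀ᶠ s in 𝓝 a, DifferentiableAt ℝ m s := by
    filter_upwards [hm.eventually (by simp)] with s hs using hs.differentiableAt (by norm_num)
  have hdk : DifferentiableAt ℝ (deriv k) a :=
    differentiableAt_deriv_of_C2 hk
  have hdm : DifferentiableAt ℝ (deriv m) a :=
    differentiableAt_deriv_of_C2 hm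
  have hfirst : ∀ᶠ s in 𝓝 a, deriv k s • deriv P (k s) = -(m s) • deriv P s + -(deriv m s) • P s := by
    filter_upwards [hev.eventually_nhds, hk1, hm1] with s h1 h2 h3
    have e1 : HasDerivAt (fun s => P (k s)) (deriv k s • deriv P (k s)) s :=
      HasDerivAt.scomp s (hP1 _).hasDerivAt h2.hasDerivAt
    have e2 := h3.hasDerivAt.neg.smul (hP1 s).hasDerivAt
    exact e1.unique (e2.congr_of_eventuallyEq h1)
  have e1 : HasDerivAt (fun s => deriv k s • deriv P (k s)) _ a :=
    hdk.hasDerivAt.smul (HasDerivAt.scomp a (hP2 _).hasDerivAt hk1.self_of_nhds.hasDerivAt)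
  have e2 := (hm1.self_of_nhds.hasDerivAt.neg.smul (hP2 a).hasDerivAt).add
    (hdm.hasDerivAt.neg.smul (hP1 a).hasDerivAt)
  have hsec := e1.unique (e2.congr_of_eventuallyEq hfirst)
  have hf := hfirst.self_of_nhds
  have hz := hev.self_of_nhds
  have hm0 : deriv m a = 0 := hmax.deriv_eq_zero
  have hmm := second_deriv_nonpos_of_localMax hm.continuousAt hmax
  simp only [hkb, hm0, neg_zero, zero_smul, add_zero, zero_add, Pi.neg_apply] at hsec hf hz
  set c := deriv k a
  set l := m a
  set d := deriv (deriv m) a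
  set P0 := P a
  set P1 := deriv P a
  set P2 := deriv (deriv P) a
  set Q0 := P b
  set Q1 := deriv P b
  set Q2 := deriv (deriv P) b
  rw [Prod.ext_iff] at hsec hf hz
  simp only [Prod.smul_fst, Prod.smul_snd, Prod.fst_add, Prod.snd_add, smul_eq_mul] at hsec hf hz
  obtain ⟨s1, s2⟩ := hsec
  obtain ⟨f1, f2⟩ := hf
  obtain ⟨z1, z2⟩ := hz
  unfold vdet at *
  have hc : 0 < c := by
    have : c * (Q0.1 * Q1.2 - Q0.2 * Q1.1) = l ^ 2 * (P0.1 * P1.2 - P0.2 * P1.1) := by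
      rw [z1, z2]
      linear_combination (-l * P0.1) * f2 + l * P0.2 * f1
    have h2 : 0 < c * (Q0.1 * Q1.2 - Q0.2 * Q1.1) := by rw [this]; positivity
    exact pos_of_mul_pos_left h2 hb.le
  refine ⟨c, hc, ?_, ?_⟩
  · ext <;> simp <;> linarith
  · have key : c ^ 3 * (Q1.1 * Q2.2 - Q1.2 * Q2.1) = l ^ 2 * (P1.1 * P2.2 - P1.2 * P2.1)
        + (-d) * l * (P0.1 * P1.2 - P0.2 * P1.1) := by
      linear_combination c * Q1.1 * s2 - c * Q1.2 * s1 + f1 * (-l * P2.2 - d * P0.2)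
        - f2 * (-l * P2.1 - d * P0.1)
    have : 0 ≤ (-d) * l * (P0.1 * P1.2 - P0.2 * P1.1) :=
      mul_nonneg (mul_nonneg (by linarith) hma.le) ha.le
    linarith

lemma vnorm_pos {v : ℝ × ℝ} (h : v ≠ 0) : 0 < vnorm v := by
  unfold vnorm
  apply Real.sqrt_pos.2
  by_contra hc
  apply h
  have h1 : v.1 = 0 := by nlinarith [sq_nonneg v.1, sq_nonneg v.2]
  have h2 : v.2 = 0 := by nlinarith [sq_nonneg v.1, sq_nonneg v.2]
  ext <;> simp [h1, h2]

lemma vnorm_sq (v : ℝ × ℝ) : vnorm v ^ 2 = v.1 ^ 2 + v.2 ^ 2 :=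
  Real.sq_sqrt (by positivity)

lemma vnorm_smul (c : ℝ) (v : ℝ × ℝ) : vnorm (c • v) = |c| * vnorm v := by
  unfold vnorm
  rw [← Real.sqrt_sq_eq_abs, ← Real.sqrt_mul (sq_nonneg c)]
  congr 1
  simp; ring

lemma star_det {P : ℝ → ℝ × ℝ} (hr : ∀ φ, deriv P φ ≠ 0) (hs : StarShapedWrt P 0) (φ : ℝ) :
    0 < vdet (P φ) (deriv P φ) := by
  have h := hs φ
  have hn := vnorm_pos (hr φ)
  have : vdet (P φ) (deriv P φ) = vnorm (deriv P φ) * vdet (P φ - 0) (unitTangent P φ) := by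
    simp only [vdet, unitTangent, sub_zero, Prod.smul_fst, Prod.smul_snd, smul_eq_mul]
    field_simp
  rw [this]; positivity

lemma curv_cmp {P : ℝ → ℝ × ℝ} {a b c l : ℝ} (hc : 0 < c) (hl : 0 < l)
    (ha : deriv P a ≠ 0) (h1 : c • deriv P b = -l • deriv P a)
    (h2 : l ^ 2 * vdet (deriv P a) (deriv (deriv P) a) ≤
        c ^ 3 * vdet (deriv P b) (deriv (deriv P) b)) :
    unitTangent P b = - unitTangent P a ∧ curv P a ≤ l * curv P b := by
  have hn := vnorm_pos ha
  have hQ : deriv P b = (-(l / c)) • deriv P a := by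
    have : deriv P b = c⁻¹ • (c • deriv P b) := by rw [smul_smul, inv_mul_cancel₀ hc.ne', one_smul]
    rw [this, h1, smul_smul]; congr 1; field_simp
  have hnQ : vnorm (deriv P b) = l / c * vnorm (deriv P a) := by
    rw [hQ, vnorm_smul, abs_neg, abs_of_pos (by positivity)]
  constructor
  · unfold unitTangent
    rw [hnQ, hQ, smul_smul, ← neg_smul]; congr 1; field_simp
  · unfold curv
    rw [hnQ]
    have e : l * (vdet (deriv P b) (deriv (deriv P) b) / (l / c * vnorm (deriv P a)) ^ 3)
      = (c ^ 3 * vdet (deriv P b) (deriv (deriv P) b)) / (l ^ 2 * vnorm (deriv P a) ^ 3) := by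
      field_simp
    rw [e, div_le_div_iff₀ (by positivity) (by positivity)]
    have : 0 < vnorm (deriv P a) ^ 3 := by positivity
    nlinarith

lemma time_identity {P : ℝ → ℝ × ℝ} {a b l l' k' α β κ₀ : ℝ} {Pt Qt : ℝ × ℝ}
    (ha : deriv P a ≠ 0) (hb : deriv P b ≠ 0)
    (hT : unitTangent P b = - unitTangent P a)
    (hP : Pt = α • unitTangent P a + (curv P a - κ₀) • innerNormal P a)
    (hQ : Qt = β • unitTangent P b + (curv P b - κ₀) • innerNormal P b)
    (h : Qt + k' • deriv P b = -l • Pt + -l' • P a) :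
    l' * vdet (P a) (unitTangent P a) = κ₀ - curv P b + l * curv P a - l * κ₀ := by
  have hn := vnorm_pos ha
  have hu : (unitTangent P a).1 ^ 2 + (unitTangent P a).2 ^ 2 = 1 := by
    have := vnorm_sq (deriv P a)
    simp only [unitTangent, Prod.smul_fst, Prod.smul_snd, smul_eq_mul]
    field_simp
    linarith
  have hQ1 : deriv P b = vnorm (deriv P b) • unitTangent P b := by
    unfold unitTangent
    rw [smul_smul, mul_inv_cancel₀ (vnorm_pos hb).ne', one_smul]
  rw [hP, hQ, hQ1] at h
  unfold innerNormal at h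
  rw [hT] at h
  rw [Prod.ext_iff] at h
  simp only [Prod.smul_fst, Prod.smul_snd, Prod.fst_add, Prod.snd_add, smul_eq_mul, Prod.fst_neg,
    Prod.snd_neg] at h
  obtain ⟨h1, h2⟩ := h
  unfold vdet
  set T := unitTangent P a
  linear_combination T.2 * h1 - T.1 * h2 - (curv P b - κ₀ - l * (curv P a - κ₀)) * hu

lemma final_ineq {l l' σ κP κQ c₀ K : ℝ} (hσ : 0 < σ) (hl : 1 < l) (hc : 0 ≤ c₀)
    (hκ : κP ≤ l * κQ) (hK : |κP| ≤ K * σ)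
    (h : l' * σ = c₀ - κQ + l * κP - l * c₀) : l' ≤ 2 * K * (l - 1) := by
  have h0 : 0 < l := by linarith
  have hK' := (abs_le.1 hK).2
  have hKσ : 0 ≤ K * σ := (abs_nonneg _).trans hK
  have h1 : l * (l' * σ) ≤ l * (2 * K * (l - 1) * σ) := by
    rw [h]
    have e1 : 0 ≤ l * (c₀ * (l - 1)) := by
      have : 0 ≤ l - 1 := by linarith
      positivity
    have e2 : (l ^ 2 - 1) * κP ≤ (l ^ 2 - 1) * (K * σ) :=
      mul_le_mul_of_nonneg_left hK' (by nlinarith)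
    have e3 : (l ^ 2 - 1) * (K * σ) ≤ 2 * l * (l - 1) * (K * σ) := by
      apply mul_le_mul_of_nonneg_right _ hKσ
      nlinarith
    nlinarith
  have h2 := le_of_mul_le_mul_left h1 h0
  exact le_of_mul_le_mul_right h2 hσ

/-- Angle function of a star-shaped closed curve. -/
lemma exists_angle (P : ℝ → ℝ × ℝ) (hP : IsSmoothClosedCurve P) (hs : StarShapedWrt P 0) :
    ∃ θ R : ℝ → ℝ, Continuous θ ∧ StrictMono θ ∧ Function.Surjective θ ∧ Continuous R ∧
      (∀ φ, 0 < R φ) ∧ (∀ φ, P φ = R φ • (Real.cos (θ φ), Real.sin (θ φ))) ∧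
      ∃ c, 0 < c ∧ ∀ φ, θ (φ + 2 * π) = θ φ + c := by
  have hdet := star_det hP.regular hs
  have hP1 : Differentiable ℝ P := hP.smooth.differentiable (by simp)
  have hdP : Continuous (deriv P) := hP.smooth.continuous_deriv (by simp)
  have hper : ∀ φ, deriv P (φ + 2 * π) = deriv P φ := by
    intro φ
    rw [← deriv_comp_add_const]
    congr 1
    funext x; exact hP.periodic x
  let z : ℝ → ℂ := fun φ => ⟨(P φ).1, (P φ).2⟩
  let z' : ℝ → ℂ := fun φ => ⟨(deriv P φ).1, (deriv P φ).2⟩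
  have hzeq : z = fun φ => Complex.equivRealProdCLM.symm (P φ) := by
    funext φ; apply Complex.ext <;> simp [z]
  have hz'eq : z' = fun φ => Complex.equivRealProdCLM.symm (deriv P φ) := by
    funext φ; apply Complex.ext <;> simp [z']
  have hz : ∀ φ, HasDerivAt z (z' φ) φ := by
    intro φ
    rw [hzeq, hz'eq]
    exact (Complex.equivRealProdCLM.symm : (ℝ × ℝ) →L[ℝ] ℂ).hasFDerivAt.comp_hasDerivAt φ
      (hP1 φ).hasDerivAt
  have hz'c : Continuous z' := by
    rw [hz'eq]; exact Complex.equivRealProdCLM.symm.continuous.comp hdP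
  have hzc : Continuous z := continuous_iff_continuousAt.2 fun φ => (hz φ).continuousAt
  have hz0 : ∀ φ, z φ ≠ 0 := by
    intro φ h
    have h1 : (P φ).1 = 0 := congrArg Complex.re h
    have h2 : (P φ).2 = 0 := congrArg Complex.im h
    have := hdet φ
    simp [vdet, h1, h2] at this
  let f : ℝ → ℂ := fun φ => z' φ / z φ
  have hf : Continuous f := hz'c.div hzc hz0
  let w : ℝ → ℂ := fun φ => Complex.log (z 0) + ∫ x in (0:ℝ)..φ, f x
  have hw : ∀ φ, HasDerivAt w (f φ) φ := fun φ =>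
    (hf.integral_hasStrictDerivAt 0 φ).hasDerivAt.const_add _
  have hwz : ∀ φ, z φ = Complex.exp (w φ) := by
    have hd : ∀ φ, HasDerivAt (fun φ => z φ * Complex.exp (-w φ)) 0 φ := by
      intro φ
      have := (hz φ).mul (hw φ).neg.cexp
      have hfz : f φ * z φ = z' φ := div_mul_cancel₀ _ (hz0 φ)
      have e : z' φ * Complex.exp ((-w) φ) + z φ * (Complex.exp ((-w) φ) * -f φ) = 0 := by
        rw [← hfz]; ring
      rw [e] at this
      exact this
    intro φ
    have hc := is_const_of_deriv_eq_zero (fun x => (hd x).differentiableAt)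
      (fun x => (hd x).deriv) φ 0
    simp only [w, intervalIntegral.integral_same, add_zero] at hc
    rw [Complex.exp_neg, Complex.exp_neg, Complex.exp_log (hz0 0), mul_inv_cancel₀ (hz0 0)] at hc
    rw [eq_comm]
    exact (mul_inv_eq_one₀ (Complex.exp_ne_zero _)).1 hc |>.symm
  have hwc : Continuous w := continuous_iff_continuousAt.2 fun φ => (hw φ).continuousAt
  have hθ : ∀ φ, HasDerivAt (fun φ => (w φ).im) (f φ).im φ := fun φ =>
    Complex.imCLM.hasFDerivAt.comp_hasDerivAt φ (hw φ)
  have hfim : ∀ φ, 0 < (f φ).im := by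
    intro φ
    have hns := Complex.normSq_pos.2 (hz0 φ)
    have : (f φ).im = vdet (P φ) (deriv P φ) / Complex.normSq (z φ) := by
      simp only [f, Complex.div_im, z, z', vdet]
      ring
    rw [this]; exact div_pos (hdet φ) hns
  have hmono : StrictMono (fun φ => (w φ).im) :=
    strictMono_of_deriv_pos fun φ => by rw [(hθ φ).deriv]; exact hfim φ
  have hθc : Continuous (fun φ => (w φ).im) := Complex.continuous_im.comp hwc
  have hpe : ∀ φ, (w (φ + 2 * π)).im = (w φ).im + ((w (2 * π)).im - (w 0).im) := by
    have hfp : ∀ φ, f (φ + 2 * π) = f φ := by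
      intro φ; simp only [f, z, z', hper, hP.periodic φ]
    have hd : ∀ φ, HasDerivAt (fun φ => (w (φ + 2 * π)).im - (w φ).im) 0 φ := by
      intro φ
      have := ((hθ (φ + 2 * π)).comp_add_const φ (2 * π)).sub (hθ φ)
      rw [hfp, sub_self] at this
      exact this
    intro φ
    have hc := is_const_of_deriv_eq_zero (fun x => (hd x).differentiableAt)
      (fun x => (hd x).deriv) φ 0
    simp only [zero_add] at hc
    linarith
  have hcpos : 0 < (w (2 * π)).im - (w 0).im := by
    have := hmono (show (0:ℝ) < 2 * π by positivity)
    simp only at this; linarith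
  set c := (w (2 * π)).im - (w 0).im
  refine ⟨fun φ => (w φ).im, fun φ => Real.exp (w φ).re, hθc, hmono, ?_,
    Real.continuous_exp.comp (Complex.continuous_re.comp hwc), fun φ => Real.exp_pos _, ?_,
    c, hcpos, hpe⟩
  · have hn : ∀ n : ℕ, (w (n * (2 * π))).im = (w 0).im + n * c := by
      intro n
      induction n with
      | zero => simp
      | succ n ih => 
        have := hpe (n * (2 * π))
        push_cast
        rw [show ((n:ℝ) + 1) * (2 * π) = n * (2 * π) + 2 * π by ring, this, ih]; ring
    have hn' : ∀ n : ℕ, (w (-(n * (2 * π)))).im = (w 0).im - n * c := by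
      intro n
      induction n with
      | zero => simp
      | succ n ih => 
        have := hpe (-((n + 1) * (2 * π)))
        rw [show -(((n:ℝ) + 1) * (2 * π)) + 2 * π = -(n * (2 * π)) by ring, ih] at this
        push_cast
        linarith
    intro y
    obtain ⟨n, hn1⟩ := exists_nat_gt (|y - (w 0).im| / c)
    rw [div_lt_iff₀ hcpos] at hn1
    obtain ⟨h1, h2⟩ := abs_lt.1 hn1
    have := intermediate_value_univ (-(n * (2 * π))) (n * (2 * π)) hθc
    apply this
    simp only [mem_Icc, hn, hn']
    constructor <;> linarith
  · intro φ
    have h := hwz φ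
    have h1 : (P φ).1 = (Complex.exp (w φ)).re := congrArg Complex.re h
    have h2 : (P φ).2 = (Complex.exp (w φ)).im := congrArg Complex.im h
    rw [Complex.exp_re] at h1
    rw [Complex.exp_im] at h2
    ext
    · simp [h1]
    · simp [h2]

lemma polar_inj {R R' α β : ℝ} (hR : 0 < R) (hR' : 0 < R')
    (h : R • (Real.cos α, Real.sin α) = R' • (Real.cos β, Real.sin β)) :
    R = R' ∧ ∃ n : ℤ, α = β + n * (2 * π) := by
  rw [Prod.ext_iff] at h
  simp only [Prod.smul_mk, smul_eq_mul] at h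
  obtain ⟨h1, h2⟩ := h
  have e : R = R' := by
    have e1 : R ^ 2 = R' ^ 2 := by
      have : (R * Real.cos α) ^ 2 + (R * Real.sin α) ^ 2
          = (R' * Real.cos β) ^ 2 + (R' * Real.sin β) ^ 2 := by rw [h1, h2]
      nlinarith [Real.sin_sq_add_cos_sq α, Real.sin_sq_add_cos_sq β]
    exact (pow_left_inj₀ hR.le hR'.le two_ne_zero).1 e1
  refine ⟨e, ?_⟩
  subst e
  have h1 := mul_left_cancel₀ hR.ne' h1
  have h2 := mul_left_cancel₀ hR.ne' h2
  have : Real.cos (α - β) = 1 := by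
    rw [Real.cos_sub, h1, h2]; nlinarith [Real.sin_sq_add_cos_sq β]
  obtain ⟨n, hn⟩ := (Real.cos_eq_one_iff _).1 this
  exact ⟨n, by linarith⟩

lemma reduce_mod {P : ℝ → ℝ × ℝ} (hP : Function.Periodic P (2 * π)) (x : ℝ) :
    ∃ j : ℤ, x - j * (2 * π) ∈ Ico 0 (2 * π) ∧ P (x - j * (2 * π)) = P x := by
  have hpi : (0:ℝ) < 2 * π := by positivity
  obtain ⟨j, hj, -⟩ := existsUnique_sub_zsmul_mem_Ico hpi x 0
  refine ⟨j, ?_, hP.sub_int_mul_eq j⟩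
  simpa using hj

lemma embedded_no_repeat {P : ℝ → ℝ × ℝ} (hP : Function.Periodic P (2 * π))
    (he : IsEmbeddedCurve P) {x y : ℝ} (hxy : x < y) (hy : y < x + 2 * π) : P x ≠ P y := by
  intro h
  obtain ⟨j, hj, hjP⟩ := reduce_mod hP x
  have hy' : P (y - j * (2 * π)) = P y := hP.sub_int_mul_eq j
  rw [mem_Ico] at hj
  by_cases hc : y - j * (2 * π) < 2 * π
  · have := he (mem_Ico.2 hj) (mem_Ico.2 ⟨by linarith, hc⟩) (by rw [hjP, hy', h])
    linarith
  · have hy2 : P (y - j * (2 * π) - 2 * π) = P y := by rw [hP.sub_eq, hy']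
    have := he (mem_Ico.2 hj) (mem_Ico.2 ⟨by linarith, by linarith⟩)
      (by rw [hjP, hy2, h] : P (x - j * (2 * π)) = P (y - j * (2 * π) - 2 * π))
    linarith

lemma ray_unique_s8 {P : ℝ → ℝ × ℝ} (hP : IsSmoothClosedCurve P) (hs : StarShapedWrt P 0)
    (he : IsEmbeddedCurve P) {a b μ : ℝ} (hμ : 0 < μ) (h : P a = μ • P b) : μ = 1 := by
  obtain ⟨θ, R, hθ, hmono, hsurj, hR, hRpos, hpol, c, hc, hper⟩ := exists_angle P hP hs
  have hpi : (0:ℝ) < 2 * π := by positivity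
  have hRper : Function.Periodic R (2 * π) := by
    intro φ
    have := hP.periodic φ
    rw [hpol, hpol φ] at this
    exact (polar_inj (hRpos _) (hRpos _) this).1
  obtain ⟨n, hn⟩ : ∃ n : ℤ, c = n * (2 * π) := by
    have := hP.periodic 0
    rw [hpol, hpol 0] at this
    obtain ⟨n, hn⟩ := (polar_inj (hRpos _) (hRpos _) this).2
    exact ⟨n, by rw [hper] at hn; linarith⟩
  have hn1 : (1:ℤ) ≤ n := by
    rw [hn] at hc
    have : (0:ℝ) < n := pos_of_mul_pos_left hc hpi.le
    exact_mod_cast this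
  have hn2 : n = 1 := by
    by_contra hne
    have hn2 : (2:ℤ) ≤ n := by omega
    have hn2' : (2:ℝ) ≤ n := by exact_mod_cast hn2
    let e := hmono.orderIsoOfSurjective θ hsurj
    have hes : ∀ y, θ (e.symm y) = y := fun y => e.apply_symm_apply y
    have hse : ∀ y, e.symm (θ y) = y := fun y => e.symm_apply_apply y
    have hec : Continuous e.symm := e.symm.continuous
    obtain ⟨φM, -, hM⟩ := (isCompact_Icc (a := (0:ℝ)) (b := 2 * π)).exists_isMaxOn
      ⟨0, by simp [hpi.le]⟩ hR.continuousOn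
    have hM' : ∀ φ, R φ ≤ R φM := by
      intro φ
      obtain ⟨y, hy, hy'⟩ := hRper.exists_mem_Ico₀ hpi φ
      rw [hy']; exact hM (Ico_subset_Icc_self hy)
    have hd : Continuous fun y => R (e.symm (y + 2 * π)) - R (e.symm y) := by fun_prop
    have := intermediate_value_univ (θ φM) (θ φM - 2 * π) hd
    obtain ⟨y, hy⟩ := this (show (0:ℝ) ∈ _ by
      simp only [mem_Icc, sub_add_cancel, hse]
      exact ⟨by linarith [hM' (e.symm (θ φM + 2 * π))], by linarith [hM' (e.symm (θ φM - 2 * π))]⟩)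
    simp only at hy
    refine embedded_no_repeat hP.periodic he (x := e.symm y) (y := e.symm (y + 2 * π))
      (e.symm.strictMono (by linarith)) ?_ ?_
    · rw [← hmono.lt_iff_lt, hper, hes, hes, hn]
      nlinarith
    · rw [hpol, hpol (e.symm (y + 2 * π)), hes, hes, Real.cos_add_two_pi, Real.sin_add_two_pi,
        sub_eq_zero.1 hy]
  subst hn2
  rw [hpol a, hpol b, smul_smul] at h
  obtain ⟨h1, k, hk⟩ := polar_inj (hRpos a) (mul_pos hμ (hRpos b)) h
  have hg : Function.Periodic (fun φ => θ φ - φ) (2 * π) := by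
    intro φ; simp only [hper, hn]; push_cast; ring
  have hgk := hg.int_mul k b
  have hab : a = b + k * (2 * π) := by
    apply hmono.injective
    rw [hk]; linarith
  have hRab : R a = R b := by rw [hab]; exact hRper.int_mul k b
  rw [hRab] at h1
  have := hRpos b
  field_simp at h1
  linarith

lemma exists_opposite {P : ℝ → ℝ × ℝ} (hP : IsSmoothClosedCurve P) (hs : StarShapedWrt P 0)
    (φ : ℝ) : ∃ ψ l : ℝ, 0 < l ∧ P ψ = -l • P φ := by
  obtain ⟨θ, R, hθ, hmono, hsurj, hR, hRpos, hpol, c, hc, hper⟩ := exists_angle P hP hs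
  obtain ⟨ψ, hψ⟩ := hsurj (θ φ + π)
  have h1 := hRpos φ
  have h2 := hRpos ψ
  refine ⟨ψ, R ψ / R φ, by positivity, ?_⟩
  rw [hpol ψ, hpol φ, hψ, Real.cos_add_pi, Real.sin_add_pi]
  ext
  · simp; field_simp
  · simp; field_simp

lemma partial_deriv_eq {F : ℝ × ℝ → ℝ × ℝ} {I : Set ℝ}
    (hF : DifferentiableOn ℝ F (I ×ˢ univ)) {t φ : ℝ} (ht : t ∈ I) :
    HasDerivAt (fun φ => F (t, φ)) (fderivWithin ℝ F (I ×ˢ univ) (t, φ) (0, 1)) φ := by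
  have h1 := (hF (t, φ) ⟨ht, mem_univ _⟩).hasFDerivWithinAt
  have h4 : HasDerivWithinAt (fun ψ : ℝ => (t, ψ)) ((0 : ℝ), (1 : ℝ)) univ φ :=
    ((hasDerivAt_const _ _).prodMk (hasDerivAt_id _)).hasDerivWithinAt
  have := h1.comp_hasDerivWithinAt φ h4 (fun x _ => ⟨ht, mem_univ _⟩)
  exact hasDerivWithinAt_univ.1 this

lemma partial_smooth {F : ℝ × ℝ → ℝ × ℝ} {I : Set ℝ} (hI : UniqueDiffOn ℝ I)
    (hF : ContDiffOn ℝ (⊤ : ℕ∞) F (I ×ˢ univ)) :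
    ContDiffOn ℝ (⊤ : ℕ∞) (fun p : ℝ × ℝ => deriv (fun φ => F (p.1, φ)) p.2) (I ×ˢ univ) := by
  have h1 := hF.fderivWithin (hI.prod uniqueDiffOn_univ) (m := (⊤ : ℕ∞)) (by simp)
  have h2 := h1.clm_apply (contDiffOn_const (c := ((0:ℝ), (1:ℝ))))
  refine h2.congr ?_
  rintro ⟨t, φ⟩ ⟨ht, -⟩
  exact (partial_deriv_eq (hF.differentiableOn (by simp)) ht).deriv

lemma vdot_smul_lemma {a : ℝ × ℝ} {l : ℝ} (ha : 0 < vdot a a) :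
    -vdot a (-l • a) / vdot a a = l := by
  have : vdot a (-l • a) = -l * vdot a a := by simp [vdot]; ring
  rw [this]; field_simp

lemma two_le_infty : (2 : WithTop ℕ∞) ≤ ((⊤ : ℕ∞) : WithTop ℕ∞) := by
  exact WithTop.coe_le_coe.2 (le_top : (2 : ℕ∞) ≤ ⊤)

lemma deriv_nonneg_of_left_max {f : ℝ → ℝ} {f' x : ℝ} (h : HasDerivAt f f' x)
    (hm : ∀ᶠ t in 𝓝[<] x, f t ≤ f x) : 0 ≤ f' := by
  have h1 := (hasDerivAt_iff_tendsto_slope_left_right.1 h).1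
  refine ge_of_tendsto h1 ?_
  filter_upwards [hm, self_mem_nhdsWithin] with t h2 h3
  rw [slope_def_field]
  exact div_nonneg_of_nonpos (by linarith) (by linarith [mem_Iio.1 h3])

/-- Differential inequality at an interior space-time maximum. -/
lemma max_point_ineq (X : ℝ → ℝ → ℝ × ℝ) (X₀ : ℝ → ℝ × ℝ) (ω : ℝ)
    (hsol : IsGAPFSolutionOn X X₀ (Set.Ico 0 ω))
    (hstar : ∀ t ∈ Set.Ico (0:ℝ) ω, StarShapedWrt (X t) 0)
    (t₀ φ₀ ψ₀ l C K : ℝ) (ht₀ : t₀ ∈ Ioo 0 ω) (hl : 1 < l)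
    (hPQ : X t₀ ψ₀ = -l • X t₀ φ₀)
    (hmax : ∀ t ∈ Icc 0 t₀, ∀ φ ψ m, 0 < m → X t ψ = -m • X t φ →
      Real.exp (-C * t) * (m - 1) ≤ Real.exp (-C * t₀) * (l - 1))
    (hK : |curv (X t₀) φ₀| ≤ K * vdet (X t₀ φ₀) (unitTangent (X t₀) φ₀)) :
    C ≤ 2 * K := by
  have htI : t₀ ∈ Ico 0 ω := ⟨ht₀.1.le, ht₀.2⟩
  have hl0 : 0 < l := by linarith
  have hcur := hsol.curve t₀ htI
  have hsm := hcur.smooth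
  have hst := hstar t₀ htI
  have hdet := star_det hcur.regular hst
  have hX : ∀ φ, ContDiffAt ℝ (⊤ : ℕ∞) (fun p : ℝ × ℝ => X p.1 p.2) (t₀, φ) := fun φ =>
    hsol.smooth.contDiffAt (prod_mem_nhds (Ico_mem_nhds ht₀.1 ht₀.2) univ_mem)
  have hX2 : ∀ φ, ContDiffAt ℝ 2 (fun p : ℝ × ℝ => X p.1 p.2) (t₀, φ) := fun φ =>
    (hX φ).of_le two_le_infty
  have hsm2 : ContDiff ℝ 2 (X t₀) := hsm.of_le two_le_infty
  have hpp : 0 < vdot (X t₀ φ₀) (X t₀ φ₀) := vdot_self_pos (hdet φ₀).ne'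
  have hd0 : vdet (X t₀ φ₀) (X t₀ ψ₀) = 0 := by rw [hPQ]; simp [vdet]; ring
  have hd1 : vdot (X t₀ φ₀) (X t₀ ψ₀) < 0 := by
    have : vdot (X t₀ φ₀) (X t₀ ψ₀) = -(l * vdot (X t₀ φ₀) (X t₀ φ₀)) := by
      rw [hPQ]; simp [vdot]; ring
    rw [this]; have := mul_pos hl0 hpp; linarith
  have hd2 : vdet (X t₀ φ₀) (deriv (X t₀) ψ₀) ≠ 0 := by
    have h := hdet ψ₀
    have : vdet (X t₀ ψ₀) (deriv (X t₀) ψ₀) = -l * vdet (X t₀ φ₀) (deriv (X t₀) ψ₀) := by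
      rw [hPQ]; simp [vdet]; ring
    intro h0
    rw [this, h0] at h; simp at h
  have hderψ : HasDerivAt (X t₀) (deriv (X t₀) ψ₀) ψ₀ :=
    (hsm.differentiable (by simp) ψ₀).hasDerivAt
  have hlval : ∀ m : ℝ, X t₀ ψ₀ = -m • X t₀ φ₀ → m = l := by
    intro m hm
    rw [← vdot_smul_lemma (l := m) hpp, ← hm, hPQ, vdot_smul_lemma hpp]
  -- space
  obtain ⟨k, m, hk, hm, hk0, hev⟩ := ray_follow (X t₀) (fun p => X t₀ p.2) φ₀ ψ₀
    (deriv (X t₀) ψ₀) hsm2.contDiffAt (hsm2.contDiffAt.comp _ contDiffAt_snd) hd0 hd1 hderψ hd2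
  have hm0 : m φ₀ = l := hlval _ (by have := hev.self_of_nhds.1; simpa only [hk0] using this)
  have hmmax : IsLocalMax m φ₀ := by
    filter_upwards [hev] with s hs
    have := hmax t₀ ⟨ht₀.1.le, le_rfl⟩ s (k s) (m s) hs.2 hs.1
    have := le_of_mul_le_mul_left this (Real.exp_pos _)
    rw [hm0]; linarith
  obtain ⟨c, hc, hc1, hc2⟩ := space_cmp (X t₀) hsm k m φ₀ ψ₀ hk hm hk0
    (hev.mono fun s hs => hs.1) hmmax (by rw [hm0]; exact hl0) (hdet φ₀) (hdet ψ₀)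
  rw [hm0] at hc1 hc2
  obtain ⟨hT, hκ⟩ := curv_cmp hc hl0 (hcur.regular φ₀) hc1 hc2
  -- time
  have hXφ : ContDiffAt ℝ 2 (fun t => X t φ₀) t₀ :=
    ContDiffAt.comp (g := fun p : ℝ × ℝ => X p.1 p.2) (f := fun t : ℝ => (t, φ₀)) t₀ (hX2 φ₀)
      (contDiffAt_id.prodMk contDiffAt_const)
  obtain ⟨k₁, m₁, hk₁, hm₁, hk₁0, hev₁⟩ := ray_follow (fun t => X t φ₀) (fun p => X p.1 p.2) t₀ ψ₀
    (deriv (X t₀) ψ₀) hXφ (hX2 ψ₀) hd0 hd1 hderψ hd2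
  have hm₁0 : m₁ t₀ = l := hlval _ (by have := hev₁.self_of_nhds.1; simpa only [hk₁0] using this)
  obtain ⟨α, hα⟩ := hsol.flow
  have hnh : Ico 0 ω ∈ 𝓝 t₀ := Ico_mem_nhds ht₀.1 ht₀.2
  have hPt := (hα t₀ htI φ₀).hasDerivAt hnh
  obtain ⟨Pt, hPte⟩ : ∃ v, v = α t₀ φ₀ • unitTangent (X t₀) φ₀ +
    (curv (X t₀) φ₀ - 2 * π / clen (X t₀)) • innerNormal (X t₀) φ₀ := ⟨_, rfl⟩
  rw [← hPte] at hPt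
  have hQt := (hα t₀ htI ψ₀).hasDerivAt hnh
  have hk' := (hk₁.differentiableAt (by norm_num)).hasDerivAt
  have hm' := (hm₁.differentiableAt (by norm_num)).hasDerivAt
  have hF := ((hX2 ψ₀).differentiableAt (by norm_num)).hasFDerivAt
  set F' := fderiv ℝ (fun p : ℝ × ℝ => X p.1 p.2) (t₀, ψ₀)
  have hF1 : F' (1, 0) = _ := (hF.comp_hasDerivAt (f := fun t : ℝ => (t, ψ₀)) t₀
    ((hasDerivAt_id t₀).prodMk (hasDerivAt_const t₀ ψ₀))).unique hQt
  have hF2 : F' (0, 1) = _ := (hF.comp_hasDerivAt (f := fun ψ : ℝ => (t₀, ψ)) ψ₀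
    ((hasDerivAt_const ψ₀ t₀).prodMk (hasDerivAt_id ψ₀))).unique hderψ
  have hid : F' (1, 0) + deriv k₁ t₀ • F' (0, 1) = -l • Pt + -(deriv m₁ t₀) • X t₀ φ₀ := by
    have e1 : HasDerivAt (fun t => X t (k₁ t)) (F' (1, deriv k₁ t₀)) t₀ := by
      refine HasFDerivAt.comp_hasDerivAt (l := fun p : ℝ × ℝ => X p.1 p.2)
        (f := fun t => (t, k₁ t)) t₀ ?_ ((hasDerivAt_id t₀).prodMk hk')
      rw [hk₁0]; exact hF
    have e2 := hm'.neg.smul hPt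
    have e3 := e1.unique (e2.congr_of_eventuallyEq (hev₁.mono fun s hs => hs.1))
    rw [Pi.neg_apply, hm₁0] at e3
    rw [← e3, ← map_smul, ← map_add]
    simp
  have hti := time_identity (hcur.regular φ₀) (hcur.regular ψ₀) hT hPte hF1 (by rw [← hF2]; exact hid)
  have hσ : 0 < vdet (X t₀ φ₀) (unitTangent (X t₀) φ₀) := by
    have := hst φ₀; rwa [sub_zero] at this
  have hlen : 0 ≤ 2 * π / clen (X t₀) := by
    have : 0 ≤ clen (X t₀) := by
      unfold clen
      exact intervalIntegral.integral_nonneg (by positivity) fun _ _ => Real.sqrt_nonneg _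
    positivity
  have hfin := final_ineq hσ hl hlen hκ hK hti
  have hE : HasDerivAt (fun t => Real.exp (-C * t) * (m₁ t - 1))
      (Real.exp (-C * t₀) * (-C * 1) * (m₁ t₀ - 1) + Real.exp (-C * t₀) * deriv m₁ t₀) t₀ :=
    (((hasDerivAt_id t₀).const_mul (-C)).exp).mul (hm'.sub_const 1)
  have hE0 := deriv_nonneg_of_left_max hE (by
    have e1 : ∀ᶠ t in 𝓝 t₀, t ∈ Ioi (0:ℝ) := Ioi_mem_nhds ht₀.1
    filter_upwards [hev₁.filter_mono nhdsWithin_le_nhds, e1.filter_mono nhdsWithin_le_nhds,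
      self_mem_nhdsWithin] with t h1 h2 h3
    rw [hm₁0]
    exact hmax t ⟨(mem_Ioi.1 h2).le, (mem_Iio.1 h3).le⟩ φ₀ (k₁ t) (m₁ t) h1.2 h1.1)
  rw [hm₁0] at hE0
  have hexp := Real.exp_pos (-C * t₀)
  have h1 : 0 ≤ Real.exp (-C * t₀) * (deriv m₁ t₀ - C * (l - 1)) := by linarith
  have h2 := nonneg_of_mul_nonneg_right h1 hexp
  have h3 : C * (l - 1) ≤ 2 * K * (l - 1) := by linarith
  exact le_of_mul_le_mul_right h3 (by linarith)


lemma key_le_one (X : ℝ → ℝ → ℝ × ℝ) (X₀ : ℝ → ℝ × ℝ) (ω : ℝ)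
    (hX₀ : IsSmoothClosedCurve X₀) (hemb : IsEmbeddedCurve X₀)
    (hstar₀ : StarShapedWrt X₀ 0) (hsym₀ : CentroSymmetricWrt X₀ 0)
    (hsol : IsGAPFSolutionOn X X₀ (Set.Ico 0 ω))
    (hstar : ∀ t ∈ Set.Ico (0:ℝ) ω, StarShapedWrt (X t) 0)
    (T : ℝ) (hT : T ∈ Ico 0 ω) (φ ψ l : ℝ) (hl0 : 0 < l) (hl : X T ψ = -l • X T φ) : l ≤ 1 := by
  by_contra hcon
  push Not at hcon
  have hpi : (0:ℝ) < 2 * π := by positivity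
  have hTI : ∀ t ∈ Icc 0 T, t ∈ Ico 0 ω := fun t ht => ⟨ht.1, ht.2.trans_lt hT.2⟩
  have hdet : ∀ t ∈ Icc 0 T, ∀ φ, 0 < vdet (X t φ) (deriv (X t) φ) := fun t ht =>
    star_det (hsol.curve t (hTI t ht)).regular (hstar t (hTI t ht))
  have hpp : ∀ t ∈ Icc 0 T, ∀ φ, 0 < vdot (X t φ) (X t φ) := fun t ht φ =>
    vdot_self_pos (hdet t ht φ).ne'
  -- initial time
  have hinit : ∀ φ ψ l : ℝ, 0 < l → X 0 ψ = -l • X 0 φ → l = 1 := by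
    intro φ ψ l hl h
    rw [hsol.init, hsol.init] at h
    have h1 : -(X₀ φ) ∈ Set.range X₀ := by
      rw [← hsym₀]
      exact ⟨X₀ φ, ⟨φ, rfl⟩, by simp⟩
    obtain ⟨χ, hχ⟩ := h1
    exact ray_unique_s8 hX₀ hstar₀ hemb (a := ψ) (b := χ) hl (by rw [h, hχ]; simp)
  -- bound for the curvature
  have hI : UniqueDiffOn ℝ (Ico 0 ω) := uniqueDiffOn_Ico 0 ω
  have hD1 := partial_smooth hI hsol.smooth
  have hD2 := partial_smooth hI hD1
  have hsub : Icc 0 T ×ˢ Icc 0 (2 * π) ⊆ Ico 0 ω ×ˢ (univ : Set ℝ) :=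
    fun p hp => ⟨hTI _ hp.1, mem_univ _⟩
  have c0 := hsol.smooth.continuousOn.mono hsub
  have c1 := hD1.continuousOn.mono hsub
  have c2 := hD2.continuousOn.mono hsub
  simp only at c1 c2
  obtain ⟨K, hK⟩ : ∃ K, ∀ p ∈ Icc 0 T ×ˢ Icc 0 (2 * π),
      ‖vdet (deriv (X p.1) p.2) (deriv (deriv (X p.1)) p.2) /
        (vnorm (deriv (X p.1) p.2) ^ 2 * vdet (X p.1 p.2) (deriv (X p.1) p.2))‖ ≤ K := by
    apply (isCompact_Icc.prod isCompact_Icc).exists_bound_of_continuousOn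
    apply ContinuousOn.div
    · unfold vdet
      exact (c1.fst.mul c2.snd).sub (c1.snd.mul c2.fst)
    · simp only [vnorm_sq, vdet]
      exact ((c1.fst.pow 2).add (c1.snd.pow 2)).mul ((c0.fst.mul c1.snd).sub (c0.snd.mul c1.fst))
    · intro p hp
      have h1 := hdet p.1 hp.1 p.2
      have h2 := vnorm_pos ((hsol.curve p.1 (hTI _ hp.1)).regular p.2)
      positivity
  have hK' : ∀ t ∈ Icc 0 T, ∀ φ ∈ Icc 0 (2 * π),
      |curv (X t) φ| ≤ K * vdet (X t φ) (unitTangent (X t) φ) := by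
    intro t ht φ hφ
    have h1 := hdet t ht φ
    have h2 := vnorm_pos ((hsol.curve t (hTI _ ht)).regular φ)
    have h3 := hK (t, φ) ⟨ht, hφ⟩
    have hσ : 0 < vdet (X t φ) (unitTangent (X t) φ) := by
      have := hstar t (hTI t ht) φ; rwa [sub_zero] at this
    have hσe : vdet (X t φ) (unitTangent (X t) φ) =
        vdet (X t φ) (deriv (X t) φ) / vnorm (deriv (X t) φ) := by
      simp only [vdet, unitTangent, Prod.smul_fst, Prod.smul_snd, smul_eq_mul]
      field_simp
    have e : curv (X t) φ = vdet (deriv (X t) φ) (deriv (deriv (X t)) φ) /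
        (vnorm (deriv (X t) φ) ^ 2 * vdet (X t φ) (deriv (X t) φ)) *
        vdet (X t φ) (unitTangent (X t) φ) := by
      rw [hσe, curv]; field_simp
    rw [e, abs_mul, abs_of_pos hσ]
    exact mul_le_mul_of_nonneg_right h3 hσ.le
  -- the maximum
  set C := 2 * K + 1 with hC
  let S : Set (ℝ × ℝ × ℝ) := Icc 0 T ×ˢ Icc 0 (2 * π) ×ˢ Icc 0 (2 * π)
  have hSc : IsCompact S := isCompact_Icc.prod (isCompact_Icc.prod isCompact_Icc)
  have cP : ContinuousOn (fun p : ℝ × ℝ × ℝ => X p.1 p.2.1) S :=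
    c0.comp (f := fun p : ℝ × ℝ × ℝ => (p.1, p.2.1)) (by fun_prop)
      (fun p hp => ⟨hp.1, hp.2.1⟩)
  have cQ : ContinuousOn (fun p : ℝ × ℝ × ℝ => X p.1 p.2.2) S :=
    c0.comp (f := fun p : ℝ × ℝ × ℝ => (p.1, p.2.2)) (by fun_prop)
      (fun p hp => ⟨hp.1, hp.2.2⟩)
  have cdet : ContinuousOn (fun p : ℝ × ℝ × ℝ => vdet (X p.1 p.2.1) (X p.1 p.2.2)) S := by
    unfold vdet
    exact (cP.fst.mul cQ.snd).sub (cP.snd.mul cQ.fst)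
  have cdot : ContinuousOn (fun p : ℝ × ℝ × ℝ => vdot (X p.1 p.2.1) (X p.1 p.2.2)) S := by
    unfold vdot
    exact (cP.fst.mul cQ.fst).add (cP.snd.mul cQ.snd)
  have cdotP : ContinuousOn (fun p : ℝ × ℝ × ℝ => vdot (X p.1 p.2.1) (X p.1 p.2.1)) S := by
    unfold vdot
    exact (cP.fst.mul cP.fst).add (cP.snd.mul cP.snd)
  let S' := S ∩ (fun p : ℝ × ℝ × ℝ => vdet (X p.1 p.2.1) (X p.1 p.2.2)) ⁻¹' {0}
  have hS' : IsCompact S' :=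
    hSc.of_isClosed_subset (cdet.preimage_isClosed_of_isClosed hSc.isClosed isClosed_singleton)
      inter_subset_left
  let f : ℝ × ℝ × ℝ → ℝ := fun p => Real.exp (-C * p.1) *
    (-vdot (X p.1 p.2.1) (X p.1 p.2.2) / vdot (X p.1 p.2.1) (X p.1 p.2.1) - 1)
  have hf : ContinuousOn f S' := by
    have : ContinuousOn f S := by
      refine ContinuousOn.mul (by fun_prop) (ContinuousOn.sub (cdot.neg.div cdotP ?_) (by fun_prop))
      intro p hp
      exact (hpp p.1 hp.1 p.2.1).ne'
    exact this.mono inter_subset_left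
  -- every opposite pair is represented in `S'`
  have hrep : ∀ t ∈ Icc 0 T, ∀ φ ψ m : ℝ, X t ψ = -m • X t φ →
      ∃ p ∈ S', f p = Real.exp (-C * t) * (m - 1) := by
    intro t ht φ ψ m hm
    have hper := (hsol.curve t (hTI t ht)).periodic
    obtain ⟨i, hi, hi'⟩ := reduce_mod hper φ
    obtain ⟨j, hj, hj'⟩ := reduce_mod hper ψ
    refine ⟨(t, φ - i * (2 * π), ψ - j * (2 * π)),
      ⟨⟨ht, Ico_subset_Icc_self hi, Ico_subset_Icc_self hj⟩, ?_⟩, ?_⟩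
    · simp only [mem_preimage, mem_singleton_iff]
      rw [hi', hj', hm]; simp [vdet]; ring
    · simp only [f]
      rw [hi', hj', hm, vdot_smul_lemma (hpp t ht φ)]
  have hT0 : T ∈ Icc 0 T := ⟨hT.1, le_rfl⟩
  obtain ⟨p₁, hp₁, hfp₁⟩ := hrep T hT0 φ ψ l hl
  obtain ⟨⟨t₀, φ₀, ψ₀⟩, hp₀, hmax⟩ := hS'.exists_isMaxOn ⟨p₁, hp₁⟩ hf
  obtain ⟨⟨ht₀, hφ₀, hψ₀⟩, hd₀⟩ := hp₀
  simp only at ht₀ hφ₀ hψ₀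
  simp only [mem_preimage, mem_singleton_iff] at hd₀
  have hopp := opposite_of_vdet_zero hd₀ (hpp t₀ ht₀ φ₀)
  set l₀ := -vdot (X t₀ φ₀) (X t₀ ψ₀) / vdot (X t₀ φ₀) (X t₀ φ₀) with hl₀
  have hf₀ : f (t₀, φ₀, ψ₀) = Real.exp (-C * t₀) * (l₀ - 1) := rfl
  have hl₀1 : 1 < l₀ := by
    have h1 : f p₁ ≤ f (t₀, φ₀, ψ₀) := hmax hp₁
    rw [hfp₁, hf₀] at h1
    have h2 : 0 < Real.exp (-C * T) * (l - 1) := mul_pos (Real.exp_pos _) (by linarith)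
    have h3 := pos_of_mul_pos_right (h2.trans_le h1) (Real.exp_pos _).le
    linarith
  have ht₀pos : 0 < t₀ := by
    rcases ht₀.1.eq_or_lt with h | h
    · rw [← h] at hopp
      have := hinit φ₀ ψ₀ l₀ (by linarith) hopp
      linarith
    · exact h
  have := max_point_ineq X X₀ ω hsol hstar t₀ φ₀ ψ₀ l₀ C K ⟨ht₀pos, (hTI t₀ ht₀).2⟩ hl₀1 hopp
    (fun t ht φ ψ m _ hm => by
      obtain ⟨p, hp, hfp⟩ := hrep t ⟨ht.1, ht.2.trans ht₀.2⟩ φ ψ m hm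
      rw [← hfp, ← hf₀]; exact hmax hp) (hK' t₀ ht₀ φ₀ hφ₀)
  linarith

/-- If the evolving curve of Gage's area-preserving flow stays star-shaped with respect
to `O`, then it stays centrosymmetric with respect to `O`. -/
theorem gapf_preserves_centrosymmetry
    (X : ℝ → ℝ → ℝ × ℝ) (X₀ : ℝ → ℝ × ℝ) (ω : ℝ)
    (hX₀ : IsSmoothClosedCurve X₀) (hemb : IsEmbeddedCurve X₀)
    (hstar₀ : StarShapedWrt X₀ 0) (hsym₀ : CentroSymmetricWrt X₀ 0)
    (hsol : IsGAPFSolutionOn X X₀ (Set.Ico 0 ω))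
    (hstar : ∀ t ∈ Set.Ico (0:ℝ) ω, StarShapedWrt (X t) 0) :
    ∀ t ∈ Set.Ico (0:ℝ) ω, CentroSymmetricWrt (X t) 0 := by
  intro t ht
  have hneg : ∀ φ, -(X t φ) ∈ Set.range (X t) := by
    intro φ
    obtain ⟨ψ, l, hl, h⟩ := exists_opposite (hsol.curve t ht) (hstar t ht) φ
    have h1 := key_le_one X X₀ ω hX₀ hemb hstar₀ hsym₀ hsol hstar t ht φ ψ l hl h
    have h2 := key_le_one X X₀ ω hX₀ hemb hstar₀ hsym₀ hsol hstar t ht ψ φ l⁻¹ (inv_pos.2 hl) (by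
      rw [h, smul_smul]
      have : -l⁻¹ * -l = 1 := by field_simp
      rw [this, one_smul])
    have h3 : l = 1 := le_antisymm h1 ((inv_le_one₀ hl).1 h2)
    exact ⟨ψ, by rw [h, h3]; simp⟩
  unfold CentroSymmetricWrt
  ext Z
  constructor
  · rintro ⟨_, ⟨φ, rfl⟩, rfl⟩
    simpa using hneg φ
  · rintro ⟨φ, rfl⟩
    exact ⟨-(X t φ), hneg φ, by simp⟩
end
end
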